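/- For every prime p ≥ 5, the number L(p) of distinct roots of ss_p(X) in 𝔽_p equals (1/4)·(2 + (1 − (−1|p))·(2 + (−2|p)))·h(√−p); equivalently, L(p) = (1/2)·h(√−p) if p ≡ 1 (mod 4), L(p) = 2·h(√−p) if p ≡ 3 (mod 8), and L(p) = h(√−p) if p ≡ 7 (mod 8). -/

import Mathlib

open Polynomial

noncomputable section

/-- The class number h(√-d) of the imaginary quadratic field ℚ(√-d),
realized as the subfield of ℂ generated by i·√d. -/
def classNumberSqrtNeg (d : ℕ) : ℕ :=
  haveI : FiniteDimensional ℚ (IntermediateField.adjoin ℚ {(Complex.I * Real.sqrt d : ℂ)}) :=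
    IntermediateField.adjoin.finiteDimensional
      ⟨X ^ 2 + C (d : ℚ), monic_X_pow_add_C _ (by norm_num), by
        have h : (Complex.I * (Real.sqrt d : ℂ)) ^ 2 = -(d : ℂ) := by
          rw [mul_pow, Complex.I_sq, ← Complex.ofReal_pow, Real.sq_sqrt (Nat.cast_nonneg d)]
          simp
        simp [h]⟩
  haveI : NumberField (IntermediateField.adjoin ℚ {(Complex.I * Real.sqrt d : ℂ)}) := ⟨⟩
  NumberField.classNumber (IntermediateField.adjoin ℚ {(Complex.I * Real.sqrt d : ℂ)})

variable (p : ℕ) [Fact p.Prime]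

/-- ε = (1 - (-1|p))/2 -/
def eps : ℕ := ((1 - legendreSym p (-1)) / 2).toNat
/-- δ = (1 - (-3|p))/2 -/
def del : ℕ := ((1 - legendreSym p (-3)) / 2).toNat
/-- ν = (1 - (-2|p))/2 -/
def nu : ℕ := ((1 - legendreSym p (-2)) / 2).toNat

/-- The Pochhammer symbol (x)_n = x(x+1)⋯(x+n-1) in 𝔽_p. -/
def poch (x : ZMod p) (n : ℕ) : ZMod p := (ascPochhammer (ZMod p) n).eval x

/-- Deuring's supersingular polynomial ss_p(X) ∈ 𝔽_p[X], via its hypergeometric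
expression: (X-1728)^ε · Σ_{n=0}^{m} ((-m)_n (β)_n / (n!)²) 1728^n X^{m+δ-n},
with m = ⌊p/12⌋ and β = 5/12 - (2δ-3ε)/6. -/
def ssPoly : (ZMod p)[X] :=
  (X - C 1728) ^ eps p *
    ∑ n ∈ Finset.range (p / 12 + 1),
      C (poch p (-(p / 12 : ℕ) : ZMod p) n *
         poch p ((5 : ZMod p) / 12 - (((2 * (del p : ℤ) - 3 * (eps p : ℤ)) : ℤ) : ZMod p) / 6) n /
         ((n.factorial : ZMod p)) ^ 2 * 1728 ^ n) *
      X ^ (p / 12 + del p - n)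

/-- L(p): the number of distinct roots of ss_p(X) in 𝔽_p. -/
def LL : ℕ := (ssPoly p).roots.toFinset.card

namespace SSP

open UpperHalfPlane Function Complex
open scoped MatrixGroups Manifold Derivative ModularForm

/-- `f` is the sum of the power series `A` in the parameter `exp (2πiτ/h)`. -/
def HasQ (h : ℝ) (f : ℍ → ℂ) (A : PowerSeries ℂ) : Prop :=
  ∀ τ : ℍ, HasSum (fun n ↦ PowerSeries.coeff n A * Periodic.qParam h τ ^ n) (f τ)

namespace HasQ

variable {h : ℝ} {f g : ℍ → ℂ} {A B : PowerSeries ℂ}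

lemma add (hf : HasQ h f A) (hg : HasQ h g B) : HasQ h (f + g) (A + B) := fun τ ↦ by
  simpa [add_mul] using (hf τ).add (hg τ)

lemma smul (c : ℂ) (hf : HasQ h f A) : HasQ h (c • f) (c • A) := fun τ ↦ by
  simpa [mul_assoc] using (hf τ).mul_left c

lemma neg (hf : HasQ h f A) : HasQ h (-f) (-A) := fun τ ↦ by
  simpa using (hf τ).neg

lemma sub (hf : HasQ h f A) (hg : HasQ h g B) : HasQ h (f - g) (A - B) := by
  simpa [sub_eq_add_neg] using hf.add hg.neg

lemma mul (hf : HasQ h f A) (hg : HasQ h g B) : HasQ h (f * g) (A * B) := fun τ ↦ by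
  have h1 := (hf τ).summable.norm
  have h2 := (hg τ).summable.norm
  have h3 := tsum_mul_tsum_eq_tsum_sum_antidiagonal_of_summable_norm h1 h2
  have h4 := (summable_norm_sum_mul_antidiagonal_of_summable_norm h1 h2).of_norm
  rw [(hf τ).tsum_eq, (hg τ).tsum_eq] at h3
  have h5 := h4.hasSum
  rw [← h3] at h5
  suffices h6 : ∀ n, PowerSeries.coeff n (A * B) * Periodic.qParam h τ ^ n =
      ∑ kl ∈ Finset.HasAntidiagonal.antidiagonal n, PowerSeries.coeff kl.1 A * Periodic.qParam h τ ^ kl.1 *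
        (PowerSeries.coeff kl.2 B * Periodic.qParam h τ ^ kl.2) by
    simp_rw [h6]
    exact h5
  intro n
  rw [PowerSeries.coeff_mul, Finset.sum_mul]
  refine Finset.sum_congr rfl fun kl hkl ↦ ?_
  rw [← Finset.HasAntidiagonal.mem_antidiagonal.mp hkl, pow_add]
  ring

lemma const (c : ℂ) : HasQ h (fun _ ↦ c) (PowerSeries.C c) := fun τ ↦ by
  convert hasSum_single (f := fun n ↦ PowerSeries.coeff n (PowerSeries.C c) *
    Periodic.qParam h τ ^ n) 0 ?_ using 1
  · simp
  · intro n hn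
    simp [PowerSeries.coeff_C, hn]

lemma one : HasQ h (1 : ℍ → ℂ) 1 := by simpa using! const (h := h) 1

lemma pow (hf : HasQ h f A) (n : ℕ) : HasQ h (f ^ n) (A ^ n) := by
  induction n with
  | zero => simpa using one
  | succ n ih => simpa [pow_succ] using ih.mul hf

lemma sum {ι : Type*} (s : Finset ι) {f : ι → ℍ → ℂ} {A : ι → PowerSeries ℂ}
    (hf : ∀ i ∈ s, HasQ h (f i) (A i)) : HasQ h (∑ i ∈ s, f i) (∑ i ∈ s, A i) := by
  classical
  induction s using Finset.induction_on with
  | empty => simpa using! const (h := h) 0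
  | insert a s ha ih =>
    rw [Finset.sum_insert ha, Finset.sum_insert ha]
    exact (hf a (Finset.mem_insert_self a s)).add
      (ih fun i hi ↦ hf i (Finset.mem_insert_of_mem hi))

lemma prod {ι : Type*} (s : Finset ι) {f : ι → ℍ → ℂ} {A : ι → PowerSeries ℂ}
    (hf : ∀ i ∈ s, HasQ h (f i) (A i)) : HasQ h (∏ i ∈ s, f i) (∏ i ∈ s, A i) := by
  classical
  induction s using Finset.induction_on with
  | empty => simpa using one
  | insert a s ha ih =>
    rw [Finset.prod_insert ha, Finset.prod_insert ha]
    exact (hf a (Finset.mem_insert_self a s)).mul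
      (ih fun i hi ↦ hf i (Finset.mem_insert_of_mem hi))

lemma ext (hh : 0 < h) (hf : HasQ h f A) (hg : HasQ h f B) : A = B := by
  have h0 : HasQ h (0 : ℍ → ℂ) (A - B) := by simpa using hf.sub hg
  have hc : cuspFunction h (0 : ℍ → ℂ) = 0 := by
    ext z
    simp only [cuspFunction, Pi.zero_apply]
    by_cases hz : z = 0
    · subst hz
      rw [Periodic.cuspFunction_zero_eq_limUnder_nhds_ne]
      refine Filter.Tendsto.limUnder_eq ?_
      refine tendsto_const_nhds.congr' ?_
      filter_upwards [self_mem_nhdsWithin] with w hw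
      rw [Periodic.cuspFunction_eq_of_nonzero _ _ hw]
      rfl
    · rw [Periodic.cuspFunction_eq_of_nonzero _ _ hz]
      rfl
  have key := (hasFPowerSeriesOnBall_cuspFunction (f := (0 : ℍ → ℂ))
    (c := fun n ↦ PowerSeries.coeff n (A - B)) hh (by rw [hc]; exact analyticAt_const)
    (fun τ ↦ by simpa [sub_mul] using! h0 τ)).hasFPowerSeriesAt
  rw [hc] at key
  rw [← sub_eq_zero]
  ext n
  have := congrArg (fun P ↦ FormalMultilinearSeries.coeff P n) key.eq_zero
  simp only [FormalMultilinearSeries.coeff_ofScalars] at this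
  simpa [FormalMultilinearSeries.coeff] using this

lemma isBoundedAtImInfty (hh : 0 < h) (hf : HasQ h f A) : IsBoundedAtImInfty f :=
  isBoundedAtImInfty_of_hasSum_qExpansion hh (c := fun n ↦ PowerSeries.coeff n A)
    (fun τ ↦ by simpa using hf τ)

lemma norm_le (hh : 0 < h) {r : ℝ} {z : ℂ} (hz : r < z.im) (n : ℕ) (c : ℂ) :
    ‖c * Periodic.qParam h z ^ n‖ ≤ ‖c * Periodic.qParam h (r * Complex.I) ^ n‖ := by
  rw [norm_mul, norm_mul, norm_pow, norm_pow, Periodic.norm_qParam, Periodic.norm_qParam]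
  refine mul_le_mul_of_nonneg_left (pow_le_pow_left₀ (by positivity) (Real.exp_le_exp.2 ?_) n)
    (norm_nonneg _)
  rw [div_le_div_iff_of_pos_right hh, show ((r * Complex.I : ℂ)).im = r by simp]
  nlinarith [Real.pi_pos]

lemma differentiableOn_and_hasSum_deriv (hh : 0 < h) (hf : HasQ h f A) (τ : ℍ) :
    DifferentiableAt ℂ (f ∘ ofComplex) τ ∧
    HasSum (fun n ↦ deriv (fun z : ℂ ↦ PowerSeries.coeff n A * Periodic.qParam h z ^ n) τ)
      (deriv (f ∘ ofComplex) τ) := by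
  set r : ℝ := τ.im / 2 with hr
  have hr0 : 0 < r := by have := τ.im_pos; positivity
  let U : Set ℂ := {z | r < z.im}
  have hU : IsOpen U := isOpen_lt continuous_const Complex.continuous_im
  have hτ : (τ : ℂ) ∈ U := by
    change τ.im / 2 < τ.im
    linarith [τ.im_pos]
  let F : ℕ → ℂ → ℂ := fun n z ↦ PowerSeries.coeff n A * Periodic.qParam h z ^ n
  have hF : ∀ n, DifferentiableOn ℂ (F n) U := fun n ↦
    ((Periodic.differentiable_qParam.pow n).const_mul _).differentiableOn
  let τ' : ℍ := ⟨r * Complex.I, by simpa using hr0⟩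
  have hs : Summable fun n ↦ ‖F n (r * Complex.I)‖ := (hf τ').summable.norm
  have hle : ∀ (n : ℕ) (w : ℂ), w ∈ U → ‖F n w‖ ≤ ‖F n (r * Complex.I)‖ := fun n w hw ↦
    norm_le hh hw n _
  have heq : (fun w ↦ ∑' n, F n w) =ᶠ[nhds (τ : ℂ)] f ∘ ofComplex := by
    filter_upwards [hU.mem_nhds hτ] with w hw
    have hw' : 0 < w.im := hr0.trans hw
    have := (hf ⟨w, hw'⟩).tsum_eq
    simpa [F, ofComplex_apply_of_im_pos hw'] using this
  have h1 := Complex.hasSum_deriv_of_summable_norm hs hF hU hle hτ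
  have h2 := (Complex.differentiableOn_tsum_of_summable_norm hs hF hU hle).differentiableAt
    (hU.mem_nhds hτ)
  rw [heq.deriv_eq] at h1
  exact ⟨h2.congr_of_eventuallyEq heq.symm, h1⟩

lemma mdiff (hh : 0 < h) (hf : HasQ h f A) : MDiff f := by
  rw [mdifferentiable_iff]
  intro z hz
  exact ((hf.differentiableOn_and_hasSum_deriv hh ⟨z, hz⟩).1).differentiableWithinAt

lemma deriv (hf : HasQ 1 f A) :
    HasQ 1 (D f) (PowerSeries.X * PowerSeries.derivative ℂ A) := fun τ ↦ by
  have h1 := (hf.differentiableOn_and_hasSum_deriv one_pos τ).2.mul_left ((2 * Real.pi * Complex.I)⁻¹)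
  convert! h1 using 2 with n
  have hd : HasDerivAt (fun z : ℂ ↦ PowerSeries.coeff n A * Periodic.qParam 1 z ^ n)
      (PowerSeries.coeff n A * (n * Periodic.qParam 1 τ ^ (n - 1) *
        (Periodic.qParam 1 τ * (2 * Real.pi * Complex.I)))) τ := by
    refine HasDerivAt.const_mul _ (HasDerivAt.fun_pow ?_ n)
    have : HasDerivAt (fun z : ℂ ↦ 2 * Real.pi * Complex.I * z / (1 : ℝ)) (2 * Real.pi * Complex.I) τ := by
      simpa using (hasDerivAt_id (τ : ℂ)).const_mul (2 * Real.pi * Complex.I)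
    exact this.cexp
  rw [hd.deriv]
  have hpi : (2 * Real.pi * Complex.I : ℂ) ≠ 0 := two_pi_I_ne_zero
  cases n with
  | zero => simp
  | succ n =>
    rw [PowerSeries.coeff_succ_X_mul, PowerSeries.coeff_derivative]
    simp only [Nat.add_sub_cancel]
    field_simp
    push_cast
    ring

lemma comp (hf : HasQ 1 f A) (s : ℍ → ℍ) {N : ℕ} (hN : N ≠ 0) {c : ℂ}
    (hs : ∀ τ : ℍ, Periodic.qParam 1 (s τ) = c * Periodic.qParam h τ ^ N) :
    HasQ h (f ∘ s) (PowerSeries.expand N hN (PowerSeries.rescale c A)) := fun τ ↦ by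
  have hinj : Injective fun n : ℕ ↦ N * n := fun a b hab ↦
    Nat.eq_of_mul_eq_mul_left (Nat.pos_of_ne_zero hN) hab
  rw [← hinj.hasSum_iff]
  · convert hf (s τ) using 2 with n
    · simp only [comp_apply]
      rw [PowerSeries.coeff_expand_mul, PowerSeries.coeff_rescale, hs, mul_pow, pow_mul]
      ring
    · rfl
  · intro x hx
    have : ¬ N ∣ x := fun ⟨k, hk⟩ ↦ hx ⟨k, hk.symm⟩
    rw [PowerSeries.coeff_expand_of_not_dvd _ _ _ this, zero_mul]

lemma comp' (hf : HasQ 1 f A) {N : ℕ} (hN : N ≠ 0)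
    (hs : ∀ τ : ℍ, Periodic.qParam 1 τ = Periodic.qParam h τ ^ N) :
    HasQ h f (PowerSeries.expand N hN A) := by
  simpa using hf.comp (c := 1) id hN (by simpa using hs)

end HasQ

end SSP

namespace SSP

open UpperHalfPlane Function
open scoped MatrixGroups Manifold Derivative ModularForm

/-- `f` transforms like a level one form of weight `k` and has the `q`-expansion `A`. -/
structure LevelOne (k : ℤ) (f : ℍ → ℂ) (A : PowerSeries ℂ) : Prop where
  S_smul : ∀ τ : ℍ, f (ModularGroup.S • τ) = (τ : ℂ) ^ k * f τ
  hasQ : HasQ 1 f A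

lemma denom_SL (γ : SL(2, ℤ)) (τ : ℍ) : denom (γ : GL (Fin 2) ℝ) τ = (γ 1 0 : ℂ) * τ + γ 1 1 := by
  simp [denom]

lemma HasQ.periodic {f : ℍ → ℂ} {A : PowerSeries ℂ} (hf : HasQ 1 f A) (τ τ' : ℍ) (n : ℤ)
    (h : (τ' : ℂ) = τ + n) : f τ' = f τ := by
  refine (hf τ').unique ?_
  have : Periodic.qParam 1 (τ' : ℂ) = Periodic.qParam 1 (τ : ℂ) := by
    rw [h, Periodic.qParam, Periodic.qParam, Complex.exp_eq_exp_iff_exists_int]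
    exact ⟨n, by push_cast; ring⟩
  rw [this]
  exact hf τ

namespace LevelOne

variable {k l : ℤ} {f g : ℍ → ℂ} {A B : PowerSeries ℂ}

lemma slash_S (hf : LevelOne k f A) : f ∣[k] ModularGroup.S = f := by
  ext τ
  rw [ModularForm.SL_slash_apply, hf.S_smul, denom_SL]
  have : (τ : ℂ) ≠ 0 := ne_zero τ
  simp only [ModularGroup.S, Fin.isValue, Matrix.SpecialLinearGroup.coe_mk, Matrix.of_apply,
    Matrix.cons_val', Matrix.cons_val_zero, Matrix.cons_val_one, Matrix.cons_val_fin_one]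
  push_cast
  rw [one_mul, add_zero, zpow_neg, mul_right_comm, mul_inv_cancel₀ (zpow_ne_zero _ this), one_mul]

lemma slash_T (hf : LevelOne k f A) : f ∣[k] ModularGroup.T = f := by
  ext τ
  rw [ModularForm.SL_slash_apply, denom_SL]
  have h1 : f (ModularGroup.T • τ) = f τ := hf.hasQ.periodic _ _ 1 (by
    rw [modular_T_smul]; simp [add_comm])
  rw [h1]
  simp [ModularGroup.T]

lemma slash (hf : LevelOne k f A) (γ : SL(2, ℤ)) : f ∣[k] γ = f :=
  SlashInvariantForm.slash_action_generators_SL2Z hf.slash_S hf.slash_T γ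

/-- The modular form given by a level one function. -/
def toModularForm (hf : LevelOne k f A) : ModularForm 𝒮ℒ k where
  toFun := f
  slash_action_eq' M hM := by
    obtain ⟨M, rfl⟩ := hM
    exact hf.slash M
  holo' := hf.hasQ.mdiff one_pos
  bdd_at_cusps' hc := by
    rw [OnePoint.isBoundedAt_iff_forall_SL2Z hc]
    intro γ _
    rw [hf.slash γ]
    exact hf.hasQ.isBoundedAtImInfty one_pos

@[simp]
lemma coe_toModularForm (hf : LevelOne k f A) : ⇑hf.toModularForm = f := rfl

lemma smul_eq (hf : LevelOne k f A) (γ : SL(2, ℤ)) (τ : ℍ) :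
    f (γ • τ) = ((γ 1 0 : ℂ) * τ + γ 1 1) ^ k * f τ := by
  have h := congrFun (hf.slash γ) τ
  rw [ModularForm.SL_slash_apply] at h
  rw [← h, ← denom_SL, mul_comm, mul_assoc, ← zpow_add₀ (denom_ne_zero _ τ)]
  simp

lemma of_modularForm (F : ModularForm 𝒮ℒ k) : LevelOne k F (qExpansion 1 F) where
  S_smul τ := by
    have h := congrFun (SlashInvariantForm.slash_action_eqn F.toSlashInvariantForm
      (ModularGroup.S : GL (Fin 2) ℝ) ⟨_, rfl⟩) τ
    have h2 : ((F : ℍ → ℂ) ∣[k] ModularGroup.S) τ = F τ := h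
    rw [ModularForm.SL_slash_apply] at h2
    rw [← h2]
    have : denom (ModularGroup.S : GL (Fin 2) ℝ) τ = (τ : ℂ) := by
      rw [denom_SL]; simp [ModularGroup.S]
    rw [this, mul_comm, mul_assoc, ← zpow_add₀ (ne_zero τ)]
    simp
  hasQ τ := by
    simpa using ModularForm.hasSum_qExpansion (F := ModularForm 𝒮ℒ k) (f := F) one_pos
      one_mem_strictPeriods_SL τ

lemma add (hf : LevelOne k f A) (hg : LevelOne k g B) : LevelOne k (f + g) (A + B) :=
  ⟨fun τ ↦ by simp only [Pi.add_apply, hf.S_smul, hg.S_smul, mul_add], hf.hasQ.add hg.hasQ⟩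

lemma sub (hf : LevelOne k f A) (hg : LevelOne k g B) : LevelOne k (f - g) (A - B) :=
  ⟨fun τ ↦ by simp only [Pi.sub_apply, hf.S_smul, hg.S_smul, mul_sub], hf.hasQ.sub hg.hasQ⟩

lemma smul (c : ℂ) (hf : LevelOne k f A) : LevelOne k (c • f) (c • A) :=
  ⟨fun τ ↦ by simp only [Pi.smul_apply, hf.S_smul, smul_eq_mul]; ring, hf.hasQ.smul c⟩

lemma mul (hf : LevelOne k f A) (hg : LevelOne l g B) : LevelOne (k + l) (f * g) (A * B) :=
  ⟨fun τ ↦ by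
    simp only [Pi.mul_apply, hf.S_smul, hg.S_smul, zpow_add₀ (ne_zero τ)]; ring,
    hf.hasQ.mul hg.hasQ⟩

lemma one : LevelOne 0 (1 : ℍ → ℂ) 1 := ⟨fun τ ↦ by simp, HasQ.one⟩

lemma pow (hf : LevelOne k f A) (n : ℕ) : LevelOne (n * k) (f ^ n) (A ^ n) := by
  refine ⟨fun τ ↦ ?_, hf.hasQ.pow n⟩
  simp only [Pi.pow_apply, hf.S_smul, mul_pow]
  rw [← zpow_natCast, ← zpow_mul, mul_comm k]

lemma qExpansion_eq (hf : LevelOne k f A) : qExpansion 1 f = A :=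
  (of_modularForm hf.toModularForm).hasQ.ext one_pos hf.hasQ

/-- A level one function whose constant coefficient vanishes is divisible by `Δ`. -/
lemma exists_div (hf : LevelOne k f A) (h0 : PowerSeries.coeff 0 A = 0) :
    ∃ G : ModularForm 𝒮ℒ (k - 12), f = ModularForm.discriminant * ⇑G := by
  refine ⟨CuspForm.discriminantEquiv (ModularForm.toCuspForm hf.toModularForm
    (by rw [coe_toModularForm, hf.qExpansion_eq, h0])), ?_⟩
  ext τ
  have := ModularForm.discriminant_mul_discriminantEquiv_apply (ModularForm.toCuspForm hf.toModularForm
    (by rw [coe_toModularForm, hf.qExpansion_eq, h0])) τ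
  rw [Pi.mul_apply, this]
  rfl

end LevelOne

end SSP

namespace SSP

section Hom

variable {R S : Type*} [CommRing R] [CommRing S]

/-- The value at `(a, b)` of the degree `N` homogenization of `P`. -/
def hom (N : ℕ) (P : R[X]) (a b : R) : R := ∑ i ∈ Finset.range (N + 1), P.coeff i * a ^ i * b ^ (N - i)

lemma hom_eq_eval (N : ℕ) (P : R[X]) (a b : R) :
    hom N P a b = MvPolynomial.eval ![a, b] (P.homogenize N) := by
  rw [hom, homogenize, Finset.Nat.sum_antidiagonal_eq_sum_range_succ_mk, map_sum]
  refine Finset.sum_congr rfl fun i hi ↦ ?_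
  have : MvPolynomial.monomial (fun₀ | 0 => i | 1 => N - i : Fin 2 →₀ ℕ) (P.coeff i) =
      MvPolynomial.C (P.coeff i) * MvPolynomial.X 0 ^ i * MvPolynomial.X 1 ^ (N - i) := by
    rw [Finsupp.update_eq_add_single (by simp), MvPolynomial.monomial_add_single,
      MvPolynomial.C_mul_X_pow_eq_monomial]
  simp only [this]
  simp

lemma hom_mul {M N : ℕ} {P Q : R[X]} (hP : P.natDegree ≤ M) (hQ : Q.natDegree ≤ N) (a b : R) :
    hom (M + N) (P * Q) a b = hom M P a b * hom N Q a b := by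
  simp only [hom_eq_eval, homogenize_mul _ _ hP hQ, map_mul]

lemma hom_one (N : ℕ) (a b : R) : hom N 1 a b = b ^ N := by
  simp [hom_eq_eval]

lemma hom_pow {N : ℕ} {P : R[X]} (hP : P.natDegree ≤ N) (n : ℕ) (a b : R) :
    hom (n * N) (P ^ n) a b = hom N P a b ^ n := by
  induction n with
  | zero => simp [hom]
  | succ n ih =>
    rw [add_mul, one_mul, pow_succ, hom_mul (natDegree_pow_le_of_le n hP) hP, ih, pow_succ]

lemma hom_add (N : ℕ) (P Q : R[X]) (a b : R) : hom N (P + Q) a b = hom N P a b + hom N Q a b := by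
  simp [hom_eq_eval]

lemma hom_sub (N : ℕ) (P Q : R[X]) (a b : R) : hom N (P - Q) a b = hom N P a b - hom N Q a b := by
  simp [hom, sub_mul]

lemma hom_C_mul (N : ℕ) (c : R) (P : R[X]) (a b : R) : hom N (C c * P) a b = c * hom N P a b := by
  simp [hom_eq_eval]

lemma hom_X_pow {m N : ℕ} (h : m ≤ N) (a b : R) : hom N (X ^ m : R[X]) a b = a ^ m * b ^ (N - m) := by
  simp [hom_eq_eval, homogenize_X_pow h]

lemma hom_map (f : R →+* S) (N : ℕ) (P : R[X]) (a b : R) :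
    hom N (P.map f) (f a) (f b) = f (hom N P a b) := by
  simp [hom]

lemma hom_succ {N : ℕ} {P : R[X]} (hP : P.natDegree ≤ N) (a b : R) :
    hom (N + 1) P a b = b * hom N P a b := by
  have := hom_mul hP (natDegree_one (R := R).le.trans zero_le_one) a b
  rw [mul_one, hom_one, pow_one] at this
  rw [this, mul_comm]

lemma hom_eq_pow_mul {K : Type*} [Field K] {N : ℕ} {P : K[X]} (hP : P.natDegree ≤ N) (a : K) {b : K}
    (hb : b ≠ 0) : hom N P a b = b ^ N * P.eval (a / b) := by
  rw [hom, eval_eq_sum_range' (Nat.lt_succ_of_le hP), Finset.mul_sum]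
  refine Finset.sum_congr rfl fun i hi ↦ ?_
  have : i ≤ N := Nat.lt_succ_iff.mp (Finset.mem_range.mp hi)
  rw [← Nat.sub_add_cancel this, pow_add, Nat.add_sub_cancel, div_pow]
  field_simp

/-- A homogeneous relation between series of orders `0` and `1` is trivial. -/
lemma eq_zero_of_hom_eq_zero {A B : PowerSeries R} (hA : PowerSeries.coeff 0 A = 1)
    (hB : PowerSeries.coeff 0 B = 0) (hB1 : PowerSeries.coeff 1 B = 1) :
    ∀ (N : ℕ) {P : R[X]}, P.natDegree ≤ N → hom N (P.map (PowerSeries.C (R := R))) A B = 0 → P = 0 := by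
  have hA' : PowerSeries.constantCoeff A = 1 := by simpa using hA
  have hB' : PowerSeries.constantCoeff B = 0 := by simpa using hB
  obtain ⟨u, rfl⟩ := PowerSeries.X_dvd_iff.mpr hB'
  have hu : PowerSeries.constantCoeff u = 1 := by
    have := PowerSeries.coeff_succ_X_mul 0 u
    rw [zero_add, hB1] at this
    simpa using this.symm
  intro N
  induction N with
  | zero =>
    intro P hP h
    rw [eq_C_of_natDegree_le_zero hP] at h ⊢
    have h2 := congrArg PowerSeries.constantCoeff h
    simp [hom] at h2
    simp [h2]
  | succ N ih =>
    intro P hP h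
    have h2 := congrArg PowerSeries.constantCoeff h
    rw [hom, Finset.sum_range_succ, map_add, map_sum, Finset.sum_eq_zero] at h2
    · have h3 : P.coeff (N + 1) = 0 := by simpa [hA'] using h2
      have hP' : P.natDegree ≤ N := by
        by_contra! hlt
        have : P.natDegree = N + 1 := by omega
        rw [← this, coeff_natDegree, leadingCoeff_eq_zero] at h3
        simp [h3] at hlt
      rw [hom_succ ((natDegree_map_le).trans hP')] at h
      refine ih hP' ?_
      have hu' : IsUnit u := PowerSeries.isUnit_iff_constantCoeff.mpr (by simp [hu])
      rw [mul_assoc] at h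
      have h4 : u * hom N (P.map (PowerSeries.C (R := R))) A (PowerSeries.X * u) = 0 := by
        ext n
        rw [← PowerSeries.coeff_succ_X_mul, h]
        simp
      exact hu'.mul_right_eq_zero.mp h4
    · intro i hi
      have : N + 1 - i ≠ 0 := by have := Finset.mem_range.mp hi; omega
      simp [this]

end Hom

end SSP

namespace SSP

open UpperHalfPlane Function
open scoped MatrixGroups Manifold Derivative ModularForm ArithmeticFunction.sigma

section Series

variable (R : Type*) [CommRing R] {S : Type*} [CommRing S]

/-- The `q`-expansion of the Eisenstein series `E₄` over a ring. -/
def e4 : PowerSeries R := PowerSeries.mk fun n ↦ if n = 0 then 1 else 240 * (σ 3 n : R)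

/-- The `q`-expansion of the Eisenstein series `E₆` over a ring. -/
def e6 : PowerSeries R := PowerSeries.mk fun n ↦ if n = 0 then 1 else -504 * (σ 5 n : R)

/-- The `q`-expansion of the discriminant over a ring in which `1728` is invertible. -/
def dq : PowerSeries R := PowerSeries.C (Ring.inverse (1728 : R)) * (e4 R ^ 3 - e6 R ^ 2)

variable {R}

@[simp] lemma constantCoeff_e4 : PowerSeries.constantCoeff (e4 R) = 1 := by
  rw [← PowerSeries.coeff_zero_eq_constantCoeff_apply]; simp only [e4, PowerSeries.coeff_mk]; simp

@[simp] lemma constantCoeff_e6 : PowerSeries.constantCoeff (e6 R) = 1 := by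
  rw [← PowerSeries.coeff_zero_eq_constantCoeff_apply]; simp only [e6, PowerSeries.coeff_mk]; simp

@[simp] lemma constantCoeff_dq : PowerSeries.constantCoeff (dq R) = 0 := by simp [dq]

lemma coeff_one_dq (h : IsUnit (1728 : R)) : PowerSeries.coeff 1 (dq R) = 1 := by
  have h4 : PowerSeries.coeff 1 (e4 R) = 240 := by simp [e4]
  have h6 : PowerSeries.coeff 1 (e6 R) = -504 := by simp [e6]
  have h3 : PowerSeries.coeff 1 (e4 R ^ 3 - e6 R ^ 2) = 1728 := by
    simp [pow_succ, PowerSeries.coeff_mul, Finset.Nat.antidiagonal_succ, h4, h6]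
    norm_num
  rw [dq, PowerSeries.coeff_C_mul, h3, Ring.inverse_mul_cancel _ h]

@[simp] lemma map_e4 (φ : R →+* S) : (e4 R).map φ = e4 S := by
  ext n; simp only [e4, PowerSeries.coeff_map, PowerSeries.coeff_mk]
  split_ifs <;> simp [map_ofNat φ 240]

@[simp] lemma map_e6 (φ : R →+* S) : (e6 R).map φ = e6 S := by
  ext n; simp only [e6, PowerSeries.coeff_map, PowerSeries.coeff_mk]
  split_ifs <;> simp [map_ofNat φ 504]

lemma map_dq (h : IsUnit (1728 : R)) (φ : R →+* S) : (dq R).map φ = dq S := by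
  have h2 : IsUnit (1728 : S) := by simpa [map_ofNat φ 1728] using h.map φ
  have h3 : φ (Ring.inverse 1728) = Ring.inverse 1728 := by
    apply h2.mul_left_cancel
    rw [Ring.mul_inverse_cancel _ h2]
    have := congrArg φ (Ring.mul_inverse_cancel _ h)
    rwa [map_mul, map_one, map_ofNat φ 1728] at this
  simp [dq, h3]

lemma mul_dq (h : IsUnit (1728 : R)) : 1728 * dq R = e4 R ^ 3 - e6 R ^ 2 := by
  rw [dq, ← mul_assoc]
  have : (1728 : PowerSeries R) = PowerSeries.C 1728 := (map_ofNat _ 1728).symm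
  rw [this, ← map_mul, Ring.mul_inverse_cancel _ h, map_one, one_mul]

lemma exists_dq_eq (h : IsUnit (1728 : R)) : ∃ u : (PowerSeries R)ˣ, dq R = PowerSeries.X * (u : PowerSeries R) := by
  obtain ⟨u, hu⟩ := PowerSeries.X_dvd_iff.mpr (constantCoeff_dq (R := R))
  have h1 := coeff_one_dq h
  rw [hu] at h1
  have h2 := PowerSeries.coeff_succ_X_mul 0 u
  rw [zero_add, h1] at h2
  have hu' : IsUnit u := PowerSeries.isUnit_iff_constantCoeff.mpr (by
    rw [← PowerSeries.coeff_zero_eq_constantCoeff_apply, ← h2]; exact isUnit_one)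
  exact ⟨hu'.unit, by simpa using hu⟩

end Series

lemma isUnit_1728 : IsUnit (1728 : ℂ) := by norm_num

lemma levelOne_E₄ : LevelOne 4 ModularForm.E₄ (e4 ℂ) := by
  convert LevelOne.of_modularForm ModularForm.E₄ using 1
  ext n
  rw [ModularForm.E₄, EisensteinSeries.E_qExpansion_coeff _ ⟨2, rfl⟩]
  simp only [e4, PowerSeries.coeff_mk]
  norm_num [show _root_.bernoulli 4 = -1 / 30 by decide +kernel]

lemma levelOne_E₆ : LevelOne 6 ModularForm.E₆ (e6 ℂ) := by
  convert LevelOne.of_modularForm ModularForm.E₆ using 1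
  ext n
  rw [ModularForm.E₆, EisensteinSeries.E_qExpansion_coeff _ ⟨3, rfl⟩]
  simp only [e6, PowerSeries.coeff_mk]
  norm_num [show _root_.bernoulli 6 = 1 / 42 by decide +kernel]

lemma levelOne_discriminant : LevelOne 12 ModularForm.discriminant (dq ℂ) := by
  have h4 := levelOne_E₄.pow 3
  have h6 := levelOne_E₆.pow 2
  have h := (LevelOne.sub (k := 12) (by exact_mod_cast h4) (by exact_mod_cast h6)).smul (1728⁻¹ : ℂ)
  convert h using 1
  · ext τ
    simp [ModularForm.discriminant_eq_E₄_cube_sub_E₆_sq]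
    ring
  · rw [dq, PowerSeries.smul_eq_C_mul, Ring.inverse_eq_inv]

/-- A level one form of weight `12 N + 4 a + 6 b` with coefficients in `R` is `E₄ ^ a * E₆ ^ b` times
a homogeneous polynomial over `R` in `E₄ ^ 3` and `Δ`. -/
lemma exists_poly {R : Type*} [CommRing R] {φ : R →+* ℂ} (hφ : Injective φ)
    (hR : IsUnit (1728 : R)) (a b : ℕ)
    (hab : ∀ F : ModularForm 𝒮ℒ (4 * a + 6 * b - 12), (F : ℍ → ℂ) = 0) :
    ∀ (N : ℕ) {f : ℍ → ℂ} {A : PowerSeries R}, LevelOne (12 * N + (4 * a + 6 * b)) f (A.map φ) →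
    ∃ P : R[X], P.natDegree ≤ N ∧
      A = e4 R ^ a * e6 R ^ b * hom N (P.map (PowerSeries.C (R := R))) (e4 R ^ 3) (dq R) := by
  have hinj : Injective (PowerSeries.map φ) := fun x y hxy ↦ by
    ext n
    exact hφ (by simpa using congrArg (PowerSeries.coeff n) hxy)
  have key : ∀ (N : ℕ) {f : ℍ → ℂ} {A : PowerSeries R},
      LevelOne (12 * N + (4 * a + 6 * b)) f (A.map φ) →
      ∃ (B : PowerSeries R) (G : ModularForm 𝒮ℒ (12 * N + (4 * a + 6 * b) - 12)),
      LevelOne (12 * N + (4 * a + 6 * b) - 12) G (B.map φ) ∧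
      A = PowerSeries.C (PowerSeries.constantCoeff A) * (e4 R ^ (a + 3 * N) * e6 R ^ b) + dq R * B := by
    intro N f A hf
    set c := PowerSeries.constantCoeff A
    have h1 := ((levelOne_E₄.pow (a + 3 * N)).mul (levelOne_E₆.pow b)).smul (φ c)
    have h2 := hf.sub (B := (PowerSeries.C c * (e4 R ^ (a + 3 * N) * e6 R ^ b)).map φ)
      (g := φ c • (⇑ModularForm.E₄ ^ (a + 3 * N) * ⇑ModularForm.E₆ ^ b)) (by
        convert h1 using 1
        · push_cast; ring
        · simp [PowerSeries.smul_eq_C_mul])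
    rw [← map_sub] at h2
    have h0 : PowerSeries.constantCoeff (A - PowerSeries.C c * (e4 R ^ (a + 3 * N) * e6 R ^ b)) = 0 := by
      simp [c]
    obtain ⟨A', hA'⟩ := PowerSeries.X_dvd_iff.mpr h0
    obtain ⟨G, hG⟩ := h2.exists_div (by rw [hA']; simp)
    obtain ⟨u, hu⟩ := exists_dq_eq hR
    refine ⟨↑u⁻¹ * A', G, ?_, ?_⟩
    · have hG' := LevelOne.of_modularForm G
      have h3 := (levelOne_discriminant.hasQ.mul hG'.hasQ).ext one_pos (hG ▸ h2.hasQ)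
      rw [← map_dq hR φ, hu, hA', map_mul, map_mul, mul_assoc, PowerSeries.map_X] at h3
      have h4 := mul_left_cancel₀ PowerSeries.X_ne_zero h3
      have h5 : qExpansion 1 G = (↑u⁻¹ * A').map φ := by
        rw [map_mul, ← h4, ← mul_assoc, ← map_mul, Units.inv_mul, map_one, one_mul]
      rwa [h5] at hG'
    · rw [hu, mul_assoc, Units.mul_inv_cancel_left, ← hA']
      ring
  intro N
  induction N with
  | zero =>
    intro f A hf
    obtain ⟨B, G, hG, hA⟩ := key 0 hf
    have hG0 : (G : ℍ → ℂ) = 0 := by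
      have : ∀ (k : ℤ), k = 4 * a + 6 * b - 12 → ∀ F : ModularForm 𝒮ℒ k, (F : ℍ → ℂ) = 0 := by
        rintro k rfl F; exact hab F
      exact this _ (by simp) G
    have hB : B = 0 := by
      apply hinj
      rw [map_zero]
      refine hG.hasQ.ext one_pos ?_
      rw [hG0]
      simpa using! HasQ.const (h := 1) 0
    refine ⟨C (PowerSeries.constantCoeff A), by simp, ?_⟩
    rw [hB] at hA
    rw [hA]
    simp [hom]
    ring
  | succ N ih =>
    intro f A hf
    obtain ⟨B, G, hG, hA⟩ := key (N + 1) hf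
    obtain ⟨P, hP, hB⟩ := ih (f := G) (A := B) (by convert hG using 1; push_cast; ring)
    refine ⟨C (PowerSeries.constantCoeff A) * X ^ (N + 1) + P, ?_, ?_⟩
    · refine (natDegree_add_le _ _).trans (max_le ?_ (hP.trans (Nat.le_succ N)))
      exact natDegree_C_mul_X_pow_le _ _
    · rw [Polynomial.map_add, hom_add, hom_succ (natDegree_map_le.trans hP), Polynomial.map_mul,
        Polynomial.map_C, Polynomial.map_pow, map_X, hom_C_mul, hom_X_pow le_rfl, Nat.sub_self,
        pow_zero, mul_one]
      conv_lhs => rw [hA, hB]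
      ring

lemma HasQ.eq {h : ℝ} {f g : ℍ → ℂ} {A : PowerSeries ℂ} (hf : HasQ h f A) (hg : HasQ h g A) :
    f = g := funext fun τ ↦ (hf τ).unique (hg τ)

lemma HasQ.hom {h : ℝ} {f g : ℍ → ℂ} {A B : PowerSeries ℂ} (hf : HasQ h f A) (hg : HasQ h g B)
    (N : ℕ) (P : ℂ[X]) : HasQ h (fun τ ↦ hom N P (f τ) (g τ))
      (SSP.hom N (P.map (PowerSeries.C (R := ℂ))) A B) := by
  convert HasQ.sum (Finset.range (N + 1)) (f := fun i ↦ (P.coeff i) • (f ^ i * g ^ (N - i)))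
    (A := fun i ↦ (P.coeff i) • (A ^ i * B ^ (N - i))) (fun i _ ↦ ((hf.pow i).mul (hg.pow (N - i))).smul _) using 1
  · ext τ
    simp [SSP.hom, mul_assoc]
  · simp [SSP.hom, PowerSeries.smul_eq_C_mul, mul_assoc]

/-- The pointwise form of a polynomial expression for `q`-expansions. -/
lemma eq_hom_of_eq {R : Type*} [CommRing R] {φ : R →+* ℂ} (hR : IsUnit (1728 : R)) {a b N : ℕ}
    {f : ℍ → ℂ} {A : PowerSeries R} (hf : HasQ 1 f (A.map φ)) {P : R[X]}
    (hA : A = e4 R ^ a * e6 R ^ b * hom N (P.map (PowerSeries.C (R := R))) (e4 R ^ 3) (dq R)) (τ : ℍ) :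
    f τ = ModularForm.E₄ τ ^ a * ModularForm.E₆ τ ^ b *
      hom N (P.map φ) (ModularForm.E₄ τ ^ 3) (ModularForm.discriminant τ) := by
  have h1 := (((levelOne_E₄.hasQ.pow a).mul (levelOne_E₆.hasQ.pow b)).mul
    ((levelOne_E₄.hasQ.pow 3).hom levelOne_discriminant.hasQ N (P.map φ)))
  have h2 := hf.eq (g := _) (by
    convert h1 using 1
    rw [hA, map_mul, map_mul, map_pow, map_pow, map_e4, map_e6, ← hom_map, map_pow, map_e4, map_dq hR,
      Polynomial.map_map, Polynomial.map_map]
    congr 2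
    ext n : 2
    simp)
  simpa using! congrFun h2 τ

end SSP

namespace SSP

open UpperHalfPlane Function IsLocalRing
open scoped MatrixGroups ModularForm ArithmeticFunction.sigma

lemma exists_valuationSubring : ∃ V : ValuationSubring ℂ, (p : V) ∈ maximalIdeal V := by
  have hI : Ideal.span {(p : (⊥ : Subring ℂ))} ≠ ⊤ := by
    rw [Ne, Ideal.span_singleton_eq_top]
    intro h
    obtain ⟨⟨u, hu⟩, h1⟩ := isUnit_iff_exists_inv.mp h
    obtain ⟨n, rfl⟩ := Subring.mem_bot.mp hu
    have h2 : (p : ℂ) * n = 1 := congrArg Subtype.val h1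
    have h3 : (p : ℤ) * n = 1 := by exact_mod_cast h2
    have h4 := Int.eq_one_or_neg_one_of_mul_eq_one h3
    have := (Fact.out : p.Prime).two_le
    omega
  obtain ⟨V, -, hV⟩ := Ideal.image_subset_nonunits_valuationSubring _ hI
  have h1 : (p : ℂ) ∈ V.nonunits := hV ⟨_, Ideal.subset_span rfl, by simp⟩
  refine ⟨V, ?_⟩
  rw [V.mem_nonunits_iff] at h1
  rw [V.valuation_lt_one_iff]
  simpa using! h1

section PAdic

variable (V : ValuationSubring ℂ)

/-- The residue field of a valuation subring of `ℂ`. -/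
abbrev kap : Type := ResidueField V

/-- The residue map of a valuation subring of `ℂ`. -/
abbrev res : V →+* kap V := residue V

variable [hV : Fact ((p : V) ∈ maximalIdeal V)]

lemma charP_kap : CharP (kap V) p := by
  have h : (p : kap V) = 0 := by simpa using (residue_eq_zero_iff (p : V)).mpr hV.out
  obtain ⟨q, hq⟩ := CharP.exists (kap V)
  have h2 := (CharP.cast_eq_zero_iff (kap V) q p).mp h
  rcases (Nat.dvd_prime Fact.out).mp h2 with rfl | rfl
  · exact absurd rfl (CharP.char_ne_one (kap V) 1)
  · exact hq

lemma isUnit_natCast {n : ℕ} (hn : ¬ p ∣ n) : IsUnit (n : V) := by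
  have := charP_kap p V
  have h : res V n ≠ 0 := by
    rw [map_natCast]
    exact fun h ↦ hn ((CharP.cast_eq_zero_iff (kap V) p n).mp h)
  by_contra h2
  exact h ((residue_eq_zero_iff _).mpr ((mem_maximalIdeal _).mpr h2))

lemma not_dvd_1728 (hp : 5 ≤ p) : ¬ p ∣ 1728 := by
  intro h
  have h2 : p ∣ 12 := (Fact.out : p.Prime).dvd_of_dvd_pow (show p ∣ 12 ^ 3 by norm_num; exact h)
  have : p ≤ 12 := Nat.le_of_dvd (by norm_num) h2
  have hpp : p.Prime := Fact.out
  interval_cases p <;> revert h2 hpp <;> decide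

lemma isUnit_1728_V (hp : 5 ≤ p) : IsUnit (1728 : V) := by
  have := isUnit_natCast p V (not_dvd_1728 p hp)
  exact_mod_cast this

lemma isUnit_1728_kap (hp : 5 ≤ p) : IsUnit (1728 : kap V) := by
  have := (isUnit_1728_V p V hp).map (res V)
  rwa [map_ofNat (res V) 1728] at this

lemma exists_bernoulli (hp : 5 ≤ p) : ∃ B : V, IsUnit B ∧ (B : ℂ) = p * (_root_.bernoulli (p - 1) : ℚ) := by
  have hpp : p.Prime := Fact.out
  have hp1 := hpp.one_lt
  obtain ⟨k, hk⟩ := (hpp.even_sub_one (by omega)).two_dvd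
  obtain ⟨n, hn⟩ := Bernoulli.vonStaudt_clausen k
  rw [← hk, show p - 1 + 2 = p + 1 by omega] at hn
  set s := (Finset.range (p + 1)).filter fun q ↦ q.Prime ∧ (q - 1) ∣ (p - 1) with hs
  have hps : p ∈ s := by simp [hs, hpp]
  have hmem : ∀ q ∈ s.erase p, IsUnit (q : V) := by
    intro q hq
    obtain ⟨hqp, hq⟩ := Finset.mem_erase.mp hq
    have hq' : q.Prime := by simp [hs] at hq; exact hq.2.1
    exact isUnit_natCast p V fun h ↦ hqp ((Nat.prime_dvd_prime_iff_eq hpp hq').mp h).symm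
  have hex : ∃ c : V, (c : ℂ) = ∑ q ∈ s.erase p, (1 : ℂ) / q := by
    refine ⟨∑ q ∈ (s.erase p).attach, ↑(hmem q.1 q.2).unit⁻¹, ?_⟩
    rw [← Finset.sum_attach (s.erase p) fun q ↦ (1 : ℂ) / q]
    push_cast
    refine Finset.sum_congr rfl fun q hq ↦ ?_
    rw [one_div]
    refine eq_inv_of_mul_eq_one_left ?_
    exact_mod_cast congrArg Subtype.val (hmem q.1 q.2).val_inv_mul
  obtain ⟨c, hc⟩ := hex
  refine ⟨p * n - 1 - p * c, ?_, ?_⟩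
  · by_contra h
    have h2 : res V (p * n - 1 - p * c) = 0 := (residue_eq_zero_iff _).mpr ((mem_maximalIdeal _).mpr h)
    have h3 : res V (p : V) = 0 := (residue_eq_zero_iff _).mpr hV.out
    simp only [map_sub, map_mul, h3, map_one] at h2
    simp at h2
  · have h4 := congrArg (fun x : ℚ ↦ (x : ℂ)) hn
    rw [← Finset.add_sum_erase _ _ hps] at h4
    push_cast at h4 ⊢
    have hp0 : (p : ℂ) ≠ 0 := by exact_mod_cast hpp.ne_zero
    rw [← hc] at h4
    rw [h4]
    field_simp
    ring

lemma exists_eisenstein (hp : 5 ≤ p) : ∃ A : PowerSeries V, (∃ f, LevelOne (p - 1) f (A.map V.subtype)) ∧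
    A.map (res V) = 1 := by
  obtain ⟨B, hB, hB'⟩ := exists_bernoulli p V hp
  obtain ⟨u, rfl⟩ := hB
  have hk : 3 ≤ p - 1 := by omega
  have hk2 : Even (p - 1) := (Fact.out : p.Prime).even_sub_one (by omega)
  refine ⟨PowerSeries.mk fun n ↦ if n = 0 then 1 else -(2 * (p - 1 : ℕ) * p * ↑u⁻¹ * (σ (p - 2) n : V)),
    ⟨ModularForm.E hk, ?_⟩, ?_⟩
  · have h1 := LevelOne.of_modularForm (ModularForm.E hk)
    convert h1 using 1
    · have : 1 ≤ p := by omega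
      push_cast [this]; ring
    · ext n
      rw [EisensteinSeries.E_qExpansion_coeff hk hk2]
      simp only [PowerSeries.coeff_map, PowerSeries.coeff_mk]
      split_ifs
      · simp
      · have h2 : ((↑u⁻¹ : V) : ℂ) = (p * (_root_.bernoulli (p - 1) : ℚ) : ℂ)⁻¹ := by
          rw [← hB']
          refine eq_inv_of_mul_eq_one_left ?_
          exact_mod_cast congrArg Subtype.val u.inv_mul
        have hp0 : (p : ℂ) ≠ 0 := by exact_mod_cast (Fact.out : p.Prime).ne_zero
        rw [show p - 1 - 1 = p - 2 by omega]
        simp only [map_neg, map_mul, map_natCast, ValuationSubring.subtype_apply, h2, map_ofNat]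
        field_simp
  · ext n
    simp only [PowerSeries.coeff_map, PowerSeries.coeff_mk, PowerSeries.coeff_one]
    split_ifs
    · simp
    · have := charP_kap p V
      rw [map_neg, map_mul, map_mul, map_mul, map_natCast (res V) p, CharP.cast_eq_zero (kap V) p]
      ring

end PAdic

end SSP

namespace SSP

open UpperHalfPlane Function IsLocalRing
open scoped MatrixGroups ModularForm

section Legendre

lemma legendreSym_neg_one (hp : 5 ≤ p) : legendreSym p (-1) = if p % 4 = 1 then 1 else -1 := by
  have h2 : p ≠ 2 := by omega
  have hodd : p % 2 = 1 := (Fact.out : p.Prime).eq_two_or_odd.resolve_left h2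
  rw [legendreSym.at_neg_one h2, ZMod.χ₄_nat_eq_if_mod_four]
  split_ifs <;> omega

lemma legendreSym_neg_three (hp : 5 ≤ p) : legendreSym p (-3) = if p % 3 = 1 then 1 else -1 := by
  have h2 : p ≠ 2 := by omega
  have hodd : p % 2 = 1 := (Fact.out : p.Prime).eq_two_or_odd.resolve_left h2
  have h3 : p % 3 ≠ 0 := fun h ↦ by
    have := (Nat.prime_dvd_prime_iff_eq Nat.prime_three (Fact.out : p.Prime)).mp (Nat.dvd_of_mod_eq_zero h)
    omega
  have key : legendreSym p (-3) = legendreSym 3 p := by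
    rw [show (-3 : ℤ) = -1 * 3 by norm_num, legendreSym.mul, legendreSym_neg_one p hp]
    split_ifs with h
    · have := legendreSym.quadratic_reciprocity_one_mod_four (p := p) (q := 3) h (by norm_num)
      rw [this]; simp
    · have := legendreSym.quadratic_reciprocity_three_mod_four (p := p) (q := 3) (by omega) (by norm_num)
      rw [this]; simp
  rw [key, legendreSym.mod]
  have h4 : ((p : ℤ) % (3 : ℕ)) = ((p % 3 : ℕ) : ℤ) := by simp
  rw [h4]
  have h5 : p % 3 = 1 ∨ p % 3 = 2 := by omega
  rcases h5 with h5 | h5 <;> rw [h5] <;> decide +kernel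

lemma eps_eq (hp : 5 ≤ p) : eps p = if p % 4 = 1 then 0 else 1 := by
  rw [eps, legendreSym_neg_one p hp]; split_ifs <;> rfl

lemma del_eq (hp : 5 ≤ p) : del p = if p % 3 = 1 then 0 else 1 := by
  rw [del, legendreSym_neg_three p hp]; split_ifs <;> rfl

lemma eq_twelve_mul_add (hp : 5 ≤ p) : p = 12 * (p / 12) + 4 * del p + 6 * eps p + 1 := by
  have hodd : p % 2 = 1 := (Fact.out : p.Prime).eq_two_or_odd.resolve_left (by omega)
  have h3 : p % 3 ≠ 0 := fun h ↦ by
    have := (Nat.prime_dvd_prime_iff_eq Nat.prime_three (Fact.out : p.Prime)).mp (Nat.dvd_of_mod_eq_zero h)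
    omega
  rw [eps_eq p hp, del_eq p hp]
  split_ifs <;> omega

lemma eps_lt_two (hp : 5 ≤ p) : eps p < 2 := by rw [eps_eq p hp]; split_ifs <;> norm_num

lemma del_lt_two (hp : 5 ≤ p) : del p < 2 := by rw [del_eq p hp]; split_ifs <;> norm_num

end Legendre

variable (V : ValuationSubring ℂ) [hV : Fact ((p : V) ∈ maximalIdeal V)]

/-- The Hasse invariant is `1`, in terms of `E₄`, `E₆`, `Δ` over the residue field. -/
lemma exists_hasse (hp : 5 ≤ p) : ∃ F : (kap V)[X], F.natDegree ≤ p / 12 ∧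
    e4 (kap V) ^ del p * e6 (kap V) ^ eps p *
      hom (p / 12) (F.map (PowerSeries.C (R := kap V))) (e4 (kap V) ^ 3) (dq (kap V)) = 1 := by
  obtain ⟨A, ⟨f, hf⟩, hA⟩ := exists_eisenstein p V hp
  have hd := del_lt_two p hp
  have he := eps_lt_two p hp
  have hab : ∀ F : ModularForm 𝒮ℒ (4 * del p + 6 * eps p - 12), (F : ℍ → ℂ) = 0 := fun F ↦
    ModularFormClass.levelOne_neg_weight_eq_zero (by omega) F
  obtain ⟨P, hP, hP2⟩ := exists_poly V.subtype_injective (isUnit_1728_V p V hp) (del p) (eps p) hab (p / 12)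
    (f := f) (A := A) (by
      convert hf using 1
      have := eq_twelve_mul_add p hp
      omega)
  refine ⟨P.map (res V), natDegree_map_le.trans hP, ?_⟩
  have h := congrArg (PowerSeries.map (res V)) hP2
  rw [hA, map_mul, map_mul, map_pow, map_pow, map_e4, map_e6, ← hom_map, map_pow, map_e4,
    map_dq (isUnit_1728_V p V hp), Polynomial.map_map] at h
  rw [h, Polynomial.map_map]
  congr 3
  ext n : 2
  simp

end SSP

namespace SSP

open UpperHalfPlane Function
open scoped MatrixGroups ModularForm Manifold Derivative ArithmeticFunction.sigma

section Ramanujan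

lemma slash_S_apply (f : ℍ → ℂ) (k : ℤ) (τ : ℍ) :
    f (ModularGroup.S • τ) = (τ : ℂ) ^ k * (f ∣[k] ModularGroup.S) τ := by
  have : denom (ModularGroup.S : GL (Fin 2) ℝ) τ = (τ : ℂ) := by
    rw [denom_SL]; simp [ModularGroup.S]
  rw [ModularForm.SL_slash_apply, this, mul_left_comm, ← zpow_add₀ (ne_zero τ)]
  simp

lemma slash_S_deriv {k : ℤ} {F : ℍ → ℂ} (hF : MDiff F) (τ : ℍ) :
    (D F ∣[k + 2] ModularGroup.S) τ = D (F ∣[k] ModularGroup.S) τ +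
      k * (2 * Real.pi * Complex.I * τ)⁻¹ * (F ∣[k] ModularGroup.S) τ := by
  have h := congrFun (Derivative.normalizedDerivOfComplex_SL_slash hF (k := k) (γ := ModularGroup.S)) τ
  have h2 : denom (ModularGroup.S : GL (Fin 2) ℝ) τ = (τ : ℂ) := by
    rw [denom_SL]; simp [ModularGroup.S]
  rw [h, Pi.sub_apply, h2]
  simp [ModularGroup.S]
  ring

lemma slash_S_E2 (τ : ℍ) : (EisensteinSeries.E2 ∣[(2 : ℤ)] ModularGroup.S) τ =
    EisensteinSeries.E2 τ + 12 * (2 * Real.pi * Complex.I * τ)⁻¹ := by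
  have h := congrFun (EisensteinSeries.E2_slash_action ModularGroup.S) τ
  rw [h, Pi.sub_apply, Pi.smul_apply, EisensteinSeries.D2_S, riemannZeta_two]
  have h1 := ne_zero τ
  have h2 : (Real.pi : ℂ) ≠ 0 := by exact_mod_cast Real.pi_ne_zero
  have h3 := Complex.I_ne_zero
  simp only [smul_eq_mul]
  field_simp
  have := Complex.I_sq
  linear_combination (-12 : ℂ) * this

/-- The `q`-expansion of `E₂` over a ring. -/
def e2 (R : Type*) [CommRing R] : PowerSeries R :=
  PowerSeries.mk fun n ↦ if n = 0 then 1 else -24 * (σ 1 n : R)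

variable {R S : Type*} [CommRing R] [CommRing S]

@[simp] lemma map_e2 (φ : R →+* S) : (e2 R).map φ = e2 S := by
  ext n; simp only [e2, PowerSeries.coeff_map, PowerSeries.coeff_mk]
  split_ifs <;> simp [map_ofNat φ 24]

@[simp] lemma constantCoeff_e2 : PowerSeries.constantCoeff (e2 R) = 1 := by
  rw [← PowerSeries.coeff_zero_eq_constantCoeff_apply]; simp only [e2, PowerSeries.coeff_mk]; simp

lemma hasQ_E2 : HasQ 1 EisensteinSeries.E2 (e2 ℂ) := fun τ ↦ by
  have h := EisensteinSeries.hasSum_qExpansion_E2 τ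
  convert h using 2 with n
  simp only [e2, PowerSeries.coeff_mk, smul_eq_mul]
  simp [Periodic.qParam]

/-- The operator `q d/dq` on power series. -/
def theta (A : PowerSeries R) : PowerSeries R := PowerSeries.X * PowerSeries.derivative R A

lemma coeff_theta (A : PowerSeries R) (n : ℕ) :
    PowerSeries.coeff n (theta A) = n * PowerSeries.coeff n A := by
  rw [theta]
  cases n with
  | zero => simp
  | succ n => rw [PowerSeries.coeff_succ_X_mul, PowerSeries.coeff_derivative]; push_cast; ring

lemma theta_mul (A B : PowerSeries R) : theta (A * B) = A * theta B + theta A * B := by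
  simp only [theta, Derivation.leibniz, smul_eq_mul]; ring

lemma theta_add (A B : PowerSeries R) : theta (A + B) = theta A + theta B := by
  simp [theta, mul_add]

lemma theta_sub (A B : PowerSeries R) : theta (A - B) = theta A - theta B := by
  simp [theta, mul_sub]

lemma theta_C_mul (c : R) (B : PowerSeries R) :
    theta (PowerSeries.C c * B) = PowerSeries.C c * theta B := by
  ext n; simp [coeff_theta]; ring

lemma theta_one : theta (1 : PowerSeries R) = 0 := by
  simp [theta]

lemma theta_natCast (n : ℕ) : theta (n : PowerSeries R) = 0 := by
  simp [theta]

lemma theta_pow (A : PowerSeries R) (n : ℕ) : theta (A ^ n) = n * A ^ (n - 1) * theta A := by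
  simp only [theta, Derivation.leibniz_pow, nsmul_eq_mul, smul_eq_mul]; ring

lemma map_theta (φ : R →+* S) (A : PowerSeries R) : (theta A).map φ = theta (A.map φ) := by
  ext n; simp [coeff_theta]

lemma levelOne_eq_C_mul {f : ℍ → ℂ} {A : PowerSeries ℂ} {k : ℤ} (a b : ℕ) (hab : k = 4 * a + 6 * b)
    (hk : 4 * a + 6 * b < 12) (hf : LevelOne k f A) :
    A = PowerSeries.C (PowerSeries.constantCoeff A) * (e4 ℂ ^ a * e6 ℂ ^ b) := by
  have hab' : ∀ F : ModularForm 𝒮ℒ (4 * a + 6 * b - 12), (F : ℍ → ℂ) = 0 := fun F ↦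
    ModularFormClass.levelOne_neg_weight_eq_zero (by omega) F
  obtain ⟨P, hP, h⟩ := exists_poly (φ := RingHom.id ℂ) injective_id isUnit_1728 a b hab' 0 (f := f)
    (A := A) (by subst hab; simpa using hf)
  rw [eq_C_of_natDegree_le_zero hP] at h
  have h2 := congrArg PowerSeries.constantCoeff h
  simp [hom] at h2
  simp only [hom, zero_add, Finset.range_one, Polynomial.map_C, Finset.sum_singleton, pow_zero, mul_one,
    Nat.sub_zero, coeff_C_zero] at h
  rw [h2]
  conv_lhs => rw [h]
  ring

lemma levelOne_serre {f : ℍ → ℂ} {A : PowerSeries ℂ} {k : ℤ} (hf : LevelOne k f A) :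
    LevelOne (k + 2) (D f - ((k / 12 : ℂ) • (EisensteinSeries.E2 * f)))
      (theta A - (k / 12 : ℂ) • (e2 ℂ * A)) := by
  refine ⟨fun τ ↦ ?_, hf.hasQ.deriv.sub ((hasQ_E2.mul hf.hasQ).smul _)⟩
  have h1 := slash_S_deriv (hf.hasQ.mdiff one_pos) (k := k) τ
  have h2 := slash_S_E2 τ
  rw [hf.slash_S] at h1
  simp only [Pi.sub_apply, Pi.smul_apply, Pi.mul_apply, smul_eq_mul]
  rw [slash_S_apply (D f) (k + 2), slash_S_apply EisensteinSeries.E2 2, h1, h2, hf.S_smul, zpow_add₀ (ne_zero τ)]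
  ring

lemma levelOne_serre_E2 :
    LevelOne 4 (D EisensteinSeries.E2 - ((1 / 12 : ℂ) • (EisensteinSeries.E2 ^ 2)))
      (theta (e2 ℂ) - (1 / 12 : ℂ) • (e2 ℂ ^ 2)) := by
  refine ⟨fun τ ↦ ?_, hasQ_E2.deriv.sub ((hasQ_E2.pow 2).smul _)⟩
  have h1 := slash_S_deriv (hasQ_E2.mdiff one_pos) (k := 2) τ
  have h2 := slash_S_E2 τ
  have h3 : D (EisensteinSeries.E2 ∣[(2 : ℤ)] ModularGroup.S) τ =
      D EisensteinSeries.E2 τ - 12 * (2 * Real.pi * Complex.I * τ)⁻¹ ^ 2 := by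
    have hpi : (2 * Real.pi * Complex.I : ℂ) ≠ 0 := Complex.two_pi_I_ne_zero
    have hd := UpperHalfPlane.mdifferentiableAt_iff.mp (hasQ_E2.mdiff one_pos τ)
    have h4 : deriv ((EisensteinSeries.E2 ∣[(2 : ℤ)] ModularGroup.S) ∘ ofComplex) τ =
        deriv ((EisensteinSeries.E2 ∘ ofComplex) + fun z ↦ 12 * (2 * Real.pi * Complex.I * z)⁻¹) τ := by
      refine Filter.EventuallyEq.deriv_eq ?_
      filter_upwards [isOpen_upperHalfPlaneSet.mem_nhds τ.im_pos] with z hz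
      simp only [comp_apply, Pi.add_apply]
      rw [slash_S_E2, ofComplex_apply_of_im_pos hz]
    have h5 : HasDerivAt (fun z : ℂ ↦ 12 * (2 * Real.pi * Complex.I * z)⁻¹)
        (-12 * (2 * Real.pi * Complex.I)⁻¹ * (τ : ℂ)⁻¹ ^ 2) τ := by
      have := ((hasDerivAt_inv (ne_zero τ)).const_mul (12 * (2 * Real.pi * Complex.I : ℂ)⁻¹))
      have h6 : (fun z : ℂ ↦ 12 * (2 * Real.pi * Complex.I * z)⁻¹) =
          fun z ↦ 12 * (2 * Real.pi * Complex.I : ℂ)⁻¹ * z⁻¹ := by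
        ext z; rw [mul_inv]; ring
      rw [h6]
      refine this.congr_deriv ?_
      rw [inv_pow]; ring
    rw [Derivative.normalizedDerivOfComplex, h4, deriv_add hd h5.differentiableAt, h5.deriv,
      Derivative.normalizedDerivOfComplex]
    rw [mul_inv (2 * Real.pi * Complex.I : ℂ) τ]
    ring
  rw [h3, h2] at h1
  simp only [Pi.sub_apply, Pi.smul_apply, Pi.pow_apply, smul_eq_mul]
  rw [slash_S_apply (D EisensteinSeries.E2) (2 + 2), slash_S_apply EisensteinSeries.E2 2, h1, h2, zpow_add₀ (ne_zero τ),
    show ((τ : ℂ) ^ (4 : ℤ)) = (τ : ℂ) ^ (2 : ℤ) * (τ : ℂ) ^ (2 : ℤ) by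
      rw [← zpow_add₀ (ne_zero τ)]; norm_num]
  push_cast
  ring

lemma constantCoeff_theta (A : PowerSeries R) : PowerSeries.constantCoeff (theta A) = 0 := by
  simp [theta]

lemma theta_e4_complex : 3 * theta (e4 ℂ) = e2 ℂ * e4 ℂ - e6 ℂ := by
  have h := levelOne_eq_C_mul 0 1 (by norm_num) (by norm_num) (levelOne_serre levelOne_E₄)
  simp [constantCoeff_theta, PowerSeries.smul_eq_C_mul] at h
  have hC : (3 : PowerSeries ℂ) * PowerSeries.C (4 / 12 : ℂ) = 1 := by
    rw [← map_ofNat (PowerSeries.C (R := ℂ)) 3, ← map_mul, ← map_one (PowerSeries.C (R := ℂ))]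
    norm_num
  linear_combination 3 * h + (e2 ℂ * e4 ℂ - e6 ℂ) * hC

lemma theta_e6_complex : 2 * theta (e6 ℂ) = e2 ℂ * e6 ℂ - e4 ℂ ^ 2 := by
  have h := levelOne_eq_C_mul 2 0 (by norm_num) (by norm_num) (levelOne_serre levelOne_E₆)
  simp [constantCoeff_theta, PowerSeries.smul_eq_C_mul] at h
  have hC : (2 : PowerSeries ℂ) * PowerSeries.C (6 / 12 : ℂ) = 1 := by
    rw [← map_ofNat (PowerSeries.C (R := ℂ)) 2, ← map_mul, ← map_one (PowerSeries.C (R := ℂ))]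
    norm_num
  linear_combination 2 * h + (e2 ℂ * e6 ℂ - e4 ℂ ^ 2) * hC

lemma theta_e2_complex : 12 * theta (e2 ℂ) = e2 ℂ ^ 2 - e4 ℂ := by
  have h := levelOne_eq_C_mul 1 0 (by norm_num) (by norm_num) levelOne_serre_E2
  simp [constantCoeff_theta, PowerSeries.smul_eq_C_mul] at h
  have hC : (12 : PowerSeries ℂ) * PowerSeries.C (12⁻¹ : ℂ) = 1 := by
    rw [← map_ofNat (PowerSeries.C (R := ℂ)) 12, ← map_mul, ← map_one (PowerSeries.C (R := ℂ))]
    norm_num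
  linear_combination 12 * h + (e2 ℂ ^ 2 - e4 ℂ) * hC

lemma eq_of_int_eq {A B : PowerSeries ℤ} (h : A.map (Int.castRingHom ℂ) = B.map (Int.castRingHom ℂ)) :
    A = B := by
  ext n
  have := congrArg (PowerSeries.coeff n) h
  simpa using this

variable (R) in
lemma theta_e4 : 3 * theta (e4 R) = e2 R * e4 R - e6 R := by
  have h : 3 * theta (e4 ℤ) = e2 ℤ * e4 ℤ - e6 ℤ := eq_of_int_eq (by
    simpa [map_theta, map_ofNat (PowerSeries.map (Int.castRingHom ℂ)) 3] using theta_e4_complex)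
  simpa [map_theta, map_ofNat (PowerSeries.map (Int.castRingHom R)) 3] using
    congrArg (PowerSeries.map (Int.castRingHom R)) h

variable (R) in
lemma theta_e6 : 2 * theta (e6 R) = e2 R * e6 R - e4 R ^ 2 := by
  have h : 2 * theta (e6 ℤ) = e2 ℤ * e6 ℤ - e4 ℤ ^ 2 := eq_of_int_eq (by
    simpa [map_theta, map_ofNat (PowerSeries.map (Int.castRingHom ℂ)) 2] using theta_e6_complex)
  simpa [map_theta, map_ofNat (PowerSeries.map (Int.castRingHom R)) 2] using
    congrArg (PowerSeries.map (Int.castRingHom R)) h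

variable (R) in
lemma theta_e2 : 12 * theta (e2 R) = e2 R ^ 2 - e4 R := by
  have h : 12 * theta (e2 ℤ) = e2 ℤ ^ 2 - e4 ℤ := eq_of_int_eq (by
    simpa [map_theta, map_ofNat (PowerSeries.map (Int.castRingHom ℂ)) 12] using theta_e2_complex)
  simpa [map_theta, map_ofNat (PowerSeries.map (Int.castRingHom R)) 12] using
    congrArg (PowerSeries.map (Int.castRingHom R)) h

end Ramanujan

end SSP

namespace SSP

section Hypergeometric

variable {K : Type*} [Field K]

lemma eq_zero_of_aeval_eq_zero {t : PowerSeries K} (ht0 : PowerSeries.constantCoeff t = 0)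
    (ht : t ≠ 0) {Q : K[X]} (h : aeval t Q = 0) : Q = 0 := by
  induction hn : Q.natDegree using Nat.strong_induction_on generalizing Q with
  | _ n ih =>
    have h0 : Q.coeff 0 = 0 := by
      have := congrArg PowerSeries.constantCoeff h
      rw [← divX_mul_X_add Q] at this
      simpa [ht0, PowerSeries.algebraMap_apply] using this
    have hQ : Q = divX Q * X := by
      conv_lhs => rw [← divX_mul_X_add Q, h0]
      simp
    rw [hQ, map_mul, aeval_X, mul_eq_zero, or_iff_left ht] at h
    by_cases hd : n = 0
    · rw [eq_C_of_natDegree_eq_zero (hn.trans hd), h0, C_0]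
    · rw [hQ, ih _ (by rw [natDegree_divX_eq_natDegree_tsub_one]; omega) h rfl, zero_mul]

lemma theta_aeval (t : PowerSeries K) (Q : K[X]) :
    theta (aeval t Q) = aeval t (derivative Q) * theta t := by
  rw [theta, Derivation.map_aeval, theta, smul_eq_mul]
  ring

/-- The variable `Δ / E₄³`. -/
def jInv (K : Type*) [Field K] : PowerSeries K := dq K * (e4 K ^ 3)⁻¹

lemma e4_mul_inv : e4 K * (e4 K)⁻¹ = 1 := PowerSeries.mul_inv_cancel _ (by simp [constantCoeff_e4])

lemma e6_mul_inv : e6 K * (e6 K)⁻¹ = 1 := PowerSeries.mul_inv_cancel _ (by simp [constantCoeff_e6])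

lemma jInv_mul : jInv K * e4 K ^ 3 = dq K := by
  rw [jInv, mul_assoc, PowerSeries.inv_mul_cancel, mul_one]
  simp [constantCoeff_e4]

lemma constantCoeff_jInv : PowerSeries.constantCoeff (jInv K) = 0 := by
  simp [jInv, constantCoeff_dq]

lemma jInv_ne_zero (h : IsUnit (1728 : K)) : jInv K ≠ 0 := by
  intro h0
  have := coeff_one_dq h
  rw [← jInv_mul, h0] at this
  simp at this

lemma e4_ne_zero : e4 K ≠ 0 := left_ne_zero_of_mul (e4_mul_inv (K := K) ▸ one_ne_zero)

lemma e6_ne_zero : e6 K ≠ 0 := left_ne_zero_of_mul (e6_mul_inv (K := K) ▸ one_ne_zero)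

lemma natCast_ne_zero_ps {n : ℕ} (h : (n : K) ≠ 0) : (n : PowerSeries K) ≠ 0 := by
  intro h0
  apply h
  simpa using congrArg PowerSeries.constantCoeff h0

lemma e4_mul_theta_jInv (h : IsUnit (1728 : K)) : e4 K * theta (jInv K) = e6 K * jInv K := by
  have h1728 : (1728 : PowerSeries K) ≠ 0 := by
    exact_mod_cast natCast_ne_zero_ps (n := 1728) (K := K) (by exact_mod_cast h.ne_zero)
  have h1 := mul_dq (R := K) h
  have hj := jInv_mul (K := K)
  have h2 := congrArg theta h1
  have h3 := theta_e4 (R := K)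
  have h4 := theta_e6 (R := K)
  have e1728 : (1728 : PowerSeries K) = ((1728 : ℕ) : PowerSeries K) := by norm_num
  rw [e1728, theta_mul, theta_natCast, theta_sub, theta_pow, theta_pow, ← e1728] at h2
  have h5 := congrArg theta hj
  rw [theta_mul, theta_pow] at h5
  norm_num at h2 h5
  refine mul_left_cancel₀ (pow_ne_zero 2 (e4_ne_zero (K := K))) (mul_left_cancel₀ h1728 ?_)
  linear_combination 1728 * h5 + h2 + (e4 K ^ 2 - 1728 * jInv K * e4 K ^ 2) * h3
    - e6 K * h4 + e2 K * (-1728 * hj - h1)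

/-- The hypergeometric differential equation satisfied by a polynomial `G` in `Δ / E₄³` of which
`E₄ⁿ E₆ᵉ G` is constant. -/
lemma hypergeometric_ode (h : IsUnit (1728 : K)) {G : K[X]} {n e : ℕ}
    (hn : (4 * n + 6 * e + 1 : K) = 0) (he : e ^ 2 = e)
    (hG : e4 K ^ n * e6 K ^ e * aeval (jInv K) G = 1) :
    9 * (X * derivative (X * derivative G)) = 1728 * X * (9 * (X * derivative (X * derivative G))
      - (6 * (n : K[X]) - 3) * (X * derivative G) + ((n : K[X]) ^ 2 - (n : K[X])) * G) := by
  have hx := e4_mul_inv (K := K)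
  have hy := e6_mul_inv (K := K)
  have h1 := theta_e4 (R := K)
  have h2 := theta_e6 (R := K)
  have h3 := theta_e2 (R := K)
  have ht := e4_mul_theta_jInv h
  have hj := jInv_mul (K := K)
  have hd := mul_dq (R := K) h
  have hg := theta_aeval (jInv K) G
  have hg1 := theta_aeval (jInv K) (X * derivative G)
  have hx0 := e4_ne_zero (K := K)
  have hy0 := e6_ne_zero (K := K)
  have hj0 := jInv_ne_zero h
  have hn' : (4 * n + 6 * e + 1 : PowerSeries K) = 0 := by
    have := congrArg (PowerSeries.C (R := K)) hn
    simpa only [map_add, map_mul, map_natCast, map_ofNat, map_one, map_zero] using this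
  have he' : (e : PowerSeries K) ^ 2 = e := by exact_mod_cast congrArg (Nat.cast (R := PowerSeries K)) he
  have hxn : e4 K * theta (e4 K ^ n) = n * e4 K ^ n * theta (e4 K) := by
    rw [theta_pow]
    rcases n with - | n
    · simp
    · simp only [Nat.add_sub_cancel, pow_succ]; ring
  have hyn : e6 K * theta (e6 K ^ e) = e * e6 K ^ e * theta (e6 K) := by
    rw [theta_pow]
    rcases e with - | e
    · simp
    · simp only [Nat.add_sub_cancel, pow_succ]; ring
  have hθ := congrArg theta hG
  rw [theta_mul, theta_mul, theta_one] at hθ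
  have key : ∀ (Q : K[X]), aeval (jInv K) Q = 0 → Q = 0 := fun Q ↦
    eq_zero_of_aeval_eq_zero constantCoeff_jInv hj0
  refine sub_eq_zero.mp (key _ ?_)
  simp only [map_sub, map_mul, map_add, map_pow, map_natCast, map_ofNat, aeval_X] at hg hg1 ⊢
  set g1' := aeval (jInv K) (derivative (X * derivative G))
  set g' := aeval (jInv K) (derivative G)
  set g := aeval (jInv K) G
  set t := jInv K
  set x := e4 K
  set y := e6 K
  set z := e2 K
  set g1 := t * g' with hg1d
  set g2 := t * g1' with hg2d
  have hg' : x * theta g = y * g1 := by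
    rw [hg, hg1d]; linear_combination g' * ht
  have hg1' : x * theta g1 = y * g2 := by
    rw [hg1, hg2d]; linear_combination g1' * ht
  clear_value g1 g2
  set P := x ^ n
  set Q := y ^ e
  obtain ⟨w, hw⟩ : ∃ w, w = P * Q * g1 := ⟨_, rfl⟩
  obtain ⟨u, hu⟩ : ∃ u, u = P * Q * g2 := ⟨_, rfl⟩
  have hwg : w * g = g1 := by rw [hw]; linear_combination g1 * hG
  have E1 : y ^ 2 * w + e * x * theta y + n * y * theta x = 0 := by
    rw [hw]
    linear_combination x * y * hθ - y * P * Q * hg' - P * x * g * hyn - y * Q * g * hxn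
      - (e * x * theta y + n * y * theta x) * hG
  have E2 : x * theta w = y * (u - w ^ 2) := by
    have h4 := congrArg theta hwg
    rw [theta_mul] at h4
    rw [hu]
    linear_combination x * P * Q * h4 + P * Q * hg1' - P * Q * w * hg' - x * theta w * hG + y * w * hw
  obtain ⟨N, hN⟩ : ∃ N : PowerSeries K, N = 4 * n := ⟨_, rfl⟩
  have hN' : N = -1 - 6 * e := by linear_combination hN + hn'
  have E3 : x * y * z = 12 * y ^ 2 * w - 6 * e * x ^ 3 - N * y ^ 2 := by
    linear_combination -12 * E1 + 6 * e * x * h2 + 4 * n * y * h1 + x * y * z * hn' + y ^ 2 * hN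
  have h12 : theta (12 : PowerSeries K) = 0 := by exact_mod_cast theta_natCast 12
  have h6 : theta (6 : PowerSeries K) = 0 := by exact_mod_cast theta_natCast 6
  have hθN : theta N = 0 := by rw [hN]; exact_mod_cast theta_natCast (4 * n)
  have h4 := congrArg theta E3
  simp only [theta_sub, theta_mul, theta_pow, h12, h6, hθN, theta_natCast] at h4
  norm_num at h4
  have h5 : 11 * (x * y * z) ^ 2 - 4 * y ^ 2 * (x * y * z) - 6 * x ^ 3 * (x * y * z) - x ^ 3 * y ^ 2 =
      144 * w * (y ^ 2 * (x * y * z) - x ^ 3 * y ^ 2) + 144 * y ^ 4 * (u - w ^ 2)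
      - 72 * e * x ^ 3 * (x * y * z - y ^ 2) - 12 * N * (y ^ 2 * (x * y * z) - x ^ 3 * y ^ 2) := by
    linear_combination 12 * x * y * h4 - 4 * x * y * (y * z + 18 * e * x ^ 2) * h1
      - 6 * x * y * (x * z - 24 * y * w + 2 * N * y) * h2 - x ^ 2 * y ^ 2 * h3 + 144 * y ^ 3 * E2
  have h7 : 144 * y ^ 2 * u + w * (-24 * N * y ^ 2 - 144 * e * x ^ 3 - 72 * x ^ 3 + 48 * y ^ 2)
      + (N ^ 2 * y ^ 2 + 12 * N * e * x ^ 3 + 6 * N * x ^ 3 - 4 * N * y ^ 2 + 48 * e * x ^ 3 + x ^ 3) = 0 := by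
    rw [E3] at h5
    refine (mul_eq_zero.mp ?_).resolve_left (pow_ne_zero 2 hy0)
    rcases (by rcases Nat.le_one_iff_eq_zero_or_eq_one.mp (by nlinarith : e ≤ 1) with h | h <;> simp [h] :
      (e : PowerSeries K) = 0 ∨ (e : PowerSeries K) = 1) with h | h <;> rw [hN', h] at h5 ⊢ <;> linear_combination -h5
  have h8 : 1728 * t * x ^ 3 = x ^ 3 - y ^ 2 := by linear_combination 1728 * hj + hd
  refine (mul_eq_zero.mp ?_).resolve_left (pow_ne_zero 3 hx0)
  have hug : u * g = g2 := by rw [hu]; linear_combination g2 * hG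
  have h16 : (16 : PowerSeries K) ≠ 0 := by
    exact_mod_cast natCast_ne_zero_ps (n := 16) (K := K) fun h0 ↦ h.ne_zero <| by
      have : (1728 : K) = (16 : ℕ) * 108 := by norm_num
      rw [this, h0, zero_mul]
  refine (mul_eq_zero.mp ?_).resolve_left h16
  rw [← hwg, ← hug]
  have h9 : N + 6 * e + 1 = 0 := by linear_combination hN'
  linear_combination g * h7 - 16 * (9 * (u * g) - (6 * n - 3) * (w * g) + (n ^ 2 - n) * g) * h8
    + 24 * (x ^ 3 * w * g) * h9 - g * x ^ 3 * (N + 6 * e + 1) * h9 + 36 * g * x ^ 3 * he'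
    + (24 * w * g * (y ^ 2 - x ^ 3) + 4 * g * (y ^ 2 - x ^ 3) - g * (y ^ 2 - x ^ 3) * (N + 4 * n)) * hN

end Hypergeometric

end SSP

namespace SSP

section Deuring

variable {K : Type*} [Field K]

lemma hom_eq_aeval_jInv (m : ℕ) (F : K[X]) :
    hom m (F.map (PowerSeries.C (R := K))) (e4 K ^ 3) (dq K) =
      e4 K ^ (3 * m) * aeval (jInv K) (∑ i ∈ Finset.range (m + 1), C (F.coeff (m - i)) * X ^ i) := by
  rw [hom, ← Finset.sum_range_reflect, map_sum, Finset.mul_sum]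
  refine Finset.sum_congr rfl fun i hi ↦ ?_
  have hi' : i ≤ m := Nat.lt_succ_iff.mp (Finset.mem_range.mp hi)
  have h1 : m + 1 - 1 - i = m - i := by omega
  have h2 : m - (m - i) = i := by omega
  rw [h1, h2, map_mul, aeval_C, map_pow, aeval_X, coeff_map, ← jInv_mul, PowerSeries.algebraMap_apply,
    mul_pow, ← pow_mul, ← pow_mul]
  have : e4 K ^ (3 * m) = e4 K ^ (3 * (m - i)) * e4 K ^ (3 * i) := by
    rw [← pow_add]; congr 1; omega
  rw [this]
  simp
  ring

variable [CharP K p]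

lemma map_ssPoly (hp : 5 ≤ p) {F : K[X]} (hF : F.natDegree ≤ p / 12)
    (h : e4 K ^ del p * e6 K ^ eps p *
      hom (p / 12) (F.map (PowerSeries.C (R := K))) (e4 K ^ 3) (dq K) = 1) :
    F.coeff (p / 12) = 1 ∧
    (ssPoly p).map (ZMod.castHom dvd_rfl K) = (X - C 1728) ^ eps p * (X ^ del p * F) := by
  have hunit : ∀ n : ℕ, ¬ p ∣ n → (n : K) ≠ 0 := fun n hn h0 ↦ hn ((CharP.cast_eq_zero_iff K p n).mp h0)
  have hpr : p.Prime := Fact.out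
  have h1728 : IsUnit (1728 : K) := by
    have := hunit 1728 (not_dvd_1728 p hp)
    exact IsUnit.mk0 _ (by exact_mod_cast this)
  set m := p / 12 with hm
  set G : K[X] := ∑ i ∈ Finset.range (m + 1), C (F.coeff (m - i)) * X ^ i with hGd
  have hGc : ∀ i ≤ m, G.coeff i = F.coeff (m - i) := by
    intro i hi
    rw [hGd, finsetSum_coeff]
    simp only [coeff_C_mul, coeff_X_pow]
    rw [Finset.sum_eq_single i]
    · simp
    · intro b _ hb; simp [hb.symm]
    · intro hb; simp at hb; omega
  have hG : e4 K ^ (del p + 3 * m) * e6 K ^ eps p * aeval (jInv K) G = 1 := by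
    rw [hom_eq_aeval_jInv, ← hGd] at h
    rw [pow_add]
    linear_combination h
  have hpK : (12 * m + 4 * del p + 6 * eps p + 1 : K) = 0 := by
    have := CharP.cast_eq_zero K p
    rw [eq_twelve_mul_add p hp] at this
    exact_mod_cast this
  have heps : eps p ^ 2 = eps p := by
    have := eps_lt_two p hp; interval_cases eps p <;> rfl
  have hode := hypergeometric_ode h1728 (G := G) (n := del p + 3 * m) (e := eps p)
    (by push_cast; linear_combination hpK) heps hG
  have h0 : G.coeff 0 = 1 := by
    have := congrArg PowerSeries.constantCoeff hG
    rw [← divX_mul_X_add G] at this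
    simpa [constantCoeff_jInv, constantCoeff_e4, constantCoeff_e6, PowerSeries.algebraMap_apply] using this
  have hrec : ∀ k : ℕ, 9 * ((k : K) + 1) ^ 2 * G.coeff (k + 1) =
      1728 * ((3 * k - (del p + 3 * m)) * (3 * k - (del p + 3 * m) + 1)) * G.coeff k := by
    intro k
    have hc : ∀ (Q : K[X]) (j : ℕ), (X * derivative Q).coeff j = j * Q.coeff j := by
      rintro Q (- | j)
      · simp
      · rw [coeff_X_mul, coeff_derivative]; push_cast; ring
    have := congrArg (fun Q : K[X] ↦ Q.coeff (k + 1)) hode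
    have e9 : (9 : K[X]) = C 9 := rfl
    have e1728 : (1728 : K[X]) = C 1728 := rfl
    have e6 : (6 * ((del p + 3 * m : ℕ) : K[X]) - 3) = C (6 * ((del p + 3 * m : ℕ) : K) - 3) := by
      simp only [map_sub, map_mul, map_natCast, map_ofNat]
    have en : (((del p + 3 * m : ℕ) : K[X]) ^ 2 - ((del p + 3 * m : ℕ) : K[X])) =
        C (((del p + 3 * m : ℕ) : K) ^ 2 - ((del p + 3 * m : ℕ) : K)) := by
      simp only [map_sub, map_pow, map_natCast]
    rw [e9, e1728, e6, en] at this
    simp only [mul_assoc, coeff_C_mul, coeff_X_mul, coeff_add, coeff_sub, hc] at this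
    push_cast at this
    linear_combination this
  have h3 : (3 : K) ≠ 0 := fun h0 ↦ h1728.ne_zero (by linear_combination 576 * h0)
  have h2 : (2 : K) ≠ 0 := fun h0 ↦ h1728.ne_zero (by linear_combination 864 * h0)
  have h12 : (12 : K) ≠ 0 := fun h0 ↦ h1728.ne_zero (by linear_combination 144 * h0)
  have h6 : (6 : K) ≠ 0 := fun h0 ↦ h1728.ne_zero (by linear_combination 288 * h0)
  set φ := ZMod.castHom (dvd_refl p) K with hφ
  set β : ZMod p := (5 : ZMod p) / 12 - (((2 * (del p : ℤ) - 3 * (eps p : ℤ)) : ℤ) : ZMod p) / 6 with hβ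
  have hφβ : φ β = 5 / 12 - (2 * (del p : K) - 3 * eps p) / 6 := by
    rw [hβ]; push_cast
    simp only [map_sub, map_div₀, map_mul, map_ofNat, map_natCast]
  have hβm : ∀ k : K, 9 * (-m + k) * (φ β + k) = (3 * k - (del p + 3 * m)) * (3 * k - (del p + 3 * m) + 1) := by
    intro k
    have hdel := del_lt_two p hp
    have hb : 12 * φ β = 5 - 4 * del p + 6 * eps p := by
      have : (12 : K) = 6 * 2 := by norm_num
      rw [hφβ, this] at *
      field_simp
      ring
    refine mul_left_cancel₀ h12 ?_
    rcases (by omega : del p = 0 ∨ del p = 1) with hd | hd <;> rw [hd] at hpK hb ⊢ <;> push_cast at hpK hb ⊢ <;>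
      linear_combination 9 * (k - m) * (hb + hpK)
  have hfac : ∀ k ≤ m, (k.factorial : K) ≠ 0 := by
    intro k hk
    refine hunit _ fun hdvd ↦ ?_
    have := (hpr.dvd_factorial).mp hdvd
    omega
  have hcoeff : ∀ k ≤ m, G.coeff k = φ (poch p (-(m : ℕ) : ZMod p) k * poch p β k /
      (k.factorial : ZMod p) ^ 2 * 1728 ^ k) := by
    intro k hk
    induction k with
    | zero => simp [h0, poch]
    | succ k ih =>
      have ih := ih (by omega)
      have hr := hrec k
      have hf := hfac (k + 1) hk
      have hf' := hfac k (by omega)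
      rw [Nat.factorial_succ] at hf
      have hk1 : ((k : K) + 1) ≠ 0 := by
        intro h; apply hf; push_cast; rw [h, zero_mul]
      rw [ih] at hr
      simp only [poch, ascPochhammer_succ_eval, map_mul, map_div₀, map_pow, map_natCast, map_neg,
        map_add, map_ofNat, Nat.factorial_succ, Nat.cast_mul, Nat.cast_add, Nat.cast_one, map_one] at hr ⊢
      have h9 : (9 : K) ≠ 0 := fun h0 ↦ h1728.ne_zero (by linear_combination 192 * h0)
      refine mul_left_cancel₀ (mul_ne_zero h9 (pow_ne_zero 2 hk1)) ?_
      rw [hr, mul_assoc 1728, ← hβm]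
      field_simp
      ring
  refine ⟨by simpa [h0] using (hGc 0 (Nat.zero_le m)).symm, ?_⟩
  rw [ssPoly, ← hβ, ← hm, Polynomial.map_mul, Polynomial.map_pow, Polynomial.map_sub, map_X, map_C, map_ofNat,
    Polynomial.map_sum]
  congr 1
  rw [as_sum_range' F (m + 1) (Nat.lt_succ_of_le hF), ← Finset.sum_range_reflect, Finset.mul_sum]
  refine Finset.sum_congr rfl fun i hi ↦ ?_
  have hi' : i ≤ m := Nat.lt_succ_iff.mp (Finset.mem_range.mp hi)
  have h1 : m + 1 - 1 - i = m - i := by omega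
  have h2 : m - (m - i) = i := by omega
  have h3 := hGc (m - i) (Nat.sub_le m i)
  rw [h2] at h3
  rw [h1, ← h3, hcoeff _ (Nat.sub_le m i), Polynomial.map_mul, map_C, Polynomial.map_pow, map_X,
    ← C_mul_X_pow_eq_monomial, (by omega : m + del p - (m - i) = del p + i), pow_add]
  ring

end Deuring

section Supersingular

open IsLocalRing

variable (V : ValuationSubring ℂ) [hV : Fact ((p : V) ∈ maximalIdeal V)]

lemma LL_eq_card (h : ssPoly p ≠ 0) : LL p = Nat.card {c : ZMod p // (ssPoly p).eval c = 0} := by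
  classical
  rw [LL, Nat.card_eq_fintype_card, Fintype.card_subtype]
  congr 1
  ext c
  simp [h]

lemma exists_supersingular (hp : 5 ≤ p) : ∃ h : (kap V)[X], h.natDegree ≤ p - 1 ∧
    hom (p - 1) (h.map (PowerSeries.C (R := kap V))) (e4 (kap V) ^ 3) (dq (kap V)) = 1 ∧
    ssPoly p ≠ 0 ∧
    ∀ c : ZMod p, (letI := charP_kap p V; h.eval (ZMod.castHom (dvd_refl p) (kap V) c)) = 0 ↔
      (ssPoly p).eval c = 0 := by
  have := charP_kap p V
  obtain ⟨F, hF, h⟩ := exists_hasse p V hp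
  obtain ⟨h1, h2⟩ := map_ssPoly p hp hF h
  set R := kap V
  have hF' : (F.map (PowerSeries.C (R := R))).natDegree ≤ p / 12 := natDegree_map_le.trans hF
  refine ⟨F ^ 12 * X ^ (4 * del p) * (X - C 1728) ^ (6 * eps p), ?_, ?_, ?_, ?_⟩
  · have e1 := natDegree_pow_le_of_le 12 hF
    have e2 := natDegree_X_pow (R := R) (4 * del p)
    have e3 := natDegree_pow_le_of_le (6 * eps p) (natDegree_X_sub_C (1728 : R)).le
    have := eq_twelve_mul_add p hp
    refine natDegree_mul_le.trans ((Nat.add_le_add_right natDegree_mul_le _).trans ?_)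
    omega
  · have e1 := natDegree_pow_le_of_le 12 hF'
    have e2 := (natDegree_X_pow (R := PowerSeries R) (4 * del p)).le
    have d1 : ((X - C (PowerSeries.C (R := R) 1728)) : (PowerSeries R)[X]).natDegree ≤ 1 := (natDegree_X_sub_C _).le
    have e3 := natDegree_pow_le_of_le (6 * eps p) d1
    have hpp : p - 1 = (12 * (p / 12) + 4 * del p) + 6 * eps p * 1 := by
      have := eq_twelve_mul_add p hp
      omega
    rw [Polynomial.map_mul, Polynomial.map_mul, Polynomial.map_pow, Polynomial.map_pow,
      Polynomial.map_pow, Polynomial.map_sub, map_X, map_C, hpp,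
      hom_mul (natDegree_mul_le.trans (Nat.add_le_add e1 e2)) e3, hom_mul e1 e2, hom_pow hF', hom_X_pow le_rfl,
      hom_pow d1, hom_sub]
    have d2 : hom 1 (X : (PowerSeries R)[X]) (e4 R ^ 3) (dq R) = e4 R ^ 3 := by
      simp [hom, Finset.sum_range_succ]
    have d3 : hom 1 (C (PowerSeries.C (R := R) 1728)) (e4 R ^ 3) (dq R) = 1728 * dq R := by
      have : (PowerSeries.C (R := R) 1728) = 1728 := map_ofNat _ 1728
      simp [hom, Finset.sum_range_succ, this]
    rw [d2, d3, mul_dq (isUnit_1728_kap p V hp), sub_sub_cancel]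
    have := congrArg (· ^ 12) h
    simp only [one_pow] at this
    rw [← this]
    simp only [Nat.sub_self, pow_zero, mul_one, mul_pow, ← pow_mul]
    ring_nf
    exact mul_rotate _ _ _
  · intro h0
    rw [h0, Polynomial.map_zero] at h2
    have hF0 : F ≠ 0 := by rintro rfl; simp at h1
    exact mul_ne_zero (pow_ne_zero _ (X_sub_C_ne_zero _)) (mul_ne_zero (pow_ne_zero _ X_ne_zero) hF0) h2.symm
  · intro c
    rw [← map_eq_zero_iff (ZMod.castHom (dvd_refl p) (kap V)) (RingHom.injective _), ← eval_map_apply, h2]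
    simp only [eval_mul, eval_pow, eval_X, eval_sub, eval_C, mul_eq_zero]
    have := del_lt_two p hp
    have := eps_lt_two p hp
    rcases (by omega : del p = 0 ∨ del p = 1) with hd | hd <;>
    rcases (by omega : eps p = 0 ∨ eps p = 1) with he | he <;> rw [hd, he] <;> simp <;> tauto

end Supersingular

end SSP

namespace SSP

open UpperHalfPlane Function
open scoped MatrixGroups ModularForm

section Correspondence

lemma prime_pos : 0 < p := (Fact.out : p.Prime).pos

/-- Integral matrices of determinant `p`. -/
abbrev Mp := FixedDetMatrix (Fin 2) ℤ (p : ℤ)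

variable {p} in
/-- The real invertible matrix underlying an integral matrix of determinant `p`. -/
def toGL (M : Mp p) : GL (Fin 2) ℝ :=
  Matrix.GeneralLinearGroup.mkOfDetNeZero (M.1.map (Int.cast : ℤ → ℝ)) (by
    have := congrArg (Int.cast : ℤ → ℝ) M.2
    rw [Matrix.det_fin_two] at this ⊢
    push_cast at this
    simp only [Matrix.map_apply]
    rw [this]
    exact_mod_cast (prime_pos p).ne')

variable {p}

lemma toGL_apply (M : Mp p) (i j : Fin 2) : (toGL M : Matrix (Fin 2) (Fin 2) ℝ) i j = M.1 i j := by
  simp [toGL]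

omit [Fact p.Prime] in
lemma Mp.det_eq (M : Mp p) : M.1 0 0 * M.1 1 1 - M.1 0 1 * M.1 1 0 = p := by
  have := M.2
  rwa [Matrix.det_fin_two] at this

lemma det_toGL (M : Mp p) : (toGL M).det.val = p := by
  rw [Matrix.GeneralLinearGroup.val_det_apply, Matrix.det_fin_two]
  simp only [toGL_apply]
  exact_mod_cast M.det_eq

lemma det_toGL_pos (M : Mp p) : 0 < (toGL M).det.val := by
  rw [det_toGL]
  exact_mod_cast prime_pos p

lemma toGL_smul (σ : SL(2, ℤ)) (M : Mp p) : toGL (σ • M) = (σ : GL (Fin 2) ℝ) * toGL M := by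
  ext i j
  rw [toGL_apply, Matrix.GeneralLinearGroup.coe_mul, Matrix.mul_apply, FixedDetMatrices.smul_coe,
    Matrix.mul_apply]
  push_cast
  simp only [toGL_apply]
  rfl

/-- Right multiplication by a matrix of determinant one. -/
def Mp.mulRight (M : Mp p) (σ : SL(2, ℤ)) : Mp p := ⟨M.1 * σ.1, by rw [Matrix.det_mul, M.2, σ.2, mul_one]⟩

omit [Fact p.Prime] in
lemma Mp.mulRight_coe (M : Mp p) (σ : SL(2, ℤ)) : (M.mulRight σ).1 = M.1 * σ.1 := rfl

lemma toGL_mulRight (M : Mp p) (σ : SL(2, ℤ)) :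
    toGL (M.mulRight σ) = toGL M * (σ : GL (Fin 2) ℝ) := by
  ext i j
  rw [toGL_apply, Matrix.GeneralLinearGroup.coe_mul, Matrix.mul_apply, Mp.mulRight_coe,
    Matrix.mul_apply]
  push_cast
  simp only [toGL_apply]
  rfl

lemma toGL_injective : Injective (toGL (p := p)) := by
  intro M N h
  refine FixedDetMatrices.ext (Fin 2) ℤ fun i j ↦ ?_
  have := toGL_apply M i j
  rw [h, toGL_apply] at this
  exact_mod_cast this.symm

variable (p) in
/-- Representatives of the integral matrices of determinant `p` modulo `SL(2, ℤ)`. -/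
def gam : Option (ZMod p) → Mp p
  | none => ⟨!![(p : ℤ), 0; 0, 1], by simp⟩
  | some b => ⟨!![1, (b.val : ℤ); 0, (p : ℤ)], by simp⟩

lemma exists_eq_smul_gam (M : Mp p) : ∃ (δ : SL(2, ℤ)) (i : Option (ZMod p)), M = δ • gam p i := by
  have hp0 : (p : ℤ) ≠ 0 := by exact_mod_cast (prime_pos p).ne'
  induction M using FixedDetMatrices.induction_on hp0 with
  | h0 A h10 h00 h01 h11 =>
    have hd := Mp.det_eq A
    rw [h10, mul_zero, sub_zero] at hd
    have hp : Prime (p : ℤ) := Nat.prime_iff_prime_int.mp Fact.out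
    have h11' : 0 < A.1 1 1 := by
      have : 0 < A.1 0 0 * A.1 1 1 := by rw [hd]; exact_mod_cast prime_pos p
      exact pos_of_mul_pos_right this h00.le
    rw [abs_of_nonneg h01, abs_of_pos h11'] at h11
    obtain ⟨a, ha⟩ := Int.eq_ofNat_of_zero_le h00.le
    obtain ⟨d, hd'⟩ := Int.eq_ofNat_of_zero_le h11'.le
    obtain ⟨b, hb⟩ := Int.eq_ofNat_of_zero_le h01
    rw [ha, hd'] at hd
    have hd2 : a * d = p := by exact_mod_cast hd
    rcases (Nat.prime_mul_iff.mp (hd2 ▸ (Fact.out : p.Prime))) with ⟨-, h1⟩ | ⟨-, h1⟩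
    · refine ⟨1, none, ?_⟩
      rw [one_smul]
      have hb0 : b = 0 := by rw [hb, hd', h1] at h11; omega
      rw [h1, mul_one] at hd2
      refine FixedDetMatrices.ext (Fin 2) ℤ fun i j ↦ ?_
      fin_cases i <;> fin_cases j <;> simp [gam, *]
    · refine ⟨1, some (b : ZMod p), ?_⟩
      rw [one_smul]
      rw [h1, one_mul] at hd2
      have hbp : b < p := by rw [hb, hd'] at h11; omega
      refine FixedDetMatrices.ext (Fin 2) ℤ fun i j ↦ ?_
      fin_cases i <;> fin_cases j <;> simp [gam, *, Nat.mod_eq_of_lt hbp, ZMod.val_natCast]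
  | hS B ih =>
    obtain ⟨δ, i, rfl⟩ := ih
    exact ⟨ModularGroup.S * δ, i, by rw [mul_smul]⟩
  | hT B ih =>
    obtain ⟨δ, i, rfl⟩ := ih
    exact ⟨ModularGroup.T * δ, i, by rw [mul_smul]⟩

lemma gam_eq_smul {i j : Option (ZMod p)} {δ : SL(2, ℤ)} (h : gam p i = δ • gam p j) : i = j := by
  have he : ∀ r s, (gam p i).1 r s = δ.1 r 0 * (gam p j).1 0 s + δ.1 r 1 * (gam p j).1 1 s := by
    intro r s
    rw [h, FixedDetMatrices.smul_coe, Matrix.mul_apply, Fin.sum_univ_two]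
  have hp : 1 < (p : ℤ) := by exact_mod_cast (Fact.out : p.Prime).one_lt
  have h00 := he 0 0
  have h01 := he 0 1
  have h10 := he 1 0
  have h11 := he 1 1
  rcases i with - | b <;> rcases j with - | b'
  · rfl
  · simp [gam] at h00 h01 h10 h11
    rw [← h10, zero_mul, zero_add] at h11
    exact absurd (Int.eq_one_or_neg_one_of_mul_eq_one' h11.symm) (by omega)
  · simp [gam] at h00 h01 h10 h11
    exact absurd (Int.eq_one_or_neg_one_of_mul_eq_one' h00.symm) (by omega)
  · simp [gam] at h00 h01 h10 h11
    rw [← h00, one_mul] at h01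
    have := congrArg (Int.cast : ℤ → ZMod p) h01
    simp at this
    rw [this]

lemma exists_perm (σ : SL(2, ℤ)) : ∃ π : Equiv.Perm (Option (ZMod p)), ∀ i, ∃ δ : SL(2, ℤ),
    toGL (gam p i) * (σ : GL (Fin 2) ℝ) = (δ : GL (Fin 2) ℝ) * toGL (gam p (π i)) := by
  choose δ π h using fun i ↦ exists_eq_smul_gam ((gam p i).mulRight σ)
  have hinj : Injective π := by
    intro i j hij
    have h1 : gam p i = (δ i * (δ j)⁻¹) • gam p j := by
      apply toGL_injective
      have h2 := congrArg toGL (h i)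
      have h3 := congrArg toGL (h j)
      rw [toGL_mulRight, toGL_smul] at h2 h3
      rw [toGL_smul]
      rw [← hij] at h3
      rw [eq_mul_inv_of_mul_eq h2, map_mul, map_inv, eq_inv_mul_of_mul_eq h3.symm]
      simp only [map_mul, map_inv]
      group
    exact gam_eq_smul h1
  exact ⟨Equiv.ofBijective π hinj.bijective_of_finite, fun i ↦ ⟨δ i, by
    rw [← toGL_mulRight, h i, toGL_smul]; rfl⟩⟩

end Correspondence

end SSP

namespace SSP

open UpperHalfPlane Function IsLocalRing
open scoped MatrixGroups ModularForm

section Conjugates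

/-- The transform of `f` by `g`, normalised so that determinant `p` matrices preserve integrality. -/
def conj (k : ℤ) (f : ℍ → ℂ) (g : GL (Fin 2) ℝ) (τ : ℍ) : ℂ :=
  (p : ℂ) ^ k * denom g τ ^ (-k) * f (g • τ)

variable {p} {k l : ℤ} {f : ℍ → ℂ} {A : PowerSeries ℂ}

omit [Fact p.Prime] in
lemma denom_mul_SL (g : GL (Fin 2) ℝ) (σ : SL(2, ℤ)) (τ : ℍ) :
    denom (g * (σ : GL (Fin 2) ℝ)) τ = denom g (σ • τ : ℍ) * denom (σ : GL (Fin 2) ℝ) τ := by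
  rw [denom_cocycle_σ, UpperHalfPlane.σ, if_pos (by simp)]
  rfl

omit [Fact p.Prime] in
lemma conj_mul_SL (f : ℍ → ℂ) (g : GL (Fin 2) ℝ) (σ : SL(2, ℤ)) (τ : ℍ) :
    conj p k f g (σ • τ) = denom (σ : GL (Fin 2) ℝ) τ ^ k * conj p k f (g * σ) τ := by
  rw [conj, conj, denom_mul_SL, mul_zpow, mul_smul, zpow_neg (denom (σ : GL (Fin 2) ℝ) τ)]
  have := zpow_ne_zero k (denom_ne_zero (σ : GL (Fin 2) ℝ) τ)
  change _ * f (g • σ • τ) = _ * (_ * f (g • σ • τ))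
  field_simp

omit [Fact p.Prime] in
lemma conj_SL_mul (hf : LevelOne k f A) {g : GL (Fin 2) ℝ} (hg : 0 < g.det.val) (σ : SL(2, ℤ))
    (τ : ℍ) : conj p k f ((σ : GL (Fin 2) ℝ) * g) τ = conj p k f g τ := by
  rw [conj, conj, denom_cocycle_σ, UpperHalfPlane.σ, if_pos hg, mul_smul]
  have h1 : f ((σ : GL (Fin 2) ℝ) • g • τ) = denom (σ : GL (Fin 2) ℝ) (g • τ : ℍ) ^ k * f (g • τ) := by
    rw [denom_SL]; exact hf.smul_eq σ (g • τ)
  simp only [ContinuousAlgEquiv.refl_apply]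
  rw [h1, mul_zpow, zpow_neg (denom (σ : GL (Fin 2) ℝ) (g • τ : ℍ))]
  have := zpow_ne_zero k (denom_ne_zero (σ : GL (Fin 2) ℝ) (g • τ))
  field_simp

/-- `π` describes the right action of `σ` on the representatives `gam p`. -/
def IsPerm (σ : SL(2, ℤ)) (π : Equiv.Perm (Option (ZMod p))) : Prop :=
  ∀ i, ∃ δ : SL(2, ℤ), toGL (gam p i) * (σ : GL (Fin 2) ℝ) = (δ : GL (Fin 2) ℝ) * toGL (gam p (π i))

/-- A family of functions permuted by the slash action of weight `k`. -/
def Fam (k : ℤ) (Φ : Option (ZMod p) → ℍ → ℂ) : Prop :=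
  ∀ σ π, IsPerm σ π → ∀ i τ, Φ i (σ • τ) = denom (σ : GL (Fin 2) ℝ) τ ^ k * Φ (π i) τ

lemma fam_conj (hf : LevelOne k f A) : Fam (p := p) k (fun i ↦ conj p k f (toGL (gam p i))) := by
  intro σ π hπ i τ
  obtain ⟨δ, h⟩ := hπ i
  simp only
  rw [conj_mul_SL, h, conj_SL_mul hf (det_toGL_pos _)]

lemma fam_const (hf : LevelOne k f A) : Fam (p := p) k (fun _ ↦ f) := by
  intro σ π hπ i τ
  simp only
  rw [hf.smul_eq, denom_SL]

lemma Fam.mul {Φ Ψ : Option (ZMod p) → ℍ → ℂ} (h : Fam k Φ) (h' : Fam l Ψ) :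
    Fam (k + l) (fun i ↦ Φ i * Ψ i) := by
  intro σ π hπ i τ
  simp only [Pi.mul_apply]
  rw [h σ π hπ, h' σ π hπ, zpow_add₀ (denom_ne_zero _ τ)]
  ring

lemma Fam.sub {Φ Ψ : Option (ZMod p) → ℍ → ℂ} (h : Fam k Φ) (h' : Fam k Ψ) :
    Fam k (fun i ↦ Φ i - Ψ i) := by
  intro σ π hπ i τ
  simp only [Pi.sub_apply]
  rw [h σ π hπ, h' σ π hπ]
  ring

lemma Fam.prod {Φ : Option (ZMod p) → ℍ → ℂ} (h : Fam k Φ) (σ : SL(2, ℤ)) (τ : ℍ) :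
    ∏ i, Φ i (σ • τ) = denom (σ : GL (Fin 2) ℝ) τ ^ (k * (p + 1)) * ∏ i, Φ i τ := by
  obtain ⟨π, hπ⟩ := exists_perm (p := p) σ
  rw [Finset.prod_congr rfl fun i _ ↦ h σ π hπ i τ, Finset.prod_mul_distrib, Finset.prod_const,
    Equiv.prod_comp π fun i ↦ Φ i τ, Finset.card_univ, Fintype.card_option, ZMod.card,
    ← zpow_natCast, ← zpow_mul]
  push_cast
  rfl

variable (p) in
/-- The root of unity `exp(2πi/p)`. -/
def zet : ℂ := Complex.exp (2 * Real.pi * Complex.I / p)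

lemma zet_pow : zet p ^ p = 1 := by
  rw [zet, ← Complex.exp_nat_mul, mul_div_cancel₀]
  · exact Complex.exp_two_pi_mul_I
  · exact_mod_cast (prime_pos p).ne'

variable (p) in
lemma pne : p ≠ 0 := (prime_pos p).ne'

lemma HasQ.level_p (hf : HasQ 1 f A) : HasQ p f (PowerSeries.expand p (pne p) A) := by
  refine hf.comp' _ fun τ ↦ ?_
  rw [Function.Periodic.qParam, Function.Periodic.qParam, ← Complex.exp_nat_mul]
  congr 1
  have : (p : ℂ) ≠ 0 := by exact_mod_cast pne p
  push_cast
  field_simp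

lemma num_gam_none (τ : ℍ) : num (toGL (gam p none)) τ = p * τ := by
  simp only [num, toGL_apply]; simp [gam]

lemma denom_gam_none (τ : ℍ) : denom (toGL (gam p none)) τ = 1 := by
  simp only [denom, toGL_apply]; simp [gam]

lemma num_gam_some (b : ZMod p) (τ : ℍ) : num (toGL (gam p (some b))) τ = τ + b.val := by
  simp only [num, toGL_apply]; simp [gam, -ZMod.natCast_val]

lemma denom_gam_some (b : ZMod p) (τ : ℍ) : denom (toGL (gam p (some b))) τ = p := by
  simp only [denom, toGL_apply]; simp [gam]

lemma hasQ_conj_none (hf : HasQ 1 f A) : HasQ p (conj p k f (toGL (gam p none)))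
    ((p : ℂ) ^ k • PowerSeries.expand p (pne p) (PowerSeries.expand p (pne p) A)) := by
  have h := (hf.comp (h := p) (fun τ ↦ toGL (gam p none) • τ) (N := p * p) (mul_ne_zero (pne p) (pne p))
    (c := 1) fun τ ↦ ?_).smul ((p : ℂ) ^ k)
  · rw [PowerSeries.rescale_one, RingHom.id_apply, PowerSeries.expand_mul _ (pne p) _ (pne p)] at h
    convert h using 1
    ext τ
    simp [conj, denom_gam_none]
  · rw [coe_smul_of_det_pos (det_toGL_pos _), num_gam_none, denom_gam_none, Function.Periodic.qParam,
      Function.Periodic.qParam, ← Complex.exp_nat_mul, one_mul]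
    congr 1
    have : (p : ℂ) ≠ 0 := by exact_mod_cast pne p
    push_cast
    field_simp

lemma hasQ_conj_some (hf : HasQ 1 f A) (b : ZMod p) : HasQ p (conj p k f (toGL (gam p (some b))))
    (PowerSeries.rescale (zet p ^ b.val) A) := by
  have hp0 : (p : ℂ) ≠ 0 := by exact_mod_cast pne p
  have h := hf.comp (h := p) (fun τ ↦ toGL (gam p (some b)) • τ) (N := 1) one_ne_zero
    (c := zet p ^ b.val) fun τ ↦ ?_
  · rw [PowerSeries.expand_one_apply] at h
    convert h using 1
    ext τ
    rw [conj, denom_gam_some, ← zpow_add₀ hp0]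
    simp
  · rw [coe_smul_of_det_pos (det_toGL_pos _), num_gam_some, denom_gam_some, Function.Periodic.qParam,
      Function.Periodic.qParam, pow_one, zet, ← Complex.exp_nat_mul, ← Complex.exp_add]
    congr 1
    push_cast
    field_simp
    ring

lemma hasQ_level_one_of_SL {F : ℍ → ℂ} {B : PowerSeries ℂ}
    (hF : ∀ (σ : SL(2, ℤ)) τ, F (σ • τ) = denom (σ : GL (Fin 2) ℝ) τ ^ k * F τ) (hB : HasQ p F B) :
    ∃ A, LevelOne k F A ∧ B = PowerSeries.expand p (pne p) A := by
  have hpp : (0 : ℝ) < p := by exact_mod_cast prime_pos p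
  have hs (σ : SL(2, ℤ)) : F ∣[k] σ = F := by
    ext τ
    rw [ModularForm.SL_slash_apply, hF, zpow_neg]
    have := zpow_ne_zero k (denom_ne_zero (σ : GL (Fin 2) ℝ) τ)
    field_simp
  let G : ModularForm 𝒮ℒ k :=
    { toFun := F
      slash_action_eq' := fun M hM ↦ by
        obtain ⟨M, rfl⟩ := hM
        exact hs M
      holo' := hB.mdiff hpp
      bdd_at_cusps' := fun hc ↦ by
        rw [OnePoint.isBoundedAt_iff_forall_SL2Z hc]
        intro γ _
        rw [hs γ]
        exact hB.isBoundedAtImInfty hpp }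
  have h := LevelOne.of_modularForm G
  exact ⟨_, h, HasQ.ext hpp hB h.hasQ.level_p⟩

/-- The power series whose coefficients are those of index divisible by `p`. -/
def unexpand {R : Type*} [CommRing R] (p : ℕ) (A : PowerSeries R) : PowerSeries R :=
  PowerSeries.mk fun n ↦ PowerSeries.coeff (p * n) A

lemma exists_levelOne_map {R : Type*} [CommRing R] (φ : R →+* ℂ) (hφ : Injective φ) {F : ℍ → ℂ}
    {B : PowerSeries R}
    (hF : ∀ (σ : SL(2, ℤ)) τ, F (σ • τ) = denom (σ : GL (Fin 2) ℝ) τ ^ k * F τ)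
    (hB : HasQ p F (B.map φ)) :
    ∃ A : PowerSeries R, LevelOne k F (A.map φ) ∧ B = PowerSeries.expand p (pne p) A := by
  obtain ⟨A, hA, h⟩ := hasQ_level_one_of_SL hF hB
  have h1 : (unexpand p B).map φ = A := by
    ext n
    rw [PowerSeries.coeff_map, unexpand, PowerSeries.coeff_mk, ← PowerSeries.coeff_map, h,
      PowerSeries.coeff_expand_mul]
  refine ⟨unexpand p B, by rwa [h1], ?_⟩
  ext n
  apply hφ
  rw [← PowerSeries.coeff_map, ← PowerSeries.coeff_map, PowerSeries.map_expand, h1, h]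

end Conjugates

section Root

variable (V : ValuationSubring ℂ) [hV : Fact ((p : V) ∈ maximalIdeal V)]

lemma exists_zet : ∃ z : V, (z : ℂ) = zet p ∧ res V z = 1 := by
  have hz : zet p ∈ V := by
    rcases V.mem_or_inv_mem (zet p) with h | h
    · exact h
    · have : zet p = (zet p)⁻¹ ^ (p - 1) := by
        rw [inv_pow, eq_comm]
        refine inv_eq_of_mul_eq_one_left ?_
        rw [← pow_succ', Nat.sub_add_cancel (prime_pos p), zet_pow]
      rw [this]
      exact pow_mem h _
  refine ⟨⟨zet p, hz⟩, rfl, ?_⟩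
  have := charP_kap p V
  have h1 : (⟨zet p, hz⟩ : V) ^ p = 1 := Subtype.ext (by simpa using zet_pow)
  have h2 : (res V ⟨zet p, hz⟩ - 1) ^ p = 0 := by
    rw [sub_pow_char, one_pow, ← map_pow, h1, map_one, sub_self]
  exact sub_eq_zero.mp (pow_eq_zero_iff (pne p) |>.mp h2)

end Root

end SSP

namespace SSP

open UpperHalfPlane Function IsLocalRing
open scoped MatrixGroups ModularForm

section Congruence

/-- Substitution of `q ^ p` for `q`. -/
abbrev ex {R : Type*} [CommRing R] : PowerSeries R →ₐ[R] PowerSeries R := PowerSeries.expand p (pne p)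

lemma expand_dq {K : Type*} [Field K] [CharP K p] (h : IsUnit (1728 : K)) : ex p (dq K) = dq K ^ p := by
  have : ExpChar K p := ExpChar.prime Fact.out
  have h1 : ((ex p (dq K)).map (frobenius K p)) = dq K ^ p := MvPowerSeries.map_frobenius_expand p _
  rwa [PowerSeries.map_expand, map_dq h] at h1

lemma expand_e4 {K : Type*} [Field K] [CharP K p] : ex p (e4 K) = e4 K ^ p := by
  have : ExpChar K p := ExpChar.prime Fact.out
  have h1 : ((ex p (e4 K)).map (frobenius K p)) = e4 K ^ p := MvPowerSeries.map_frobenius_expand p _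
  rwa [PowerSeries.map_expand, map_e4] at h1

/-- The `q`-expansion of the product of the `y Δ - Δ ∣ γ`. -/
def serR {R : Type*} [CommRing R] (z y y' : R) : PowerSeries R :=
  (ex p (dq R) - PowerSeries.C y' * ex p (ex p (dq R))) *
    ∏ b : ZMod p, (PowerSeries.C y * ex p (dq R) - PowerSeries.rescale (z ^ b.val) (dq R))

/-- The `q`-expansion of the product of the `E₄³ (Δ ∣ γ) - (E₄³ ∣ γ) Δ`. -/
def serG {R : Type*} [CommRing R] (z : R) : PowerSeries R :=
  (ex p (e4 R ^ 3) * ex p (ex p (dq R)) - ex p (ex p (e4 R ^ 3)) * ex p (dq R)) *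
    ∏ b : ZMod p, (ex p (e4 R ^ 3) * PowerSeries.rescale (z ^ b.val) (dq R) -
      PowerSeries.rescale (z ^ b.val) (e4 R ^ 3) * ex p (dq R))

section Map

variable {R S : Type*} [CommRing R] [CommRing S] (hR : IsUnit (1728 : R)) (φ : R →+* S)

include hR

lemma map_serR (z y y' : R) : (serR p z y y').map φ = serR p (φ z) (φ y) (φ y') := by
  simp only [serR, map_mul, map_sub, map_prod, PowerSeries.map_expand, map_dq hR, PowerSeries.map_C,
    ← PowerSeries.rescale_map, map_pow]

lemma map_serG (z : R) : (serG p z).map φ = serG p (φ z) := by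
  simp only [serG, map_mul, map_sub, map_prod, PowerSeries.map_expand, map_dq hR, map_e4,
    ← PowerSeries.rescale_map, map_pow]

end Map

lemma serR_eq {K : Type*} [Field K] [CharP K p] (h : IsUnit (1728 : K)) (y : K) :
    serR p 1 y 0 = ex p (PowerSeries.C (y ^ p) * dq K ^ (p + 1) - dq K ^ 2) := by
  have : CharP (PowerSeries K) p := charP_of_injective_ringHom (PowerSeries.C_injective (R := K)) p
  simp only [serR, one_pow, PowerSeries.rescale_one, RingHom.id_apply, map_zero, zero_mul, sub_zero,
    Finset.prod_const, Finset.card_univ, ZMod.card]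
  rw [sub_pow_char, mul_pow, ← expand_dq p h, ← map_pow, ← map_pow]
  rw [map_sub, map_mul, PowerSeries.expand_C, map_pow (ex p) (dq K) (p + 1), map_pow (ex p) (dq K) 2,
    map_pow (ex p) (dq K) p]
  ring

lemma serG_eq {K : Type*} [Field K] [CharP K p] (h : IsUnit (1728 : K)) :
    serG p (1 : K) = ex p (-(((e4 K ^ 3) ^ p * dq K - e4 K ^ 3 * dq K ^ p) ^ 2)) := by
  have : CharP (PowerSeries K) p := charP_of_injective_ringHom (PowerSeries.C_injective (R := K)) p
  simp only [serG, one_pow, PowerSeries.rescale_one, RingHom.id_apply,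
    Finset.prod_const, Finset.card_univ, ZMod.card]
  rw [← neg_sub (e4 K ^ 3 * ex p (dq K)), neg_pow]
  have h4 : ex p (e4 K ^ 3) = (e4 K ^ 3) ^ p := by rw [map_pow, expand_e4, pow_right_comm]
  have hE : (ex p (e4 K ^ 3) * dq K - e4 K ^ 3 * ex p (dq K)) ^ p =
      ex p ((e4 K ^ 3) ^ p * dq K - e4 K ^ 3 * dq K ^ p) := by
    rw [h4, expand_dq p h, sub_pow_char]
    simp only [map_sub, map_mul, map_pow, expand_e4, expand_dq p h]
    ring
  have h5 : ex p (e4 K ^ 3) * ex p (ex p (dq K)) - ex p (ex p (e4 K ^ 3)) * ex p (dq K) =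
      - ex p ((e4 K ^ 3) ^ p * dq K - e4 K ^ 3 * dq K ^ p) := by
    simp only [map_sub, map_mul, map_pow, expand_e4, expand_dq p h]
    ring
  rw [← neg_pow, neg_sub, hE, h5, map_neg, map_pow]
  ring

end Congruence

end SSP

namespace SSP

open UpperHalfPlane Function IsLocalRing
open scoped MatrixGroups ModularForm

section Transfer

local notation "Δ" => ModularForm.discriminant
local notation "E₄" => (ModularForm.E₄ : ℍ → ℂ)

omit [Fact p.Prime] in
variable {p} in
lemma natDegree_le_of_constantCoeff_hom {R : Type*} [CommRing R] {A B : PowerSeries R}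
    (hA : PowerSeries.constantCoeff A = 1) (hB : PowerSeries.constantCoeff B = 0) {N : ℕ} {P : R[X]}
    (hP : P.natDegree ≤ N + 1)
    (h : PowerSeries.constantCoeff (hom (N + 1) (P.map (PowerSeries.C (R := R))) A B) = 0) :
    P.natDegree ≤ N := by
  rw [hom, Finset.sum_range_succ, map_add, map_sum, Finset.sum_eq_zero] at h
  · have h3 : P.coeff (N + 1) = 0 := by simpa [hA] using h
    by_contra! hlt
    have : P.natDegree = N + 1 := by omega
    rw [← this, coeff_natDegree, leadingCoeff_eq_zero] at h3
    simp [h3] at hlt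
  · intro i hi
    have : N + 1 - i ≠ 0 := by have := Finset.mem_range.mp hi; omega
    simp [this, hB]

lemma exists_poly_weight_zero {R : Type*} [CommRing R] {φ : R →+* ℂ} (hφ : Injective φ)
    (hR : IsUnit (1728 : R)) {N : ℕ} {k : ℤ} (hk : k = 12 * N) {f : ℍ → ℂ} {A : PowerSeries R}
    (hf : LevelOne k f (A.map φ)) : ∃ P : R[X], P.natDegree ≤ N ∧
      A = hom N (P.map (PowerSeries.C (R := R))) (e4 R ^ 3) (dq R) ∧
      ∀ τ, f τ = hom N (P.map φ) (E₄ τ ^ 3) (Δ τ) := by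
  obtain ⟨P, h1, h2⟩ := exists_poly hφ hR 0 0
    (fun F ↦ ModularFormClass.levelOne_neg_weight_eq_zero (by norm_num) F) N
    (f := f) (A := A) (by rw [hk] at hf; simpa using hf)
  refine ⟨P, h1, by simpa using h2, fun τ ↦ ?_⟩
  simpa using eq_hom_of_eq hR hf.hasQ h2 τ

variable {p} in
lemma levelOne_E₄_cube : LevelOne 12 (ModularForm.E₄ ^ 3 : ℍ → ℂ) (e4 ℂ ^ 3) := by
  simpa using levelOne_E₄.pow 3

/-- The family `y Δ - Δ ∣ γ`. -/
def famR (y : ℂ) (i : Option (ZMod p)) : ℍ → ℂ := y • Δ - conj p 12 Δ (toGL (gam p i))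

/-- The family `E₄³ (Δ ∣ γ) - (E₄³ ∣ γ) Δ`. -/
def famG (i : Option (ZMod p)) : ℍ → ℂ :=
  (ModularForm.E₄ ^ 3 : ℍ → ℂ) * conj p 12 Δ (toGL (gam p i)) -
    conj p 12 (ModularForm.E₄ ^ 3 : ℍ → ℂ) (toGL (gam p i)) * Δ

lemma famR_fam (y : ℂ) : Fam (p := p) 12 (famR p y) :=
  (fam_const (levelOne_discriminant.smul y)).sub (fam_conj levelOne_discriminant)

lemma famG_fam : Fam (p := p) (12 + 12) (famG p) :=
  ((fam_const levelOne_E₄_cube).mul (fam_conj levelOne_discriminant)).sub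
    ((fam_conj levelOne_E₄_cube).mul (fam_const levelOne_discriminant))

lemma hasQ_famR {y y' : ℂ} (hy : y * y' = p ^ 12) :
    HasQ p (fun τ ↦ y⁻¹ * ∏ i, famR p y i τ) (serR p (zet p) y y') := by
  have hpp : (p : ℂ) ≠ 0 := by exact_mod_cast pne p
  have hy0 : y ≠ 0 := by rintro rfl; rw [zero_mul] at hy; exact pow_ne_zero _ hpp hy.symm
  have hd := levelOne_discriminant.hasQ.level_p (p := p)
  have h1 := ((hd.smul y).sub (hasQ_conj_none (k := 12) levelOne_discriminant.hasQ)).smul y⁻¹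
  have h2 := HasQ.prod Finset.univ fun (b : ZMod p) _ ↦
    (hd.smul y).sub (hasQ_conj_some (k := 12) levelOne_discriminant.hasQ b)
  convert h1.mul h2 using 1
  · ext τ
    rw [Fintype.prod_option]
    simp [famR, mul_assoc]
  · rw [serR]
    congr 1
    · rw [smul_sub, smul_smul, smul_smul, inv_mul_cancel₀ hy0, one_smul, PowerSeries.smul_eq_C_mul]
      congr 3
      rw [eq_inv_mul_iff_mul_eq₀ hy0, hy]
      norm_cast
    · simp only [PowerSeries.smul_eq_C_mul]

lemma hasQ_famG : HasQ p (fun τ ↦ ((p : ℂ) ^ 12)⁻¹ * ∏ i, famG p i τ) (serG p (zet p)) := by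
  have hpp : (p : ℂ) ^ 12 ≠ 0 := pow_ne_zero _ (by exact_mod_cast pne p)
  have hd := levelOne_discriminant.hasQ.level_p (p := p)
  have hE := levelOne_E₄_cube.hasQ.level_p (p := p)
  have h1 := ((hE.mul (hasQ_conj_none (k := 12) levelOne_discriminant.hasQ)).sub
    ((hasQ_conj_none (k := 12) levelOne_E₄_cube.hasQ).mul hd)).smul ((p : ℂ) ^ 12)⁻¹
  have h2 := HasQ.prod Finset.univ fun (b : ZMod p) _ ↦
    (hE.mul (hasQ_conj_some (k := 12) levelOne_discriminant.hasQ b)).sub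
      ((hasQ_conj_some (k := 12) levelOne_E₄_cube.hasQ b).mul hd)
  convert h1.mul h2 using 1
  · ext τ
    rw [Fintype.prod_option]
    simp [famG, mul_assoc]
  · rw [serG]
    congr 1
    rw [show (p : ℂ) ^ (12 : ℤ) = p ^ 12 by norm_cast, mul_smul_comm, smul_mul_assoc, ← smul_sub,
      smul_smul, inv_mul_cancel₀ hpp, one_smul]

variable (V : ValuationSubring ℂ) [hV : Fact ((p : V) ∈ maximalIdeal V)] (hp : 5 ≤ p)

include hp

lemma exists_polyR {y y' : V} (hy : y * y' = p ^ 12) (hy' : res V y' = 0) {h : (kap V)[X]}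
    (hdeg : h.natDegree ≤ p - 1)
    (hh : hom (p - 1) (h.map (PowerSeries.C (R := kap V))) (e4 (kap V) ^ 3) (dq (kap V)) = 1) :
    ∃ P : V[X], P.natDegree ≤ p + 1 ∧
      (∀ τ, (y : ℂ)⁻¹ * ∏ i, famR p y i τ = hom (p + 1) (P.map V.subtype) (E₄ τ ^ 3) (Δ τ)) ∧
      P.map (res V) = C (res V y ^ p) - h := by
  have := charP_kap p V
  have hyC : (y : ℂ) * (y' : ℂ) = p ^ 12 := by
    have := congrArg (Subtype.val) hy
    simpa using this
  obtain ⟨z, hz, hz1⟩ := exists_zet p V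
  have hu := isUnit_1728_V p V hp
  have huk := isUnit_1728_kap p V hp
  obtain ⟨A, hA, hB⟩ := exists_levelOne_map (p := p) (k := 12 * (p + 1)) V.subtype
    V.subtype_injective (F := fun τ ↦ (y : ℂ)⁻¹ * ∏ i, famR p y i τ) (B := serR p z y y')
    (fun σ τ ↦ by
      rw [(famR_fam p y).prod σ τ]; ring)
    (by
      rw [map_serR p hu]
      have := hasQ_famR p hyC
      rwa [← hz] at this)
  obtain ⟨P, h1, h2, h3⟩ := exists_poly_weight_zero V.subtype_injective hu (N := p + 1)
    (by push_cast; ring) hA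
  refine ⟨P, h1, h3, ?_⟩
  have hA' : A.map (res V) = PowerSeries.C (res V y ^ p) * dq (kap V) ^ (p + 1) - dq (kap V) ^ 2 := by
    have h4 := congrArg (PowerSeries.map (res V)) hB
    rw [map_serR p hu, hz1, hy', serR_eq p huk, PowerSeries.map_expand] at h4
    ext n
    have h5 := congrArg (PowerSeries.coeff (p * n)) h4
    rw [PowerSeries.coeff_expand_mul, PowerSeries.coeff_expand_mul] at h5
    exact h5.symm
  rw [h2, ← hom_map, map_pow, map_e4, map_dq hu, Polynomial.map_map] at hA'
  rw [← sub_eq_zero]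
  have hdeg1 : (h.map (PowerSeries.C (R := kap V))).natDegree ≤ p - 1 := natDegree_map_le.trans hdeg
  refine eq_zero_of_hom_eq_zero (A := e4 (kap V) ^ 3) (B := dq (kap V)) ?_ ?_ (coeff_one_dq huk) (p + 1) ?_ ?_
  · simp
  · obtain ⟨u, hu⟩ := exists_dq_eq huk
    simp [hu]
  · refine (natDegree_sub_le_of_le (natDegree_map_le.trans h1) ((natDegree_sub_le_of_le (m := 0)
      (natDegree_C _).le hdeg).trans (b := max 0 (p - 1)) (c := p + 1) (by omega))).trans (max_self _).le
  · rw [Polynomial.map_sub, Polynomial.map_map, hom_sub, Polynomial.map_sub, hom_sub, Polynomial.map_C]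
    have e2 : hom (p + 1) (h.map (PowerSeries.C (R := kap V))) (e4 (kap V) ^ 3) (dq (kap V)) =
        dq (kap V) ^ 2 := by
      have : p + 1 = p - 1 + 1 + 1 := by have := prime_pos p; omega
      rw [this, hom_succ (by omega), hom_succ hdeg1, hh]
      ring
    have e3 : hom (p + 1) (C (PowerSeries.C (R := kap V) (res V y ^ p))) (e4 (kap V) ^ 3) (dq (kap V)) =
        PowerSeries.C (R := kap V) (res V y ^ p) * dq (kap V) ^ (p + 1) := by
      rw [← mul_one (C _), hom_C_mul, hom_one]
    rw [e2, e3, ← hA']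
    have : (PowerSeries.map (res V)).comp (PowerSeries.C (R := V)) =
        (PowerSeries.C (R := kap V)).comp (res V) := by
      ext; simp
    rw [this, sub_self]

lemma exists_polyG : ∃ P : V[X], P.natDegree = 2 * p ∧ IsUnit P.leadingCoeff ∧
      (∀ τ, ((p : ℂ) ^ 12)⁻¹ * ∏ i, famG p i τ =
        hom (2 * (p + 1)) (P.map V.subtype) (E₄ τ ^ 3) (Δ τ)) ∧
      P.map (res V) = -((X ^ p - X) ^ 2) := by
  have := charP_kap p V
  obtain ⟨z, hz, hz1⟩ := exists_zet p V
  have hu := isUnit_1728_V p V hp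
  have huk := isUnit_1728_kap p V hp
  obtain ⟨A, hA, hB⟩ := exists_levelOne_map (p := p) (k := (12 + 12) * (p + 1)) V.subtype
    V.subtype_injective (F := fun τ ↦ ((p : ℂ) ^ 12)⁻¹ * ∏ i, famG p i τ) (B := serG p z)
    (fun σ τ ↦ by
      rw [(famG_fam p).prod σ τ]; ring)
    (by
      rw [map_serG p hu]
      have := hasQ_famG p
      rwa [← hz] at this)
  obtain ⟨P, h1, h2, h3⟩ := exists_poly_weight_zero V.subtype_injective hu (N := 2 * (p + 1))
    (by push_cast; ring) hA
  have hA' : A.map (res V) = -(((e4 (kap V) ^ 3) ^ p * dq (kap V) - e4 (kap V) ^ 3 * dq (kap V) ^ p) ^ 2) := by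
    have h4 := congrArg (PowerSeries.map (res V)) hB
    rw [map_serG p hu, hz1, serG_eq p huk, PowerSeries.map_expand] at h4
    ext n
    have h5 := congrArg (PowerSeries.coeff (p * n)) h4
    rw [PowerSeries.coeff_expand_mul, PowerSeries.coeff_expand_mul] at h5
    exact h5.symm
  have hc : (X ^ p - X : (kap V)[X]).natDegree ≤ p + 1 := by
    refine (natDegree_sub_le_of_le (m := p) (n := 1) (natDegree_X_pow_le _) natDegree_X_le).trans ?_
    have := prime_pos p
    simp
  have hred : P.map (res V) = -((X ^ p - X) ^ 2) := by
    have h2' := h2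
    apply_fun PowerSeries.map (res V) at h2'
    rw [hA', ← hom_map, map_pow, map_e4, map_dq hu, Polynomial.map_map] at h2'
    rw [← sub_eq_zero]
    have hc2 : ((X ^ p - X : (kap V)[X]) ^ 2).natDegree ≤ 2 * (p + 1) := natDegree_pow_le_of_le 2 hc
    refine eq_zero_of_hom_eq_zero (A := e4 (kap V) ^ 3) (B := dq (kap V)) ?_ ?_ (coeff_one_dq huk)
      (2 * (p + 1)) ?_ ?_
    · simp
    · obtain ⟨u, hu⟩ := exists_dq_eq huk
      simp [hu]
    · refine (natDegree_sub_le_of_le (natDegree_map_le.trans h1) ?_).trans (max_self _).le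
      rwa [natDegree_neg]
    · have e1 : (PowerSeries.map (res V)).comp (PowerSeries.C (R := V)) =
          (PowerSeries.C (R := kap V)).comp (res V) := by
        ext; simp
      rw [Polynomial.map_sub, hom_sub, Polynomial.map_map, ← e1, ← h2', Polynomial.map_neg,
        Polynomial.map_pow, Polynomial.map_sub, Polynomial.map_pow, map_X, ← neg_one_mul (_ ^ 2), ← neg_one_mul ((X ^ p - X) ^ 2)]
      have e2 : (X ^ p - X : (PowerSeries (kap V))[X]).natDegree ≤ p + 1 := by
        refine (natDegree_sub_le_of_le (m := p) (n := 1) (natDegree_X_pow_le _) natDegree_X_le).trans ?_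
        have := prime_pos p
        simp
      have e3 : (-1 : (PowerSeries (kap V))[X]) = C (-1) := by simp
      rw [e3, hom_C_mul, hom_pow e2, hom_sub, hom_X_pow (by omega)]
      have e4' := hom_X_pow (m := 1) (N := p + 1) (by omega) (e4 (kap V) ^ 3) (dq (kap V))
      rw [pow_one] at e4'
      rw [e4']
      simp only [Nat.add_sub_cancel_left, Nat.add_sub_cancel]
      ring
  obtain ⟨u, hdX⟩ := exists_dq_eq hu
  have hd0 : PowerSeries.constantCoeff (dq V) = 0 := by simp [hdX]
  have hX : PowerSeries.X ^ (2 * p) ∣ serG p z := by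
    have hd : (PowerSeries.X : PowerSeries V) ∣ dq V := ⟨_, hdX⟩
    have he : (PowerSeries.X : PowerSeries V) ^ p ∣ ex p (dq V) := by
      have := map_dvd (ex p) hd
      rwa [PowerSeries.expand_X] at this
    have he1 : (PowerSeries.X : PowerSeries V) ∣ ex p (dq V) := (dvd_pow_self _ (pne p)).trans he
    have he2 : (PowerSeries.X : PowerSeries V) ^ p ∣ ex p (ex p (dq V)) := by
      have := map_dvd (ex p) he1
      rwa [PowerSeries.expand_X] at this
    rw [two_mul, pow_add, serG]
    refine mul_dvd_mul (dvd_sub (he2.mul_left _) (he.mul_left _)) ?_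
    have : (PowerSeries.X : PowerSeries V) ^ p = ∏ b : ZMod p, PowerSeries.X := by
      rw [Finset.prod_const, Finset.card_univ, ZMod.card]
    rw [this]
    refine Finset.prod_dvd_prod_of_dvd _ _ fun b _ ↦ dvd_sub (Dvd.dvd.mul_left ?_ _) (he1.mul_left _)
    rw [PowerSeries.X_dvd_iff] at hd ⊢
    rw [← PowerSeries.coeff_zero_eq_constantCoeff_apply, PowerSeries.coeff_rescale, pow_zero, one_mul,
      PowerSeries.coeff_zero_eq_constantCoeff_apply, hd]
  have hA0 (m : ℕ) (hm : m < 2) : PowerSeries.coeff m A = 0 := by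
    rw [PowerSeries.X_pow_dvd_iff] at hX
    have := hX (p * m) (by rw [mul_comm]; exact Nat.mul_lt_mul_of_pos_right hm (prime_pos p))
    rwa [hB, PowerSeries.coeff_expand_mul] at this
  have hA1 := hA0 0 (by norm_num)
  rw [h2] at hA1
  have hdeg1 : P.natDegree ≤ 2 * p + 1 := natDegree_le_of_constantCoeff_hom (A := e4 V ^ 3) (by simp) hd0 h1
    (by rwa [PowerSeries.coeff_zero_eq_constantCoeff_apply] at hA1)
  have hA2 := hA0 1 (by norm_num)
  rw [h2, show 2 * (p + 1) = 2 * p + 1 + 1 by ring, hom_succ (natDegree_map_le.trans hdeg1)] at hA2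
  have hdeg2 : P.natDegree ≤ 2 * p := by
    refine natDegree_le_of_constantCoeff_hom (A := e4 V ^ 3) (B := dq V) (by simp) hd0 hdeg1 ?_
    have hu1 := coeff_one_dq hu
    rw [hdX, mul_assoc, ← zero_add 1, PowerSeries.coeff_succ_X_mul, PowerSeries.coeff_zero_eq_constantCoeff_apply] at hA2
    rw [hdX, ← zero_add 1, PowerSeries.coeff_succ_X_mul, PowerSeries.coeff_zero_eq_constantCoeff_apply] at hu1
    rwa [map_mul, hu1, one_mul, ← hdX] at hA2
  have hpX : (X ^ p - X : (kap V)[X]).natDegree = p := by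
    rw [natDegree_sub_eq_left_of_natDegree_lt] <;> rw [natDegree_X_pow]
    rw [natDegree_X]; omega
  have hc : IsUnit (P.coeff (2 * p)) := by
    have h := congrArg (fun Q ↦ Q.coeff (2 * p)) hred
    simp only [coeff_map] at h
    have h' : (-((X ^ p - X : (kap V)[X]) ^ 2)).coeff (2 * p) = -1 := by
      have hm : (X ^ p - X : (kap V)[X]).Monic := by
        refine monic_X_pow_sub ?_
        rw [degree_X]; exact_mod_cast (show 1 < p by omega)
      have := (hm.pow 2).coeff_natDegree
      rw [hm.natDegree_pow, hpX] at this
      rw [coeff_neg, this]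
    rw [h'] at h
    by_contra hn
    have := (IsLocalRing.mem_maximalIdeal _).mpr hn
    rw [← IsLocalRing.residue_eq_zero_iff] at this
    have h0 : res V (P.coeff (2 * p)) = 0 := this
    rw [h0] at h
    simp at h
  have hnd : P.natDegree = 2 * p := hdeg2.antisymm (le_natDegree_of_ne_zero hc.ne_zero)
  exact ⟨P, hnd, by rwa [leadingCoeff, hnd], h3, hred⟩

end Transfer

end SSP

namespace SSP

open UpperHalfPlane Function IsLocalRing
open scoped MatrixGroups ModularForm

section FixedPoints

local notation "Δ" => ModularForm.discriminant
local notation "E₄" => (ModularForm.E₄ : ℍ → ℂ)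

/-- The modular invariant, as a function on the upper half plane. -/
def jf (τ : ℍ) : ℂ := E₄ τ ^ 3 / Δ τ

variable {p}

/-- The adjugate of an integral matrix of determinant `p`. -/
def Mp.adj (M : Mp p) : Mp p := ⟨!![M.1 1 1, -M.1 0 1; -M.1 1 0, M.1 0 0], by
  have := M.det_eq
  rw [Matrix.det_fin_two]
  simp
  linarith⟩

lemma denom_toGL (M : Mp p) (τ : ℍ) : denom (toGL M) τ = M.1 1 0 * τ + M.1 1 1 := by
  simp only [denom, toGL_apply]
  simp

lemma num_toGL (M : Mp p) (τ : ℍ) : num (toGL M) τ = M.1 0 0 * τ + M.1 0 1 := by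
  simp only [num, toGL_apply]
  simp

lemma toGL_smul_eq_iff (M : Mp p) (τ σ : ℍ) : toGL M • τ = σ ↔
    (M.1 0 0 * τ + M.1 0 1 : ℂ) = σ * (M.1 1 0 * τ + M.1 1 1) := by
  have hd := denom_ne_zero (toGL M) τ
  rw [UpperHalfPlane.ext_iff, UpperHalfPlane.coe_smul_of_det_pos (det_toGL_pos M), div_eq_iff hd,
    denom_toGL, num_toGL]

omit [Fact p.Prime] in
lemma Mp.det_eq_complex (M : Mp p) :
    (M.1 0 0 * M.1 1 1 - M.1 0 1 * M.1 1 0 : ℂ) = p := by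
  exact_mod_cast congrArg (Int.cast : ℤ → ℂ) M.det_eq

lemma not_sq_eq_prime (a : ℤ) : a * a ≠ p := by
  intro h
  have hp : Prime (p : ℤ) := Nat.prime_iff_prime_int.mp Fact.out
  exact hp.irreducible.not_isSquare ⟨a, h.symm⟩

variable {M : Mp p} {τ : ℍ}

lemma fix_quadratic (hM : toGL M • τ = τ) :
    (M.1 1 0 * τ ^ 2 + (M.1 1 1 - M.1 0 0) * τ - M.1 0 1 : ℂ) = 0 := by
  rw [toGL_smul_eq_iff] at hM
  linear_combination -hM

lemma lower_left_ne_zero (hM : toGL M • τ = τ) : M.1 1 0 ≠ 0 := by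
  intro h0
  have h := fix_quadratic hM
  have hd := M.det_eq
  rw [h0] at h hd
  have him := congrArg Complex.im h
  have hre := congrArg Complex.re h
  simp at him hre
  have h1 : M.1 1 1 = M.1 0 0 := by
    rcases him with h | h
    · have : (M.1 1 1 : ℝ) = M.1 0 0 := by linarith
      exact_mod_cast this
    · exact absurd h τ.im_ne_zero
  rw [h1] at hd
  exact not_sq_eq_prime (p := p) (M.1 0 0) (by linarith)

lemma trace_sq_lt (hM : toGL M • τ = τ) : (M.1 0 0 + M.1 1 1) ^ 2 < 4 * p := by
  have hc := lower_left_ne_zero hM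
  by_contra! hge
  have h := fix_quadratic hM
  have hd := M.det_eq_complex
  have h1 : (2 * M.1 1 0 * τ + (M.1 1 1 - M.1 0 0) : ℂ) ^ 2 =
      ((((M.1 0 0 + M.1 1 1) ^ 2 - 4 * p : ℤ) : ℝ) : ℂ) := by
    push_cast
    linear_combination 4 * (M.1 1 0 : ℂ) * h - 4 * hd
  have hge' : (0 : ℝ) ≤ (((M.1 0 0 + M.1 1 1) ^ 2 - 4 * p : ℤ) : ℝ) := by
    exact_mod_cast sub_nonneg.mpr hge
  set w : ℂ := 2 * M.1 1 0 * τ + (M.1 1 1 - M.1 0 0) with hw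
  have hwim : w.im = 2 * M.1 1 0 * τ.im := by simp [hw]
  have hne : w.im ≠ 0 := by
    rw [hwim]
    have := τ.im_ne_zero
    have : (M.1 1 0 : ℝ) ≠ 0 := by exact_mod_cast hc
    positivity
  have him := congrArg Complex.im h1
  have hre := congrArg Complex.re h1
  rw [Complex.ofReal_im, pow_two, Complex.mul_im] at him
  rw [Complex.ofReal_re, pow_two, Complex.mul_re] at hre
  have : w.re = 0 := by
    have : w.re * w.im = 0 := by linarith
    rcases mul_eq_zero.mp this with h | h
    · exact h
    · exact absurd h hne
  rw [this] at hre
  have := mul_self_pos.mpr hne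
  linarith

lemma eigenvalue_mul (hM : toGL M • τ = τ) :
    denom (toGL M) τ * (((M.1 0 0 + M.1 1 1 : ℤ) : ℂ) - denom (toGL M) τ) = p := by
  rw [denom_toGL]
  have h := fix_quadratic hM
  have hd := M.det_eq_complex
  push_cast
  linear_combination (-(M.1 1 0 : ℂ)) * h + hd

lemma adj_smul (hM : toGL M • τ = τ) : toGL M.adj • τ = τ := by
  have h := fix_quadratic hM
  rw [toGL_smul_eq_iff]
  simp [Mp.adj]
  linear_combination h

lemma denom_adj (M : Mp p) (τ : ℍ) :
    denom (toGL M.adj) τ = ((M.1 0 0 + M.1 1 1 : ℤ) : ℂ) - denom (toGL M) τ := by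
  rw [denom_toGL, denom_toGL]
  simp [Mp.adj]
  ring

lemma exists_conj_eq (M : Mp p) : ∃ i : Option (ZMod p), ∀ (k : ℤ) (f : ℍ → ℂ) (A : PowerSeries ℂ),
    LevelOne k f A → ∀ τ, conj p k f (toGL (gam p i)) τ = conj p k f (toGL M) τ := by
  obtain ⟨δ, i, hi⟩ := exists_eq_smul_gam M
  refine ⟨i, fun k f A hf τ ↦ ?_⟩
  rw [hi, toGL_smul, conj_SL_mul hf (det_toGL_pos _)]

variable (V : ValuationSubring ℂ)

lemma eigenvalue_mem (hM : toGL M • τ = τ) : denom (toGL M) τ ∈ V := by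
  rcases V.mem_or_inv_mem (denom (toGL M) τ) with h | h
  · exact h
  · have h1 := eigenvalue_mul hM
    have : denom (toGL M) τ =
        ((M.1 0 0 + M.1 1 1 : ℤ) : ℂ) - (p : ℂ) * (denom (toGL M) τ)⁻¹ := by
      rw [← h1]
      field_simp [denom_ne_zero (toGL M) τ]
      ring
    rw [this]
    exact sub_mem (intCast_mem _ _) (mul_mem (natCast_mem _ _) h)

variable [hV : Fact ((p : V) ∈ maximalIdeal V)]

lemma eval_eq_zero_of_hom {N : ℕ} {P : V[X]} {c : V} {a b : ℂ} (hb : b ≠ 0)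
    (hP : P.natDegree ≤ N) (hc : (c : ℂ) = a / b) :
    hom N (P.map V.subtype) a b = 0 ↔ P.eval c = 0 := by
  rw [hom_eq_pow_mul (natDegree_map_le.trans hP) a hb, ← hc,
    show (c : ℂ) = V.subtype c from rfl, eval_map_apply,
    mul_eq_zero, or_iff_right (pow_ne_zero _ hb), map_eq_zero_iff _ V.subtype_injective]

lemma eval_hasse (hp : 5 ≤ p) (hM : toGL M • τ = τ) {h : (kap V)[X]}
    (hdeg : h.natDegree ≤ p - 1)
    (hh : hom (p - 1) (h.map (PowerSeries.C (R := kap V))) (e4 (kap V) ^ 3) (dq (kap V)) = 1)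
    {c : V} (hc : (c : ℂ) = jf τ) {l l' : V} (hl : (l : ℂ) = denom (toGL M) τ)
    (hl' : (l' : ℂ) = ((M.1 0 0 + M.1 1 1 : ℤ) : ℂ) - denom (toGL M) τ)
    (hres : res V l = 0) : h.eval (res V c) = (res V (l' ^ 12)) ^ p := by
  have hll : l * l' = p := by
    apply Subtype.ext
    push_cast
    rw [hl, hl', eigenvalue_mul hM]
  obtain ⟨P, hP, h1, h2⟩ := exists_polyR p V hp (y := l' ^ 12) (y' := l ^ 12)
    (by rw [← mul_pow, mul_comm, hll]) (by rw [map_pow, hres]; simp) hdeg hh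
  obtain ⟨i, hi⟩ := exists_conj_eq M
  have h3 : famR p ((l' ^ 12 : V) : ℂ) i τ = 0 := by
    rw [famR, Pi.sub_apply, hi _ _ _ levelOne_discriminant, conj, hM, Pi.smul_apply, smul_eq_mul,
      sub_eq_zero]
    congr 1
    have hne := denom_ne_zero (toGL M) τ
    have : (p : ℂ) = l * l' := by rw [← eigenvalue_mul hM, hl, hl']
    rw [zpow_neg, this, ← hl]
    have hl0 : (l : ℂ) ≠ 0 := by rwa [hl]
    push_cast
    norm_cast
    field_simp
    push_cast
    ring
  have h4 := h1 τ
  rw [Finset.prod_eq_zero (Finset.mem_univ i) h3, mul_zero, eq_comm,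
    eval_eq_zero_of_hom V (ModularForm.discriminant_ne_zero τ) hP hc] at h4
  have h5 : (P.map (res V)).eval (res V c) = 0 := by rw [eval_map_apply, h4, map_zero]
  rw [h2, eval_sub, eval_C, sub_eq_zero] at h5
  exact h5.symm

lemma eval_hasse_eq_zero_iff (hp : 5 ≤ p) (hM : toGL M • τ = τ) {h : (kap V)[X]}
    (hdeg : h.natDegree ≤ p - 1)
    (hh : hom (p - 1) (h.map (PowerSeries.C (R := kap V))) (e4 (kap V) ^ 3) (dq (kap V)) = 1)
    {c : V} (hc : (c : ℂ) = jf τ) : h.eval (res V c) = 0 ↔ M.1 0 0 + M.1 1 1 = 0 := by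
  set t : ℤ := M.1 0 0 + M.1 1 1 with ht
  have hadj := adj_smul hM
  set l : V := ⟨_, eigenvalue_mem V hM⟩ with hl
  set l' : V := ⟨_, eigenvalue_mem V hadj⟩ with hl'
  have hl'1 : (l' : ℂ) = (t : ℂ) - denom (toGL M) τ := denom_adj M τ
  have hll : l * l' = p := by
    apply Subtype.ext
    push_cast
    rw [hl'1, ← eigenvalue_mul hM]
  have hsum : l + l' = t := by
    apply Subtype.ext
    push_cast
    rw [hl'1]
    simp [hl]
  have hpr : res V (p : V) = 0 := (residue_eq_zero_iff _).mpr hV.out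
  have hprod : res V l * res V l' = 0 := by rw [← map_mul, hll, hpr]
  have hsum' : res V l + res V l' = (t : kap V) := by rw [← map_add, hsum, map_intCast]
  have htr : M.adj.1 0 0 + M.adj.1 1 1 = t := by simp [Mp.adj, ht, add_comm]
  have key : (res V l' = 0 ∧ h.eval (res V c) = res V l ^ (12 * p)) ∨
      (res V l = 0 ∧ h.eval (res V c) = res V l' ^ (12 * p)) := by
    rcases mul_eq_zero.mp hprod with h0 | h0
    · right
      refine ⟨h0, ?_⟩
      rw [eval_hasse V hp hM hdeg hh hc (l := l) (l' := l') rfl hl'1 h0, map_pow, ← pow_mul]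
    · left
      refine ⟨h0, ?_⟩
      rw [eval_hasse V hp hadj hdeg hh hc (l := l') (l' := l) rfl ?_ h0, map_pow, ← pow_mul]
      rw [htr, denom_adj M τ]
      simp [hl, ht]
  have hcp := charP_kap p V
  have hz : h.eval (res V c) = 0 ↔ (t : kap V) = 0 := by
    have h12 : 12 * p ≠ 0 := by omega
    rcases key with ⟨h0, h1⟩ | ⟨h0, h1⟩
    · rw [h1, pow_eq_zero_iff h12, ← hsum', h0, add_zero]
    · rw [h1, pow_eq_zero_iff h12, ← hsum', h0, zero_add]
  rw [hz, CharP.intCast_eq_zero_iff (kap V) p]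
  refine ⟨fun ⟨k, hk⟩ ↦ ?_, fun h ↦ by rw [h]; exact dvd_zero _⟩
  have hlt := trace_sq_lt hM
  rw [← ht, hk] at hlt
  have hp' : (5 : ℤ) ≤ p := by exact_mod_cast hp
  have hk0 : k = 0 := by
    by_contra hk0
    have h1 : 0 < k ^ 2 := by
      have : k ≠ 0 := hk0
      positivity
    have h2 : (p : ℤ) ^ 2 * 1 ≤ p ^ 2 * k ^ 2 := by
      gcongr
      linarith
    nlinarith
  rw [hk, hk0, mul_zero]

end FixedPoints

end SSP

namespace SSP

open UpperHalfPlane Function IsLocalRing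
open scoped MatrixGroups ModularForm Manifold PeriodPair Topology

section Surjective

local notation "Δ" => ModularForm.discriminant
local notation "E₄" => (ModularForm.E₄ : ℍ → ℂ)
local notation "E₆" => (ModularForm.E₆ : ℍ → ℂ)

lemma LevelOne.tendsto {k : ℤ} {f : ℍ → ℂ} {A : PowerSeries ℂ} (hf : LevelOne k f A) :
    Filter.Tendsto f atImInfty (𝓝 (PowerSeries.coeff 0 A)) := by
  have hanal := ModularFormClass.analyticAt_cuspFunction_zero hf.toModularForm one_pos
    one_mem_strictPeriods_SL
  have := hanal.continuousAt.tendsto.comp (qParam_tendsto_atImInfty one_pos)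
  have h0 : cuspFunction 1 hf.toModularForm 0 = PowerSeries.coeff 0 A := by
    rw [coe_toModularForm]
    conv_rhs => rw [← hf.qExpansion_eq, qExpansion_coeff]
    simp
  rw [h0] at this
  exact this.congr fun τ ↦ SlashInvariantFormClass.eq_cuspFunction hf.toModularForm τ
    one_mem_strictPeriods_SL one_ne_zero

/-- A level one form of positive weight with nonzero constant coefficient vanishes somewhere. -/
lemma LevelOne.exists_eq_zero {k : ℤ} (hk : 0 < k) {f : ℍ → ℂ} {A : PowerSeries ℂ}
    (hf : LevelOne k f A) (hA : PowerSeries.coeff 0 A ≠ 0) : ∃ τ, f τ = 0 := by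
  by_contra! hne
  have hS : ∀ γ : SL(2, ℤ), f⁻¹ ∣[-k] γ = f⁻¹ := by
    intro γ
    ext τ
    rw [ModularForm.SL_slash_apply, Pi.inv_apply, Pi.inv_apply, hf.smul_eq, ← denom_SL, mul_inv,
      ← zpow_neg, mul_right_comm, ← zpow_add₀ (denom_ne_zero _ τ)]
    simp
  let G : ModularForm 𝒮ℒ (-k) :=
    { toFun := f⁻¹
      slash_action_eq' := by
        rintro M ⟨M, rfl⟩
        exact hS M
      holo' := (hf.hasQ.mdiff one_pos).inv hne
      bdd_at_cusps' := fun hc ↦ by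
        rw [OnePoint.isBoundedAt_iff_forall_SL2Z hc]
        intro γ _
        rw [hS γ]
        exact (hf.tendsto.inv₀ hA).isBigO_one ℝ }
  have h := ModularFormClass.levelOne_neg_weight_eq_zero (k := -k) (by linarith) G
  have h1 : f⁻¹ I = 0 := congrFun h I
  exact hne I (inv_eq_zero.mp h1)

lemma jf_surjective (c : ℂ) : ∃ τ, jf τ = c := by
  obtain ⟨τ, h⟩ := (levelOne_E₄_cube.sub (levelOne_discriminant.smul c)).exists_eq_zero (by norm_num)
    (by simp [constantCoeff_e4, constantCoeff_dq])
  refine ⟨τ, ?_⟩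
  rw [jf, div_eq_iff (ModularForm.discriminant_ne_zero τ)]
  exact sub_eq_zero.mp h

end Surjective

section Injective

local notation "Δ" => ModularForm.discriminant
local notation "E₄" => (ModularForm.E₄ : ℍ → ℂ)
local notation "E₆" => (ModularForm.E₆ : ℍ → ℂ)

lemma delta_eq (τ : ℍ) : 1728 * Δ τ = E₄ τ ^ 3 - E₆ τ ^ 2 := by
  rw [ModularForm.discriminant_eq_E₄_cube_sub_E₆_sq τ]
  ring

lemma exists_scaling {τ₁ τ₂ : ℍ} (h : jf τ₁ = jf τ₂) :
    ∃ u : ℂ, u ≠ 0 ∧ E₄ τ₁ = u ^ 4 * E₄ τ₂ ∧ E₆ τ₁ = u ^ 6 * E₆ τ₂ ∧ Δ τ₁ = u ^ 12 * Δ τ₂ := by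
  have hd1 := ModularForm.discriminant_ne_zero τ₁
  have hd2 := ModularForm.discriminant_ne_zero τ₂
  obtain ⟨v, hv⟩ := IsAlgClosed.exists_pow_nat_eq (Δ τ₁ / Δ τ₂) (n := 12) (by norm_num)
  have hv0 : v ≠ 0 := by
    rintro rfl
    exact div_ne_zero hd1 hd2 (by rw [← hv]; norm_num)
  rw [eq_div_iff hd2] at hv
  rw [jf, jf, div_eq_div_iff hd1 hd2, ← hv] at h
  have h4 : E₄ τ₁ ^ 3 = v ^ 12 * E₄ τ₂ ^ 3 := by
    apply mul_right_cancel₀ hd2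
    linear_combination h
  have h6 : E₆ τ₁ ^ 2 = v ^ 12 * E₆ τ₂ ^ 2 := by
    have h1 := delta_eq τ₁
    have h2 := delta_eq τ₂
    linear_combination h4 + h1 - v ^ 12 * h2 + 1728 * hv
  obtain ⟨r, hr3, hr⟩ : ∃ r : ℂ, r ^ 3 = 1 ∧ E₄ τ₁ = r * (v ^ 4 * E₄ τ₂) := by
    by_cases h0 : E₄ τ₂ = 0
    · refine ⟨1, by norm_num, ?_⟩
      rw [h0] at h4 ⊢
      simpa using h4
    · have hne : v ^ 4 * E₄ τ₂ ≠ 0 := mul_ne_zero (pow_ne_zero _ hv0) h0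
      refine ⟨E₄ τ₁ / (v ^ 4 * E₄ τ₂), ?_, by field_simp⟩
      rw [div_pow, h4, div_eq_one_iff_eq (pow_ne_zero _ hne)]
      ring
  obtain ⟨s, hs2, hs⟩ : ∃ s : ℂ, s ^ 2 = 1 ∧ E₆ τ₁ = s * (v ^ 6 * E₆ τ₂) := by
    by_cases h0 : E₆ τ₂ = 0
    · refine ⟨1, by norm_num, ?_⟩
      rw [h0] at h6 ⊢
      simpa using h6
    · have hne : v ^ 6 * E₆ τ₂ ≠ 0 := mul_ne_zero (pow_ne_zero _ hv0) h0
      refine ⟨E₆ τ₁ / (v ^ 6 * E₆ τ₂), ?_, by field_simp⟩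
      rw [div_pow, h6, div_eq_one_iff_eq (pow_ne_zero _ hne)]
      ring
  obtain ⟨z, hz⟩ := IsAlgClosed.exists_pow_nat_eq s (n := 2) (by norm_num)
  have hz4 : z ^ 4 = 1 := by rw [show z ^ 4 = (z ^ 2) ^ 2 by ring, hz, hs2]
  have hz6 : z ^ 6 = s := by rw [show z ^ 6 = z ^ 4 * z ^ 2 by ring, hz4, hz, one_mul]
  have hr4 : r ^ 4 = r := by rw [pow_succ, hr3, one_mul]
  have hr6 : r ^ 6 = 1 := by rw [show r ^ 6 = (r ^ 3) ^ 2 by ring, hr3, one_pow]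
  have hr0 : r ≠ 0 := by rintro rfl; norm_num at hr3
  have hz0 : z ≠ 0 := by rintro rfl; norm_num at hz4
  refine ⟨z * r * v, by positivity, ?_, ?_, ?_⟩
  · rw [hr, mul_pow, mul_pow, hz4, hr4]; ring
  · rw [hs, mul_pow, mul_pow, hz6, hr6]; ring
  · rw [← hv, mul_pow, mul_pow, show z ^ 12 = (z ^ 4) ^ 3 by ring, hz4,
      show r ^ 12 = (r ^ 3) ^ 4 by ring, hr3]; ring

lemma hom_scale (N : ℕ) (P : ℂ[X]) (t a b : ℂ) :
    hom N P (t * a) (t * b) = t ^ N * hom N P a b := by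
  rw [hom, hom, Finset.mul_sum]
  refine Finset.sum_congr rfl fun i hi ↦ ?_
  have hi : i ≤ N := Nat.lt_succ_iff.mp (Finset.mem_range.mp hi)
  have : t ^ N = t ^ i * t ^ (N - i) := by rw [← pow_add, Nat.add_sub_cancel' hi]
  rw [this]
  ring

lemma scale_of_levelOne {τ₁ τ₂ : ℍ} {u : ℂ} (h4 : E₄ τ₁ = u ^ 4 * E₄ τ₂)
    (h6 : E₆ τ₁ = u ^ 6 * E₆ τ₂) (hd : Δ τ₁ = u ^ 12 * Δ τ₂) {k : ℕ} (hk3 : 3 ≤ k) (hk : Even k)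
    {f : ℍ → ℂ} {A : PowerSeries ℂ} (hf : LevelOne k f A) : f τ₁ = u ^ k * f τ₂ := by
  have key : ∀ a b N : ℕ, (k = 12 * N + (4 * a + 6 * b)) →
      (∀ F : ModularForm 𝒮ℒ (4 * a + 6 * b - 12), (F : ℍ → ℂ) = 0) → f τ₁ = u ^ k * f τ₂ := by
    intro a b N hab h0
    have hk' : (k : ℤ) = 12 * N + (4 * a + 6 * b) := by exact_mod_cast hab
    rw [hk'] at hf
    have hf' : LevelOne (12 * N + (4 * a + 6 * b)) f (A.map (RingHom.id ℂ)) := by simpa using hf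
    obtain ⟨P, -, hP⟩ := exists_poly (φ := RingHom.id ℂ) injective_id isUnit_1728 a b h0 N hf'
    rw [eq_hom_of_eq isUnit_1728 hf'.hasQ hP τ₁, eq_hom_of_eq isUnit_1728 hf'.hasQ hP τ₂, h4, h6, hd,
      show (u ^ 4 * E₄ τ₂) ^ 3 = u ^ 12 * E₄ τ₂ ^ 3 by ring, hom_scale, hab]
    ring
  have hneg : ∀ a b : ℕ, 4 * a + 6 * b < 12 → ∀ F : ModularForm 𝒮ℒ (4 * a + 6 * b - 12),
      (F : ℍ → ℂ) = 0 := fun a b h F ↦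
    ModularFormClass.levelOne_neg_weight_eq_zero (by omega) F
  obtain ⟨m, hm⟩ := hk
  have h12 : m % 6 < 6 := Nat.mod_lt _ (by norm_num)
  have hm6 := Nat.div_add_mod m 6
  interval_cases h : m % 6
  · exact key 0 0 (m / 6) (by omega) (hneg _ _ (by norm_num))
  · refine key 2 1 (m / 6 - 1) (by omega) fun F ↦ ?_
    have h2 : ∀ F : ModularForm 𝒮ℒ 2, F = 0 :=
      rank_zero_iff_forall_zero.mp ModularForm.levelOne_weight_two_rank_zero
    have e : (4 * (2 : ℕ) + 6 * (1 : ℕ) - 12 : ℤ) = 2 := by norm_num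
    revert F
    rw [e]
    intro F
    rw [h2 F]
    rfl
  · exact key 1 0 (m / 6) (by omega) (hneg _ _ (by norm_num))
  · exact key 0 1 (m / 6) (by omega) (hneg _ _ (by norm_num))
  · exact key 2 0 (m / 6) (by omega) (hneg _ _ (by norm_num))
  · exact key 1 1 (m / 6) (by omega) (hneg _ _ (by norm_num))

end Injective

section Lattices

lemma weierstrassP_eventuallyEq {L L' : PeriodPair} (h : ∀ n, 3 ≤ n → L.G n = L'.G n) :
    ℘[L] =ᶠ[𝓝 0] ℘[L'] := by
  have h1 := L.hasFPowerSeriesAt_weierstrassPExcept 0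
  have h2 := L'.hasFPowerSeriesAt_weierstrassPExcept 0
  have h0 : ∀ L : PeriodPair, ℘[L - (0 : ℂ)] 0 = 0 := fun L ↦ by
    simp [PeriodPair.weierstrassPExcept]
  have he : (fun i : ℕ ↦ if i = 0 then ℘[L - (0 : ℂ)] 0 else (i + 1) * L.sumInvPow 0 (i + 2)) =
      (fun i : ℕ ↦ if i = 0 then ℘[L' - (0 : ℂ)] 0 else (i + 1) * L'.sumInvPow 0 (i + 2)) := by
    ext i
    by_cases hi : i = 0
    · simp [hi, h0]
    · simp only [hi, if_false, PeriodPair.sumInvPow_zero]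
      rw [h (i + 2) (by omega)]
  rw [he] at h1
  filter_upwards [h1.eventually_hasSum_sub, h2.eventually_hasSum_sub] with z hz1 hz2
  have hz := hz1.unique hz2
  have e1 := L.weierstrassPExcept_add 0 z
  have e2 := L'.weierstrassPExcept_add 0 z
  simp only [ZeroMemClass.coe_zero] at e1 e2
  rw [← e1, ← e2, hz]

lemma lattice_countable (L : PeriodPair) : (L.lattice : Set ℂ).Countable :=
  Set.countable_coe_iff.mp (L.latticeEquivProd.toEquiv.countable_iff.mpr inferInstance)

lemma lattice_le {L L' : PeriodPair} (h : ∀ n, 3 ≤ n → L.G n = L'.G n) : L.lattice ≤ L'.lattice := by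
  intro x hx
  by_contra hx'
  set U : Set ℂ := ((L.lattice : Set ℂ) ∪ L'.lattice)ᶜ with hU
  have hUo : IsOpen U := (L.isClosed_lattice.union L'.isClosed_lattice).isOpen_compl
  have hUc : IsPreconnected U :=
    (Set.Countable.isConnected_compl_of_one_lt_rank (by simp)
      ((lattice_countable L).union (lattice_countable L'))).isPreconnected
  have hnear : ∀ x : ℂ, ∀ᶠ z in 𝓝[≠] x, z ∈ U := by
    intro x
    have h1 := nhdsWithin_le_nhds (s := {x}ᶜ) (L.compl_lattice_sdiff_singleton_mem_nhds x)
    have h2 := nhdsWithin_le_nhds (s := {x}ᶜ) (L'.compl_lattice_sdiff_singleton_mem_nhds x)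
    filter_upwards [h1, h2, self_mem_nhdsWithin] with z hz1 hz2 hz3
    simp_all
  obtain ⟨V, hV, hVo, h0V⟩ := eventually_nhds_iff.mp (weierstrassP_eventuallyEq h)
  obtain ⟨z₀, hz₀U, hz₀V⟩ : ∃ z₀, z₀ ∈ U ∧ z₀ ∈ V :=
    ((hnear 0).and (nhdsWithin_le_nhds (hVo.mem_nhds h0V))).exists
  have hs1 : U ⊆ (L.lattice : Set ℂ)ᶜ := fun z hz hz' ↦ hz (Or.inl hz')
  have hs2 : U ⊆ (L'.lattice : Set ℂ)ᶜ := fun z hz hz' ↦ hz (Or.inr hz')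
  have heq : Set.EqOn ℘[L] ℘[L'] U :=
    (L.analyticOnNhd_weierstrassP.mono hs1).eqOn_of_preconnected_of_eventuallyEq
      (L'.analyticOnNhd_weierstrassP.mono hs2) hUc hz₀U
      (Filter.eventually_of_mem (hVo.mem_nhds hz₀V) hV)
  have h1 := L.order_weierstrassP x hx
  rw [meromorphicOrderAt_congr ((hnear x).mono fun z hz ↦ heq hz)] at h1
  have h2 := (L'.analyticOnNhd_weierstrassP x hx').meromorphicOrderAt_nonneg
  rw [h1] at h2
  exact absurd h2 (by decide)

lemma lattice_eq {L L' : PeriodPair} (h : ∀ n, 3 ≤ n → L.G n = L'.G n) : L.lattice = L'.lattice :=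
  le_antisymm (lattice_le h) (lattice_le fun n hn ↦ (h n hn).symm)

/-- The lattice `w (ℤ τ + ℤ)`. -/
def pp (τ : ℍ) (w : ℂ) (hw : w ≠ 0) : PeriodPair where
  ω₁ := w * τ
  ω₂ := w
  indep := by
    rw [LinearIndependent.pair_iff]
    intro s t h
    have h1 : (s * τ + t : ℂ) = 0 := by
      apply mul_left_cancel₀ hw
      simp only [Complex.real_smul] at h
      linear_combination h
    have him := congrArg Complex.im h1
    have hre := congrArg Complex.re h1
    simp at him hre
    have hs : s = 0 := him.resolve_right τ.im_ne_zero
    rw [hs] at hre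
    exact ⟨hs, by simpa using hre⟩

lemma pp_G (τ : ℍ) (w : ℂ) (hw : w ≠ 0) {n : ℕ} (hn : 3 ≤ n) :
    (pp τ w hw).G n = (w ^ n)⁻¹ * (riemannZeta n * (2 * ModularForm.E hn τ)) := by
  have h := tsum_eisSummand_eq_riemannZeta_mul_eisensteinSeries hn τ
  have hE : eisensteinSeries (N := 1) 0 n τ = 2 * ModularForm.E hn τ := by
    have : ModularForm.E hn τ = (1 / 2 : ℂ) * eisensteinSeries (N := 1) 0 n τ := rfl
    rw [this]
    ring
  rw [← hE, ← h, PeriodPair.G, ← tsum_mul_left,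
    ← (pp τ w hw).latticeEquivProd.symm.toEquiv.tsum_eq, ← (finTwoArrowEquiv ℤ).tsum_eq]
  refine tsum_congr fun v ↦ ?_
  have := (pp τ w hw).latticeEquiv_symm_apply (finTwoArrowEquiv ℤ v)
  rw [LinearEquiv.coe_toEquiv, this]
  simp only [pp, finTwoArrowEquiv_apply, EisensteinSeries.eisSummand, zpow_neg, zpow_natCast]
  rw [← mul_inv, ← mul_pow]
  congr 2
  change (v 0 : ℂ) * (w * τ) + v 1 * w = w * (v 0 * τ + v 1)
  ring

lemma exists_smul_eq_of_lattice_eq {τ₁ τ₂ : ℍ} {w : ℂ} (hw : w ≠ 0)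
    (h : (pp τ₁ 1 one_ne_zero).lattice = (pp τ₂ w hw).lattice) : ∃ γ : SL(2, ℤ), γ • τ₁ = τ₂ := by
  have m1 : ∀ x : ℂ, x ∈ (pp τ₁ 1 one_ne_zero).lattice ↔ ∃ m n : ℤ, m * (τ₁ : ℂ) + n = x := fun x ↦ by
    rw [PeriodPair.mem_lattice]; simp [pp]
  have m2 : ∀ x : ℂ, x ∈ (pp τ₂ w hw).lattice ↔ ∃ m n : ℤ, m * (w * τ₂ : ℂ) + n * w = x := fun x ↦ by
    rw [PeriodPair.mem_lattice]; simp [pp]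
  obtain ⟨a, b, hab⟩ := (m1 (w * τ₂)).mp (h ▸ (m2 _).mpr ⟨1, 0, by simp⟩)
  obtain ⟨c, d, hcd⟩ := (m1 w).mp (h ▸ (m2 _).mpr ⟨0, 1, by simp⟩)
  obtain ⟨a', b', hab'⟩ := (m2 τ₁).mp (h ▸ (m1 _).mpr ⟨1, 0, by simp⟩)
  obtain ⟨c', d', hcd'⟩ := (m2 1).mp (h ▸ (m1 _).mpr ⟨0, 1, by simp⟩)
  have hind : ∀ m n m' n' : ℤ, (m * (τ₁ : ℂ) + n = m' * τ₁ + n') → m = m' ∧ n = n' := by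
    intro m n m' n' he
    have him := congrArg Complex.im he
    have hre := congrArg Complex.re he
    simp at him hre
    have h1 : m = m' := by
      rcases him with h | h
      · exact_mod_cast h
      · exact absurd h τ₁.im_ne_zero
    rw [h1] at hre
    exact ⟨h1, by simpa using hre⟩
  have e1 := hind (a' * a + b' * c) (a' * b + b' * d) 1 0 (by
    push_cast
    linear_combination hab' + a' * hab + b' * hcd)
  have e2 := hind (c' * a + d' * c) (c' * b + d' * d) 0 1 (by
    push_cast
    linear_combination hcd' + c' * hab + d' * hcd)
  have hdet : (a' * d' - b' * c') * (a * d - b * c) = 1 := by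
    obtain ⟨h1, h2⟩ := e1
    obtain ⟨h3, h4⟩ := e2
    linear_combination (c' * b + d' * d) * h1 - (c' * a + d' * c) * h2 + h4
  have hpos : 0 < (a * d - b * c : ℤ) := by
    have h1 : (a * (τ₁ : ℂ) + b) = τ₂ * (c * τ₁ + d) := by rw [hab, hcd]; ring
    have h2 : (a * (τ₁ : ℂ) + b) * (starRingEnd ℂ (c * τ₁ + d)) =
        τ₂ * ((Complex.normSq (c * τ₁ + d) : ℝ) : ℂ) := by
      rw [h1, mul_assoc, Complex.mul_conj]
    have h3 := congrArg Complex.im h2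
    rw [Complex.im_mul_ofReal, Complex.mul_im] at h3
    simp at h3
    have h4 : 0 < Complex.normSq (c * τ₁ + d) := by
      rw [Complex.normSq_pos, hcd]
      exact hw
    have h5 := mul_pos τ₂.im_pos h4
    have h6 : ((a * d - b * c : ℤ) : ℝ) * τ₁.im = τ₂.im * Complex.normSq (c * τ₁ + d) := by
      push_cast
      linear_combination h3
    rw [← h6] at h5
    exact_mod_cast pos_of_mul_pos_left h5 τ₁.im_pos.le
  have hone : a * d - b * c = 1 := Int.eq_one_of_mul_eq_one_left hpos.le hdet
  obtain ⟨γ, h00, h01, h10, h11⟩ : ∃ γ : SL(2, ℤ), γ 0 0 = a ∧ γ 0 1 = b ∧ γ 1 0 = c ∧ γ 1 1 = d :=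
    ⟨⟨!![a, b; c, d], by rw [Matrix.det_fin_two]; simpa using hone⟩, rfl, rfl, rfl, rfl⟩
  refine ⟨γ, ?_⟩
  rw [UpperHalfPlane.ext_iff, UpperHalfPlane.coe_specialLinearGroup_apply, h00, h01, h10, h11]
  simp
  rw [hab, hcd]
  field_simp

/-- The modular invariant separates the orbits of `SL(2, ℤ)`. -/
lemma exists_smul_eq_of_jf_eq {τ₁ τ₂ : ℍ} (h : jf τ₁ = jf τ₂) : ∃ γ : SL(2, ℤ), γ • τ₁ = τ₂ := by
  obtain ⟨u, hu, h4, h6, hd⟩ := exists_scaling h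
  refine exists_smul_eq_of_lattice_eq (inv_ne_zero hu) (lattice_eq fun n hn ↦ ?_)
  rcases Nat.even_or_odd n with he | ho
  · rw [pp_G _ _ _ hn, pp_G _ _ _ hn, scale_of_levelOne h4 h6 hd hn he
      (LevelOne.of_modularForm (ModularForm.E hn))]
    simp
    ring
  · rw [PeriodPair.G_eq_zero_of_odd _ _ ho, PeriodPair.G_eq_zero_of_odd _ _ ho]

lemma jf_smul (γ : SL(2, ℤ)) (τ : ℍ) : jf (γ • τ) = jf τ := by
  have h1 := levelOne_E₄.smul_eq γ τ
  have h2 := levelOne_discriminant.smul_eq γ τ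
  have hne : ((γ 1 0 : ℂ) * τ + γ 1 1) ≠ 0 := by rw [← denom_SL]; exact denom_ne_zero _ τ
  have hd := ModularForm.discriminant_ne_zero τ
  simp only [zpow_ofNat] at h1 h2
  rw [jf, jf, h1, h2]
  field_simp

end Lattices

end SSP

namespace SSP

open UpperHalfPlane Function IsLocalRing
open scoped MatrixGroups ModularForm Manifold Derivative Topology

section Slopes

local notation "Δ" => ModularForm.discriminant
local notation "E₄" => (ModularForm.E₄ : ℍ → ℂ)
local notation "E₆" => (ModularForm.E₆ : ℍ → ℂ)

lemma LevelOne.hasDerivAt {k : ℤ} {f : ℍ → ℂ} {A : PowerSeries ℂ} (hf : LevelOne k f A) (τ : ℍ) :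
    HasDerivAt (f ∘ ofComplex) (2 * Real.pi * Complex.I * D f τ) (τ : ℂ) := by
  have h := (UpperHalfPlane.mdifferentiableAt_iff.mp (hf.hasQ.mdiff one_pos τ)).hasDerivAt
  refine h.congr_deriv ?_
  have h1 : (2 * Real.pi * Complex.I : ℂ) ≠ 0 := by simp [Real.pi_ne_zero]
  change _ = 2 * Real.pi * Complex.I * ((2 * Real.pi * Complex.I)⁻¹ * deriv (f ∘ ofComplex) τ)
  rw [mul_inv_cancel_left₀ h1]

lemma theta_dq_complex : theta (dq ℂ) = e2 ℂ * dq ℂ := by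
  have h4 := theta_e4_complex
  have h6 := theta_e6_complex
  have hd := mul_dq (R := ℂ) isUnit_1728
  have h0 := congrArg theta hd
  rw [show (1728 : PowerSeries ℂ) = PowerSeries.C 1728 from (map_ofNat _ 1728).symm, theta_C_mul,
    theta_sub, theta_pow, theta_pow, map_ofNat] at h0
  apply mul_left_cancel₀ (show (1728 : PowerSeries ℂ) ≠ 0 by
    rw [show (1728 : PowerSeries ℂ) = PowerSeries.C 1728 from (map_ofNat _ 1728).symm]
    exact (map_ne_zero_iff _ PowerSeries.C_injective).mpr (by norm_num))
  push_cast at h0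
  linear_combination h0 + e4 ℂ ^ 2 * h4 - e6 ℂ * h6 - e2 ℂ * hd

lemma wronskian (τ : ℍ) : 3 * D E₄ τ * Δ τ - E₄ τ * D Δ τ = -(E₆ τ * Δ τ) := by
  have h1 := levelOne_E₄.hasQ.deriv
  have h2 := levelOne_discriminant.hasQ.deriv
  have h3 := ((h1.smul 3).mul levelOne_discriminant.hasQ).sub (levelOne_E₄.hasQ.mul h2)
  have h4 := (levelOne_E₆.hasQ.mul levelOne_discriminant.hasQ).neg
  have h5 := congrFun (h3.eq (g := -(E₆ * Δ)) (by
    convert h4 using 1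
    have h6 := theta_dq_complex
    have h7 := theta_e4_complex
    rw [PowerSeries.smul_eq_C_mul, map_ofNat]
    simp only [theta] at h6 h7
    linear_combination dq ℂ * h7 - e4 ℂ * h6)) τ
  simpa [mul_assoc] using h5

lemma hasDerivAt_jf (τ : ℍ) : HasDerivAt (jf ∘ ofComplex)
    (-(2 * Real.pi * Complex.I * E₄ τ ^ 2 * E₆ τ / Δ τ)) (τ : ℂ) := by
  have hd := ModularForm.discriminant_ne_zero τ
  have h := ((levelOne_E₄.hasDerivAt τ).pow 3).div (levelOne_discriminant.hasDerivAt τ) (by simpa)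
  refine h.congr_deriv ?_
  have hw := wronskian τ
  simp only [comp_apply, Pi.pow_apply, ofComplex_apply]
  field_simp
  push_cast
  linear_combination (E₄ τ ^ 2) * hw

/-- Difference quotients of the modular invariant. -/
lemma tendsto_slope_jf (τ₀ : ℍ) : Filter.Tendsto
    (fun τ : ℍ ↦ (jf τ - jf τ₀) / ((τ : ℂ) - τ₀)) (𝓝[≠] τ₀)
    (𝓝 (-(2 * Real.pi * Complex.I * E₄ τ₀ ^ 2 * E₆ τ₀ / Δ τ₀))) := by
  have h := (hasDerivAt_iff_tendsto_slope.mp (hasDerivAt_jf τ₀))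
  have hc : Filter.Tendsto (fun τ : ℍ ↦ (τ : ℂ)) (𝓝[≠] τ₀) (𝓝[≠] (τ₀ : ℂ)) :=
    tendsto_nhdsWithin_iff.mpr ⟨(UpperHalfPlane.continuous_coe.tendsto τ₀).mono_left
      nhdsWithin_le_nhds, by
        filter_upwards [self_mem_nhdsWithin] with τ hτ h'
        exact hτ (UpperHalfPlane.ext h')⟩
  refine (h.comp hc).congr fun τ ↦ ?_
  simp [slope_def_field]

lemma continuous_jf : Continuous jf := by
  have h1 := (levelOne_E₄.hasQ.mdiff one_pos).continuous
  have h2 := (levelOne_discriminant.hasQ.mdiff one_pos).continuous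
  exact (h1.pow 3).div h2 ModularForm.discriminant_ne_zero

variable {p}

lemma toGL_smul_sub (M : Mp p) (τ σ : ℍ) : ((toGL M • τ : ℍ) : ℂ) - (toGL M • σ : ℍ) =
    p * ((τ : ℂ) - σ) / (denom (toGL M) τ * denom (toGL M) σ) := by
  have h1 := denom_ne_zero (toGL M) τ
  have h2 := denom_ne_zero (toGL M) σ
  rw [UpperHalfPlane.coe_smul_of_det_pos (det_toGL_pos M),
    UpperHalfPlane.coe_smul_of_det_pos (det_toGL_pos M), div_sub_div _ _ h1 h2]
  congr 1
  rw [denom_toGL, denom_toGL, num_toGL, num_toGL]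
  linear_combination ((τ : ℂ) - σ) * M.det_eq_complex

lemma continuous_toGL_smul (M : Mp p) : Continuous fun τ : ℍ ↦ toGL M • τ := continuous_const_smul _

lemma continuous_denom (M : Mp p) : Continuous fun τ : ℍ ↦ denom (toGL M) τ := by
  simp only [denom_toGL]
  fun_prop

lemma tendsto_slope_jf_smul {M : Mp p} {τ₀ : ℍ} (hM : toGL M • τ₀ = τ₀)
    (ht : M.1 0 0 + M.1 1 1 = 0) : Filter.Tendsto
    (fun τ : ℍ ↦ (jf (toGL M • τ) - jf τ₀) / ((τ : ℂ) - τ₀)) (𝓝[≠] τ₀)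
    (𝓝 (2 * Real.pi * Complex.I * E₄ τ₀ ^ 2 * E₆ τ₀ / Δ τ₀)) := by
  have hl : denom (toGL M) τ₀ * denom (toGL M) τ₀ = -p := by
    have := eigenvalue_mul hM
    rw [ht] at this
    linear_combination -this
  have h1 : Filter.Tendsto (fun τ : ℍ ↦ toGL M • τ) (𝓝[≠] τ₀) (𝓝[≠] τ₀) :=
    tendsto_nhdsWithin_iff.mpr ⟨by
      have := (continuous_toGL_smul M).tendsto τ₀
      rw [hM] at this
      exact this.mono_left nhdsWithin_le_nhds, by
        filter_upwards [self_mem_nhdsWithin] with τ hτ h'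
        have h2 : toGL M • τ = τ₀ := h'
        exact hτ (smul_left_cancel (toGL M) (h2.trans hM.symm))⟩
  have h2 : Filter.Tendsto (fun τ : ℍ ↦ (p : ℂ) / (denom (toGL M) τ * denom (toGL M) τ₀)) (𝓝[≠] τ₀)
      (𝓝 (-1)) := by
    have h3 : Filter.Tendsto (fun τ : ℍ ↦ (p : ℂ) / (denom (toGL M) τ * denom (toGL M) τ₀)) (𝓝 τ₀)
        (𝓝 ((p : ℂ) / (denom (toGL M) τ₀ * denom (toGL M) τ₀))) :=
      tendsto_const_nhds.div (((continuous_denom M).tendsto τ₀).mul tendsto_const_nhds)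
        (by rw [hl]; simpa using pne p)
    rw [hl, div_neg, div_self (by exact_mod_cast pne p)] at h3
    exact h3.mono_left nhdsWithin_le_nhds
  have h3 := ((tendsto_slope_jf τ₀).comp h1).mul h2
  rw [mul_neg_one, neg_neg] at h3
  refine h3.congr' ?_
  filter_upwards [self_mem_nhdsWithin] with τ hτ
  have hne : (τ : ℂ) - τ₀ ≠ 0 := fun h ↦ hτ (UpperHalfPlane.ext (sub_eq_zero.mp h))
  have he := toGL_smul_sub M τ τ₀
  rw [hM] at he
  simp only [comp_apply]
  rw [he]
  have h1 := denom_ne_zero (toGL M) τ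
  have h2 := denom_ne_zero (toGL M) τ₀
  have : (p : ℂ) ≠ 0 := by exact_mod_cast pne p
  field_simp

end Slopes

end SSP

namespace SSP

open UpperHalfPlane Function IsLocalRing
open scoped MatrixGroups ModularForm Topology

/-- The points of the upper half plane fixed by an integral matrix of trace zero and
determinant `p`. -/
def cmPoints : Set ℍ := {τ | ∃ M : Mp p, M.1 0 0 + M.1 1 1 = 0 ∧ toGL M • τ = τ}

section Elliptic

local notation "Δ" => ModularForm.discriminant
local notation "E₄" => (ModularForm.E₄ : ℍ → ℂ)
local notation "E₆" => (ModularForm.E₆ : ℍ → ℂ)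

variable {p}

lemma smul_mem_cmPoints (γ : SL(2, ℤ)) {τ : ℍ} (h : τ ∈ cmPoints p) : γ • τ ∈ cmPoints p := by
  obtain ⟨M, ht, hM⟩ := h
  refine ⟨γ • M.mulRight γ⁻¹, ?_, ?_⟩
  · have h1 : (γ • M.mulRight γ⁻¹).1 = γ.1 * (M.1 * (γ⁻¹).1) := by
      rw [FixedDetMatrices.smul_coe, Mp.mulRight_coe]
    rw [← Matrix.trace_fin_two] at ht ⊢
    rw [h1, Matrix.trace_mul_comm, Matrix.mul_assoc, ← Matrix.SpecialLinearGroup.coe_mul]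
    simpa using ht
  · rw [toGL_smul, toGL_mulRight, mul_smul, mul_smul]
    change γ • (toGL M • (γ⁻¹ • (γ • τ))) = γ • τ
    rw [inv_smul_smul, hM]

/-- A primitive cube root of unity. -/
def rho : ℍ := ⟨⟨-1 / 2, √3 / 2⟩, by simp⟩

lemma rho_sq : (rho : ℂ) ^ 2 + rho + 1 = 0 := by
  have h3 : √3 * √3 = 3 := Real.mul_self_sqrt (by norm_num)
  apply Complex.ext
  · simp [rho, pow_two]; nlinarith
  · simp [rho, pow_two]; ring

lemma jf_rho : jf rho = 0 := by
  obtain ⟨γ, h00, h01, h10, h11⟩ : ∃ γ : SL(2, ℤ), γ 0 0 = 0 ∧ γ 0 1 = -1 ∧ γ 1 0 = 1 ∧ γ 1 1 = 1 :=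
    ⟨⟨!![0, -1; 1, 1], by simp⟩, rfl, rfl, rfl, rfl⟩
  have hr := rho_sq
  have hne : (rho : ℂ) + 1 ≠ 0 := by
    intro h
    have : (rho : ℂ) ^ 2 + rho + 1 = 0 + 1 := by linear_combination (rho : ℂ) * h
    rw [hr] at this; norm_num at this
  have h1 : γ • rho = rho := by
    rw [UpperHalfPlane.ext_iff, UpperHalfPlane.coe_specialLinearGroup_apply, h00, h01, h10, h11]
    simp
    rw [div_eq_iff hne]
    linear_combination -hr
  have h2 := levelOne_E₄.smul_eq γ rho
  rw [h1, h10, h11, zpow_ofNat] at h2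
  have h4 : E₄ rho = 0 := by
    have h5 : (((1 : ℤ) : ℂ) * rho + (1 : ℤ)) ^ 4 = -(rho + 1) := by
      push_cast
      linear_combination ((rho : ℂ) ^ 2 + 3 * rho + 2) * hr
    rw [h5] at h2
    have h6 : ((rho : ℂ) + 2) * E₄ rho = 0 := by linear_combination h2
    refine (mul_eq_zero.mp h6).resolve_left fun h ↦ ?_
    have : (rho : ℂ) ^ 2 + rho + 1 = 3 := by linear_combination ((rho : ℂ) - 1) * h
    rw [hr] at this
    norm_num at this
  simp [jf, h4]

lemma jf_I : jf UpperHalfPlane.I = 1728 := by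
  have h1 := levelOne_E₆.S_smul UpperHalfPlane.I
  have h2 : ModularGroup.S • UpperHalfPlane.I = UpperHalfPlane.I := by
    rw [UpperHalfPlane.modular_S_smul]
    apply UpperHalfPlane.ext
    simp
  rw [h2, zpow_ofNat, UpperHalfPlane.coe_I,
    show Complex.I ^ 6 = -1 by rw [show 6 = 4 + 2 from rfl, pow_add, Complex.I_pow_four]; simp] at h1
  have h6 : E₆ UpperHalfPlane.I = 0 := by linear_combination h1 / 2
  have hd := delta_eq UpperHalfPlane.I
  have hne := ModularForm.discriminant_ne_zero UpperHalfPlane.I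
  rw [h6] at hd
  rw [jf, div_eq_iff hne]
  linear_combination -hd

lemma intCast_add_mul_eq_zero (τ : ℍ) {m n : ℤ} (h : (m * τ + n : ℂ) = 0) : m = 0 ∧ n = 0 := by
  have him := congrArg Complex.im h
  have hre := congrArg Complex.re h
  simp at him hre
  have h1 : m = 0 := him.resolve_right τ.im_ne_zero
  rw [h1] at hre
  exact ⟨h1, by simpa using hre⟩

lemma E₄_ne_zero (hp : 5 ≤ p) {τ : ℍ} (h : τ ∈ cmPoints p) : E₄ τ ≠ 0 := by
  intro h0
  obtain ⟨γ, hγ⟩ := exists_smul_eq_of_jf_eq (τ₁ := τ) (τ₂ := rho) (by rw [jf_rho, jf, h0]; simp)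
  obtain ⟨M, ht, hM⟩ := hγ ▸ smul_mem_cmPoints γ h
  have h1 := fix_quadratic hM
  have hd := M.det_eq
  obtain ⟨h2, h3⟩ := intCast_add_mul_eq_zero rho (m := M.1 1 1 - M.1 0 0 - M.1 1 0)
    (n := -M.1 1 0 - M.1 0 1) (by push_cast; linear_combination h1 - M.1 1 0 * rho_sq)
  have h4 : (p : ℤ) = 3 * (M.1 0 0 * M.1 0 0) := by
    have e1 : M.1 1 1 = - M.1 0 0 := by linarith
    have e2 : M.1 1 0 = -2 * M.1 0 0 := by linarith
    have e3 : M.1 0 1 = 2 * M.1 0 0 := by linarith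
    rw [e1, e2, e3] at hd
    linarith
  have h5 : 3 ∣ p := by exact_mod_cast Dvd.intro _ h4.symm
  have := (Nat.prime_dvd_prime_iff_eq Nat.prime_three Fact.out).mp h5
  omega

lemma E₆_ne_zero {τ : ℍ} (h : τ ∈ cmPoints p) : E₆ τ ≠ 0 := by
  intro h0
  have hd := delta_eq τ
  have hne := ModularForm.discriminant_ne_zero τ
  obtain ⟨γ, hγ⟩ := exists_smul_eq_of_jf_eq (τ₁ := τ) (τ₂ := UpperHalfPlane.I) (by
    rw [jf_I, jf, div_eq_iff hne]
    rw [h0] at hd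
    linear_combination -hd)
  obtain ⟨M, ht, hM⟩ := hγ ▸ smul_mem_cmPoints γ h
  have h1 := fix_quadratic hM
  have hd := M.det_eq
  have hI : (UpperHalfPlane.I : ℂ) ^ 2 = -1 := by simp
  obtain ⟨h2, h3⟩ := intCast_add_mul_eq_zero UpperHalfPlane.I (m := M.1 1 1 - M.1 0 0)
    (n := -M.1 1 0 - M.1 0 1) (by
      push_cast
      rw [hI] at h1
      simp only [UpperHalfPlane.coe_I] at h1 ⊢
      linear_combination h1)
  apply not_sq_eq_prime (p := p) (M.1 1 0)
  rw [show M.1 0 0 = 0 by linarith, show M.1 0 1 = - M.1 1 0 by linarith] at hd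
  linarith

lemma eq_or_eq_neg_of_fix {M N : Mp p} {τ : ℍ} (hM : toGL M • τ = τ) (hN : toGL N • τ = τ)
    (htM : M.1 0 0 + M.1 1 1 = 0) (htN : N.1 0 0 + N.1 1 1 = 0) : M.1 = N.1 ∨ M.1 = -N.1 := by
  have h1 := fix_quadratic hM
  have h2 := fix_quadratic hN
  have hcM := lower_left_ne_zero hM
  have hcN := lower_left_ne_zero hN
  have eM : M.1 1 1 = - M.1 0 0 := by linarith
  have eN : N.1 1 1 = - N.1 0 0 := by linarith
  rw [eM] at h1
  rw [eN] at h2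
  push_cast at h1 h2
  obtain ⟨h3, h4⟩ := intCast_add_mul_eq_zero τ
    (m := 2 * (M.1 1 0 * N.1 0 0 - N.1 1 0 * M.1 0 0)) (n := M.1 1 0 * N.1 0 1 - N.1 1 0 * M.1 0 1)
    (by push_cast; linear_combination (N.1 1 0 : ℂ) * h1 - (M.1 1 0 : ℂ) * h2)
  have h5 : M.1 1 0 * N.1 0 0 = N.1 1 0 * M.1 0 0 := by linarith
  have h6 : M.1 1 0 * N.1 0 1 = N.1 1 0 * M.1 0 1 := by linarith
  have hdM := M.det_eq
  have hdN := N.det_eq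
  rw [eM] at hdM
  rw [eN] at hdN
  have hp0 : (p : ℤ) ≠ 0 := by exact_mod_cast pne p
  have h7 : M.1 1 0 * M.1 1 0 = N.1 1 0 * N.1 1 0 := by
    apply mul_right_cancel₀ hp0
    linear_combination (-(M.1 1 0) * N.1 0 0 - N.1 1 0 * M.1 0 0) * h5 - M.1 1 0 * N.1 1 0 * h6 +
      N.1 1 0 ^ 2 * hdM - M.1 1 0 ^ 2 * hdN
  rcases mul_self_eq_mul_self_iff.mp h7 with h | h
  · left
    rw [h] at h5 h6
    have e0 := mul_left_cancel₀ hcN h5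
    have e1 := mul_left_cancel₀ hcN h6
    ext i j
    fin_cases i <;> fin_cases j <;> simp [h, eM, eN, e0, e1]
  · right
    rw [h] at h5 h6
    have e0 : -N.1 0 0 = M.1 0 0 := mul_left_cancel₀ hcN (by linarith)
    have e1 : -N.1 0 1 = M.1 0 1 := mul_left_cancel₀ hcN (by linarith)
    ext i j
    fin_cases i <;> fin_cases j <;> simp [h, eM, eN, ← e0, ← e1]

end Elliptic

end SSP

namespace SSP

open UpperHalfPlane Function IsLocalRing
open scoped MatrixGroups ModularForm Topology

section Roots

local notation "Δ" => ModularForm.discriminant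
local notation "E₄" => (ModularForm.E₄ : ℍ → ℂ)
local notation "E₆" => (ModularForm.E₆ : ℍ → ℂ)

variable {p}

lemma famG_eq (i : Option (ZMod p)) (τ : ℍ) : famG p i τ =
    ((p : ℂ) ^ 12 * (denom (toGL (gam p i)) τ ^ 12)⁻¹ * Δ τ * Δ (toGL (gam p i) • τ)) *
      (jf τ - jf (toGL (gam p i) • τ)) := by
  have h1 := ModularForm.discriminant_ne_zero τ
  have h2 := ModularForm.discriminant_ne_zero (toGL (gam p i) • τ)
  have h3 := denom_ne_zero (toGL (gam p i)) τ
  simp only [famG, conj, jf, Pi.pow_apply, Pi.mul_apply, Pi.sub_apply, zpow_neg, zpow_ofNat]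
  field_simp

lemma exists_fix_of_jf_eq {i : Option (ZMod p)} {τ : ℍ} (h : jf τ = jf (toGL (gam p i) • τ)) :
    ∃ (M : Mp p) (δ : SL(2, ℤ)), M = δ • gam p i ∧ toGL M • τ = τ := by
  obtain ⟨δ, hδ⟩ := exists_smul_eq_of_jf_eq h.symm
  refine ⟨δ • gam p i, δ, rfl, ?_⟩
  rw [toGL_smul, mul_smul]
  exact hδ

lemma exists_jf_eq {τ : ℍ} {M : Mp p} (hM : toGL M • τ = τ) :
    ∃ (i : Option (ZMod p)) (δ : SL(2, ℤ)), M = δ • gam p i ∧ jf τ = jf (toGL (gam p i) • τ) := by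
  obtain ⟨δ, i, hi⟩ := exists_eq_smul_gam M
  refine ⟨i, δ, hi, ?_⟩
  rw [hi, toGL_smul, mul_smul] at hM
  conv_lhs => rw [← hM]
  exact jf_smul δ _

lemma eq_of_trace_zero {i j : Option (ZMod p)} {δ ε : SL(2, ℤ)} {τ : ℍ} {M N : Mp p}
    (hMi : M = δ • gam p i) (hNj : N = ε • gam p j) (hM : toGL M • τ = τ) (hN : toGL N • τ = τ)
    (htM : M.1 0 0 + M.1 1 1 = 0) (htN : N.1 0 0 + N.1 1 1 = 0) : i = j := by
  have hneg : ∃ ζ : SL(2, ℤ), M = ζ • N := by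
    rcases eq_or_eq_neg_of_fix hM hN htM htN with h | h
    · exact ⟨1, by rw [one_smul]; exact Subtype.ext h⟩
    · refine ⟨-1, Subtype.ext ?_⟩
      rw [FixedDetMatrices.smul_coe, h]
      simp
  obtain ⟨ζ, hζ⟩ := hneg
  apply gam_eq_smul (δ := δ⁻¹ * ζ * ε)
  rw [mul_smul, mul_smul, ← hNj, ← hζ, hMi, inv_smul_smul]

lemma neBot_nhdsNE (τ : ℍ) : (𝓝[≠] τ).NeBot := by
  have : Nontrivial ℍ := ⟨⟨UpperHalfPlane.I, rho, fun h ↦ by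
    have := congrArg UpperHalfPlane.re h
    norm_num [rho, UpperHalfPlane.re] at this⟩⟩
  infer_instance

lemma famG_factor_ne_zero (i : Option (ZMod p)) (τ : ℍ) :
    (p : ℂ) ^ 12 * (denom (toGL (gam p i)) τ ^ 12)⁻¹ * Δ τ * Δ (toGL (gam p i) • τ) ≠ 0 := by
  have hp0 : (p : ℂ) ≠ 0 := by exact_mod_cast pne p
  refine mul_ne_zero (mul_ne_zero (mul_ne_zero (pow_ne_zero _ hp0) (inv_ne_zero (pow_ne_zero _
    (denom_ne_zero _ _)))) (ModularForm.discriminant_ne_zero _))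
    (ModularForm.discriminant_ne_zero _)

variable {P : ℂ[X]} (hval : ∀ τ, ((p : ℂ) ^ 12)⁻¹ * ∏ i, famG p i τ =
        hom (2 * (p + 1)) P (E₄ τ ^ 3) (Δ τ)) (hdeg : P.natDegree = 2 * p)
include hval hdeg

lemma prod_famG_eq (τ : ℍ) : ((p : ℂ) ^ 12)⁻¹ * ∏ i, famG p i τ =
    Δ τ ^ (2 * (p + 1)) * P.eval (jf τ) := by
  rw [hval, hom_eq_pow_mul (by omega) _ (ModularForm.discriminant_ne_zero τ), jf]

lemma eval_eq_zero_iff (τ : ℍ) : P.eval (jf τ) = 0 ↔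
    ∃ i : Option (ZMod p), jf τ = jf (toGL (gam p i) • τ) := by
  have h := prod_famG_eq hval hdeg τ
  have hp0 : (p : ℂ) ≠ 0 := by exact_mod_cast pne p
  have hd := ModularForm.discriminant_ne_zero τ
  have h1 : P.eval (jf τ) = 0 ↔ ∏ i, famG p i τ = 0 := by
    constructor
    · intro h0
      rw [h0, mul_zero] at h
      exact (mul_eq_zero.mp h).resolve_left (inv_ne_zero (pow_ne_zero _ hp0))
    · intro h0
      rw [h0, mul_zero] at h
      exact (mul_eq_zero.mp h.symm).resolve_left (pow_ne_zero _ hd)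
  rw [h1, Finset.prod_eq_zero_iff]
  simp only [Finset.mem_univ, true_and]
  refine exists_congr fun i ↦ ?_
  rw [famG_eq, mul_eq_zero, sub_eq_zero]
  exact or_iff_right (famG_factor_ne_zero i τ)

lemma not_sq_dvd (hp : 5 ≤ p) {τ₀ : ℍ} (hτ : τ₀ ∈ cmPoints p)
    (htr : ∀ M : Mp p, toGL M • τ₀ = τ₀ → M.1 0 0 + M.1 1 1 = 0) :
    ¬ (X - C (jf τ₀)) ^ 2 ∣ P := by
  rintro ⟨Q, hQ⟩
  obtain ⟨M, ht, hM⟩ := hτ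
  obtain ⟨i₀, δ, hMi, hi₀⟩ := exists_jf_eq hM
  have huniq : ∀ i, i ≠ i₀ → jf τ₀ - jf (toGL (gam p i) • τ₀) ≠ 0 := by
    intro i hi h0
    obtain ⟨N, ε, hN, hN'⟩ := exists_fix_of_jf_eq (sub_eq_zero.mp h0)
    exact hi (eq_of_trace_zero hN hMi hN' hM (htr N hN') ht)
  have hp0 : (p : ℂ) ≠ 0 := by exact_mod_cast pne p
  set U : ℍ → ℂ := fun τ ↦ ∏ i, ((p : ℂ) ^ 12 * (denom (toGL (gam p i)) τ ^ 12)⁻¹ * Δ τ *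
    Δ (toGL (gam p i) • τ)) with hU
  have hU0 : ∀ τ, U τ ≠ 0 := by
    intro τ
    exact Finset.prod_ne_zero_iff.mpr fun i _ ↦ famG_factor_ne_zero i τ
  have hΔc : Continuous Δ := (levelOne_discriminant.hasQ.mdiff one_pos).continuous
  have hUc : Continuous U := by
    refine continuous_finsetProd _ fun i _ ↦ ?_
    refine ((continuous_const.mul (((continuous_denom _).pow 12).inv₀ fun τ ↦ ?_)).mul hΔc).mul
      (hΔc.comp (continuous_toGL_smul _))
    exact pow_ne_zero _ (denom_ne_zero (toGL (gam p i)) τ)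
  have hkey : ∀ τ, (∏ i, (jf τ - jf (toGL (gam p i) • τ))) =
      (p : ℂ) ^ 12 * (U τ)⁻¹ * Δ τ ^ (2 * (p + 1)) * ((jf τ - jf τ₀) ^ 2 * Q.eval (jf τ)) := by
    intro τ
    have h := prod_famG_eq hval hdeg τ
    simp only [famG_eq] at h
    rw [Finset.prod_mul_distrib, hQ] at h
    simp only [eval_mul, eval_pow, eval_sub, eval_X, eval_C] at h
    have := hU0 τ
    apply mul_left_cancel₀ (mul_ne_zero (inv_ne_zero (pow_ne_zero 12 hp0)) this)
    rw [mul_assoc]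
    refine h.trans ?_
    field_simp
  set K : ℂ := 2 * Real.pi * Complex.I * E₄ τ₀ ^ 2 * E₆ τ₀ / Δ τ₀ with hK
  have hK0 : K ≠ 0 := by
    have h4 := E₄_ne_zero hp ⟨M, ht, hM⟩
    have h6 := E₆_ne_zero (p := p) ⟨M, ht, hM⟩
    have hd := ModularForm.discriminant_ne_zero τ₀
    have := Real.pi_ne_zero
    have h1 : (2 * Real.pi * Complex.I : ℂ) ≠ 0 := by simp [Real.pi_ne_zero]
    exact div_ne_zero (mul_ne_zero (mul_ne_zero h1 (pow_ne_zero 2 h4)) h6) hd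
  have hl1 : Filter.Tendsto (fun τ : ℍ ↦ (∏ i ∈ Finset.univ.erase i₀,
      (jf τ - jf (toGL (gam p i) • τ))) * ((jf τ - jf τ₀) / ((τ : ℂ) - τ₀) -
        (jf (toGL M • τ) - jf τ₀) / ((τ : ℂ) - τ₀))) (𝓝[≠] τ₀)
      (𝓝 ((∏ i ∈ Finset.univ.erase i₀, (jf τ₀ - jf (toGL (gam p i) • τ₀))) * (-K - K))) := by
    refine Filter.Tendsto.mul (Filter.Tendsto.mono_left (Continuous.tendsto ?_ τ₀)
      nhdsWithin_le_nhds) ((tendsto_slope_jf τ₀).sub (tendsto_slope_jf_smul hM ht))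
    exact continuous_finsetProd _ fun i _ ↦
      continuous_jf.sub (continuous_jf.comp (continuous_toGL_smul _))
  have hl2 : Filter.Tendsto (fun τ : ℍ ↦ ((p : ℂ) ^ 12 * (U τ)⁻¹ * Δ τ ^ (2 * (p + 1)) *
      ((jf τ - jf τ₀) * Q.eval (jf τ))) * ((jf τ - jf τ₀) / ((τ : ℂ) - τ₀))) (𝓝[≠] τ₀)
      (𝓝 (((p : ℂ) ^ 12 * (U τ₀)⁻¹ * Δ τ₀ ^ (2 * (p + 1)) *
      ((jf τ₀ - jf τ₀) * Q.eval (jf τ₀))) * (-K))) := by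
    refine Filter.Tendsto.mul (Filter.Tendsto.mono_left (Continuous.tendsto ?_ τ₀)
      nhdsWithin_le_nhds) (tendsto_slope_jf τ₀)
    exact ((continuous_const.mul (hUc.inv₀ hU0)).mul (hΔc.pow _)).mul
      ((continuous_jf.sub continuous_const).mul (Q.continuous.comp continuous_jf))
  rw [sub_self, zero_mul, mul_zero, zero_mul] at hl2
  have := neBot_nhdsNE τ₀
  have h0 := tendsto_nhds_unique hl1 (hl2.congr fun τ ↦ by
    have h1 : jf (toGL M • τ) = jf (toGL (gam p i₀) • τ) := by
      rw [hMi, toGL_smul, mul_smul]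
      exact jf_smul δ _
    have h2 := hkey τ
    rw [← Finset.mul_prod_erase _ _ (Finset.mem_univ i₀)] at h2
    rw [h1, ← sub_div, sub_sub_sub_cancel_right]
    rw [← mul_div_assoc, ← mul_div_assoc]
    congr 1
    linear_combination -h2)
  rw [mul_eq_zero] at h0
  rcases h0 with h0 | h0
  · obtain ⟨i, hi, h0⟩ := Finset.prod_eq_zero_iff.mp h0
    exact huniq i (Finset.ne_of_mem_erase hi) h0
  · exact hK0 (by linear_combination -h0 / 2)

end Roots

end SSP

namespace SSP

open UpperHalfPlane Function IsLocalRing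
open scoped MatrixGroups ModularForm

lemma splits_of_isUnit_leadingCoeff (V : ValuationSubring ℂ) {P : V[X]} (hP : IsUnit P.leadingCoeff) :
    P.Splits := by
  refine Splits.of_splits_map_of_injective (i := algebraMap V ℂ) (IsFractionRing.injective V ℂ)
    (IsAlgClosed.splits _) fun c hc ↦ ?_
  have h0 : P.eval₂ (algebraMap V ℂ) c = 0 := by
    have := isRoot_of_mem_roots hc
    rwa [IsRoot.def, eval_map] at this
  have h1 := RingHom.isIntegralElem_leadingCoeff_mul (algebraMap V ℂ) P c h0
  obtain ⟨y, hy⟩ := (IsIntegrallyClosed.isIntegral_iff (R := V) (K := ℂ)).mp h1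
  obtain ⟨u, hu⟩ := hP
  refine ⟨↑u⁻¹ * y, ?_⟩
  rw [map_mul, hy, ← hu, ← mul_assoc, ← map_mul, Units.inv_mul, map_one, one_mul]

lemma roots_frobenius (K : Type*) [Field K] (φ : ZMod p →+* K) :
    (-((X ^ p - X : K[X]) ^ 2)).roots = 2 • (Finset.univ.val.map φ) := by
  have h1 : (X ^ p - X : K[X]) = (X ^ p - X : (ZMod p)[X]).map φ := by simp
  have h2 := FiniteField.roots_X_pow_card_sub_X (ZMod p)
  rw [ZMod.card] at h2
  rw [roots_neg, roots_pow, h1, ← h2]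
  congr 1
  refine (roots_map_of_injective_of_card_eq_natDegree φ.injective ?_).symm
  rw [h2, FiniteField.X_pow_card_sub_X_natDegree_eq _ (Fact.out : p.Prime).one_lt]
  simp [ZMod.card]

lemma card_cmPoints (hp : 5 ≤ p) : (jf '' cmPoints p).Finite ∧
    (jf '' cmPoints p).ncard = 2 * LL p := by
  classical
  obtain ⟨V, hV⟩ := exists_valuationSubring p
  have : Fact ((p : V) ∈ maximalIdeal V) := ⟨hV⟩
  have hchar := charP_kap p V
  obtain ⟨P, hdeg, hlead, hval, hres⟩ := exists_polyG p V hp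
  obtain ⟨h, hhdeg, hh, hss, hiff⟩ := exists_supersingular p V hp
  have hsp := splits_of_isUnit_leadingCoeff V hlead
  have hinj : Injective V.subtype := V.subtype_injective
  have hdeg' : (P.map V.subtype).natDegree = 2 * p := by
    rw [natDegree_map_eq_of_injective hinj, hdeg]
  have hP0 : P ≠ 0 := by
    rintro rfl
    simp [pne p] at hdeg
  have hX0 := FiniteField.X_pow_card_sub_X_ne_zero (kap V) (Fact.out : p.Prime).one_lt
  have hroots : P.roots.map (res V) = 2 • (Finset.univ.val.map (ZMod.castHom (dvd_refl p) (kap V))) := by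
    rw [← roots_frobenius, ← hres]
    refine (hsp.roots_map_of_ne_zero ?_).symm
    rw [hres]
    exact neg_ne_zero.mpr (pow_ne_zero 2 hX0)
  set S : Multiset V := P.roots.filter fun c ↦ h.eval (res V c) = 0 with hS
  have hroot : ∀ c : V, P.eval c = 0 ↔ (P.map V.subtype).eval (c : ℂ) = 0 := fun c ↦ by
    rw [show (c : ℂ) = V.subtype c from rfl, eval_map_apply, map_eq_zero_iff _ hinj]
  have hmem : ∀ c ∈ S, ∃ τ, jf τ = c ∧ τ ∈ cmPoints p ∧
      ∀ M : Mp p, toGL M • τ = τ → M.1 0 0 + M.1 1 1 = 0 := by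
    intro c hc
    obtain ⟨hc1, hc2⟩ := Multiset.mem_filter.mp hc
    have hc3 := (hroot c).mp (isRoot_of_mem_roots hc1)
    obtain ⟨τ, hτ⟩ := jf_surjective (c : ℂ)
    have htr : ∀ M : Mp p, toGL M • τ = τ → M.1 0 0 + M.1 1 1 = 0 := fun M hM ↦
      (eval_hasse_eq_zero_iff V hp hM hhdeg hh hτ.symm).mp hc2
    rw [← hτ, eval_eq_zero_iff hval hdeg'] at hc3
    obtain ⟨i, hi⟩ := hc3
    obtain ⟨M, δ, -, hM⟩ := exists_fix_of_jf_eq hi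
    exact ⟨τ, hτ, ⟨M, htr M hM, hM⟩, htr⟩
  have hnodup : S.Nodup := by
    rw [Multiset.nodup_iff_count_le_one]
    intro c
    by_cases hc : c ∈ S
    · obtain ⟨τ, hτ, hcm, htr⟩ := hmem c hc
      refine (Multiset.count_le_of_le c (Multiset.filter_le _ _)).trans ?_
      rw [count_roots]
      by_contra! hlt
      have hdvd := (le_rootMultiplicity_iff hP0 (n := 2)).mp hlt
      apply not_sq_dvd hval hdeg' hp hcm htr
      have := Polynomial.map_dvd V.subtype hdvd
      rw [hτ]
      simpa using this
    · rw [Multiset.count_eq_zero_of_notMem hc]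
      exact zero_le_one
  have hcard : S.card = 2 * LL p := by
    have h1 : S.card = ((P.roots.map (res V)).filter fun a ↦ h.eval a = 0).card := by
      rw [Multiset.filter_map, Multiset.card_map]
      rfl
    rw [h1, hroots, Multiset.filter_nsmul, Multiset.card_nsmul, Multiset.filter_map,
      Multiset.card_map, LL_eq_card p hss, Nat.card_eq_fintype_card, Fintype.card_subtype]
    congr 1
    rw [Finset.card_def, Finset.filter_val]
    congr 1
    refine Multiset.filter_congr fun c _ ↦ ?_
    exact hiff c
  have hset : jf '' cmPoints p = ((S.toFinset.image (Subtype.val : V → ℂ) : Finset ℂ) : Set ℂ) := by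
    ext x
    simp only [Finset.coe_image, Set.mem_image, Finset.mem_coe, Multiset.mem_toFinset]
    constructor
    · rintro ⟨τ, ⟨M, ht, hM⟩, rfl⟩
      obtain ⟨i, δ, -, hi⟩ := exists_jf_eq hM
      have h0 := (eval_eq_zero_iff hval hdeg' τ).mpr ⟨i, hi⟩
      have hr : jf τ ∈ (P.map V.subtype).roots := by
        rw [mem_roots (by rwa [Ne, Polynomial.map_eq_zero_iff hinj])]
        exact h0
      rw [hsp.roots_map_of_injective hinj, Multiset.mem_map] at hr
      obtain ⟨c, hc, hcτ⟩ := hr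
      exact ⟨c, Multiset.mem_filter.mpr ⟨hc,
        (eval_hasse_eq_zero_iff V hp hM hhdeg hh hcτ).mpr ht⟩, hcτ⟩
    · rintro ⟨c, hc, rfl⟩
      obtain ⟨τ, hτ, hcm, -⟩ := hmem c hc
      exact ⟨τ, hcm, hτ⟩
  rw [hset]
  refine ⟨Finset.finite_toSet _, ?_⟩
  rw [Set.ncard_coe_finset, Finset.card_image_of_injective _ Subtype.val_injective,
    Multiset.toFinset_card_of_nodup hnodup, hcard]

end SSP

namespace SSP

open UpperHalfPlane Function
open scoped MatrixGroups

/-- The lattice `ℤτ + ℤ` as a subset of `ℂ`. -/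
def lat (τ : ℍ) : AddSubgroup ℂ where
  carrier := {x | ∃ m n : ℤ, (m * τ + n : ℂ) = x}
  zero_mem' := ⟨0, 0, by simp⟩
  add_mem' := by
    rintro _ _ ⟨m, n, rfl⟩ ⟨m', n', rfl⟩
    exact ⟨m + m', n + n', by push_cast; ring⟩
  neg_mem' := by
    rintro _ ⟨m, n, rfl⟩
    exact ⟨-m, -n, by push_cast; ring⟩

lemma mem_lat {τ : ℍ} {x : ℂ} : x ∈ lat τ ↔ ∃ m n : ℤ, (m * τ + n : ℂ) = x := Iff.rfl

lemma one_mem_lat (τ : ℍ) : (1 : ℂ) ∈ lat τ := ⟨0, 1, by simp⟩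

lemma tau_mem_lat (τ : ℍ) : (τ : ℂ) ∈ lat τ := ⟨1, 0, by simp⟩

lemma intCast_mul_mem (L : AddSubgroup ℂ) {x : ℂ} (hx : x ∈ L) (m : ℤ) : (m * x : ℂ) ∈ L := by
  simpa using L.zsmul_mem hx m

lemma mem_lat_of_basis {τ : ℍ} {L : AddSubgroup ℂ} {w : ℂ} (h1 : w * τ ∈ L) (h2 : w ∈ L)
    {x : ℂ} (hx : x ∈ lat τ) : w * x ∈ L := by
  obtain ⟨m, n, rfl⟩ := hx
  have := L.add_mem (intCast_mul_mem L h1 m) (intCast_mul_mem L h2 n)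
  convert this using 1
  ring

lemma jf_eq_iff (τ τ' : ℍ) :
    jf τ = jf τ' ↔ ∃ z : ℂ, z ≠ 0 ∧ ∀ x, x ∈ lat τ ↔ z * x ∈ lat τ' := by
  constructor
  · intro h
    obtain ⟨γ, rfl⟩ := exists_smul_eq_of_jf_eq h
    have hd := denom_ne_zero (γ : GL (Fin 2) ℝ) τ
    have h1 : ((γ • τ : ℍ) : ℂ) = (γ 0 0 * τ + γ 0 1) / (γ 1 0 * τ + γ 1 1) := by
      simpa using congrArg UpperHalfPlane.coe (UpperHalfPlane.specialLinearGroup_apply γ τ)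
    rw [denom_SL] at hd
    have hdet : (γ 0 0 : ℂ) * γ 1 1 - γ 0 1 * γ 1 0 = 1 := by
      have := γ.det_coe
      rw [Matrix.det_fin_two] at this
      exact_mod_cast this
    rw [eq_div_iff hd] at h1
    set σ := γ • τ
    refine ⟨(γ 1 0 * τ + γ 1 1 : ℂ)⁻¹, inv_ne_zero hd, fun x ↦ ⟨fun hx ↦ ?_, fun hx ↦ ?_⟩⟩
    · refine mem_lat_of_basis (τ := τ) ?_ ?_ hx
      · refine ⟨γ 1 1, -γ 0 1, ?_⟩
        rw [inv_mul_eq_div, eq_div_iff hd]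
        push_cast
        linear_combination (γ 1 1 : ℂ) * h1 + (τ : ℂ) * hdet
      · refine ⟨-γ 1 0, γ 0 0, ?_⟩
        rw [← one_div, eq_div_iff hd]
        push_cast
        linear_combination (-γ 1 0 : ℂ) * h1 + hdet
    · have := mem_lat_of_basis (τ := σ) (L := lat τ) (w := (γ 1 0 * τ + γ 1 1 : ℂ))
        ⟨γ 0 0, γ 0 1, by linear_combination -h1⟩ ⟨γ 1 0, γ 1 1, rfl⟩ hx
      rwa [mul_inv_cancel_left₀ hd] at this
  · rintro ⟨z, hz, h⟩
    obtain ⟨γ, rfl⟩ : ∃ γ : SL(2, ℤ), γ • τ = τ' := by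
      refine exists_smul_eq_of_lattice_eq (inv_ne_zero hz) ?_
      ext x
      have h1 : x ∈ (pp τ 1 one_ne_zero).lattice ↔ x ∈ lat τ := by
        rw [PeriodPair.mem_lattice, mem_lat]; simp [pp]
      have h2 : x ∈ (pp τ' z⁻¹ (inv_ne_zero hz)).lattice ↔ z * x ∈ lat τ' := by
        rw [PeriodPair.mem_lattice, mem_lat]
        refine exists_congr fun m ↦ exists_congr fun n ↦ ?_
        simp only [pp]
        constructor
        · rintro rfl; field_simp
        · intro h; field_simp; linear_combination h
      rw [h1, h2, h]
    exact (jf_smul γ τ).symm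

/-- `L` is a lattice with `j`-invariant `c`. -/
def HasJ (L : AddSubgroup ℂ) (c : ℂ) : Prop :=
  ∃ (τ : ℍ) (w : ℂ), w ≠ 0 ∧ (∀ x, x ∈ L ↔ w * x ∈ lat τ) ∧ jf τ = c

lemma hasJ_lat (τ : ℍ) : HasJ (lat τ) (jf τ) := ⟨τ, 1, one_ne_zero, by simp, rfl⟩

lemma HasJ.of_homothety {L L' : AddSubgroup ℂ} {c : ℂ} (h : HasJ L' c) {z : ℂ} (hz : z ≠ 0)
    (hL : ∀ x, x ∈ L ↔ z * x ∈ L') : HasJ L c := by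
  obtain ⟨τ, w, hw, h1, h2⟩ := h
  exact ⟨τ, w * z, mul_ne_zero hw hz, fun x ↦ by rw [hL, h1, mul_assoc], h2⟩

lemma HasJ.eq_iff {L L' : AddSubgroup ℂ} {c c' : ℂ} (h : HasJ L c) (h' : HasJ L' c') :
    c = c' ↔ ∃ z : ℂ, z ≠ 0 ∧ ∀ x, x ∈ L ↔ z * x ∈ L' := by
  obtain ⟨τ, w, hw, h1, rfl⟩ := h
  obtain ⟨τ', w', hw', h1', rfl⟩ := h'
  rw [jf_eq_iff]
  constructor
  · rintro ⟨z, hz, h⟩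
    refine ⟨w'⁻¹ * z * w, by simp [hz, hw, hw'], fun x ↦ ?_⟩
    rw [h1, h1', h]
    rw [show w' * (w'⁻¹ * z * w * x) = z * (w * x) by field_simp]
  · rintro ⟨z, hz, h⟩
    refine ⟨w' * z * w⁻¹, by simp [hz, hw, hw'], fun x ↦ ?_⟩
    have := h (w⁻¹ * x)
    rw [h1, h1', mul_inv_cancel_left₀ hw] at this
    rw [this]
    ring_nf

lemma HasJ.unique {L : AddSubgroup ℂ} {c c' : ℂ} (h : HasJ L c) (h' : HasJ L c') : c = c' :=
  (h.eq_iff h').mpr ⟨1, one_ne_zero, by simp⟩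

lemma exists_hasJ {L : AddSubgroup ℂ} {x y : ℂ} (hy : y ≠ 0) (him : (x / y).im ≠ 0)
    (h : ∀ z, z ∈ L ↔ ∃ m n : ℤ, (m * x + n * y : ℂ) = z) : ∃ c, HasJ L c := by
  rcases lt_or_gt_of_ne him with him | him
  · refine ⟨_, ⟨-(x / y), by simpa using him⟩, y⁻¹, inv_ne_zero hy, fun z ↦ ?_, rfl⟩
    rw [h, mem_lat]
    constructor
    · rintro ⟨m, n, rfl⟩
      refine ⟨-m, n, ?_⟩
      push_cast
      field_simp
    · rintro ⟨m, n, hz⟩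
      refine ⟨-m, n, ?_⟩
      simp only at hz
      push_cast
      field_simp at hz
      linear_combination hz
  · refine ⟨_, ⟨x / y, him⟩, y⁻¹, inv_ne_zero hy, fun z ↦ ?_, rfl⟩
    rw [h, mem_lat]
    refine exists_congr fun m ↦ exists_congr fun n ↦ ?_
    simp only
    field_simp

/-- `L` is stable under multiplication by `θ`. -/
def Stab (θ : ℂ) (L : AddSubgroup ℂ) : Prop := ∀ x ∈ L, θ * x ∈ L

lemma Stab.of_homothety {θ : ℂ} {L L' : AddSubgroup ℂ} (h : Stab θ L) {z : ℂ} (hz : z ≠ 0)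
    (hL : ∀ x, x ∈ L ↔ z * x ∈ L') : Stab θ L' := by
  intro x hx
  have h1 := (hL (z⁻¹ * x)).mpr (by rwa [mul_inv_cancel_left₀ hz])
  have h2 := (hL _).mp (h _ h1)
  convert h2 using 1
  field_simp

/-- The set of `j`-invariants of lattices with multiplication by `θ`. -/
def jStab (θ : ℂ) : Set ℂ := {c | ∃ L, HasJ L c ∧ Stab θ L}

lemma HasJ.mem_jStab_iff {θ : ℂ} {L : AddSubgroup ℂ} {c : ℂ} (h : HasJ L c) :
    c ∈ jStab θ ↔ Stab θ L := by
  refine ⟨fun ⟨L', h', hs⟩ ↦ ?_, fun hs ↦ ⟨L, h, hs⟩⟩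
  obtain ⟨z, hz, hL⟩ := (h'.eq_iff h).mp rfl
  exact hs.of_homothety hz hL

lemma exists_lat_of_mem_jStab {θ c : ℂ} (h : c ∈ jStab θ) : ∃ τ : ℍ, jf τ = c ∧ Stab θ (lat τ) := by
  obtain ⟨τ, rfl⟩ := jf_surjective c
  exact ⟨τ, rfl, (hasJ_lat τ).mem_jStab_iff.mp h⟩

lemma stab_lat_iff {θ : ℂ} {τ : ℍ} :
    Stab θ (lat τ) ↔ ∃ a b c d : ℤ, θ * τ = a * τ + b ∧ θ = c * τ + d := by
  constructor
  · intro h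
    obtain ⟨a, b, h1⟩ := h _ (tau_mem_lat τ)
    obtain ⟨c, d, h2⟩ := h _ (one_mem_lat τ)
    exact ⟨a, b, c, d, h1.symm, by rw [h2, mul_one]⟩
  · rintro ⟨a, b, c, d, h1, h2⟩ x hx
    exact mem_lat_of_basis (mem_lat.mpr ⟨a, b, h1.symm⟩) (mem_lat.mpr ⟨c, d, h2.symm⟩) hx

/-- The square root of `-p` in the upper half plane. -/
def sqm : ℂ := Complex.I * (Real.sqrt p : ℂ)

omit [Fact p.Prime] in
lemma sqm_mul_self : sqm p * sqm p = -p := by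
  have : ((Real.sqrt p : ℂ)) * (Real.sqrt p) = p := by
    rw [← Complex.ofReal_mul, Real.mul_self_sqrt (Nat.cast_nonneg p)]; simp
  rw [sqm]
  linear_combination (Complex.I * Complex.I) * this + (p : ℂ) * Complex.I_mul_I

omit [Fact p.Prime] in
lemma sqm_re : (sqm p).re = 0 := by simp [sqm]

lemma sqm_im_pos : 0 < (sqm p).im := by
  simp [sqm, (Fact.out : p.Prime).pos]

/-- `1` and `√-p` are linearly independent over `ℝ`. -/
lemma sqm_indep {a b : ℝ} (h : (a + b * sqm p : ℂ) = 0) : a = 0 ∧ b = 0 := by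
  have h1 := congrArg Complex.im h
  have h2 := congrArg Complex.re h
  have := (sqm_im_pos p).ne'
  simp [sqm_re, this] at h1 h2
  exact ⟨h2, h1⟩

lemma jf_image_cmPoints : jf '' cmPoints p = jStab (sqm p) := by
  ext c
  constructor
  · rintro ⟨τ, ⟨M, htr, hM⟩, rfl⟩
    rw [(hasJ_lat τ).mem_jStab_iff]
    have h1 := eigenvalue_mul hM
    rw [htr, denom_toGL] at h1
    rw [toGL_smul_eq_iff] at hM
    have h2 : ((M.1 1 0 * τ + M.1 1 1 : ℂ) - sqm p) * ((M.1 1 0 * τ + M.1 1 1 : ℂ) + sqm p) = 0 := by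
      push_cast at h1
      linear_combination -h1 - sqm_mul_self p
    rw [stab_lat_iff]
    rcases mul_eq_zero.mp h2 with h2 | h2
    · exact ⟨M.1 0 0, M.1 0 1, M.1 1 0, M.1 1 1, by linear_combination -hM - τ * h2,
        by linear_combination -h2⟩
    · refine ⟨-M.1 0 0, -M.1 0 1, -M.1 1 0, -M.1 1 1, ?_, ?_⟩
      · push_cast; linear_combination hM + τ * h2
      · push_cast; linear_combination h2
  · intro h
    obtain ⟨τ, rfl, hs⟩ := exists_lat_of_mem_jStab h
    obtain ⟨a, b, c, d, h1, h2⟩ := stab_lat_iff.mp hs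
    have h3 : ((a * d - b * c - p : ℝ) + (-(a + d) : ℝ) * sqm p : ℂ) = 0 := by
      have h4 : c * (sqm p * τ) = c * (a * τ + b) := by rw [h1]
      push_cast
      linear_combination h4 + (sqm p - a) * h2 - sqm_mul_self p
    obtain ⟨h4, h5⟩ := sqm_indep p h3
    have h6 : a + d = 0 := by
      have : (a + d : ℝ) = 0 := by linarith
      exact_mod_cast this
    refine ⟨τ, ⟨⟨!![a, b; c, d], ?_⟩, h6, ?_⟩, rfl⟩
    · rw [Matrix.det_fin_two_of]
      have : (a * d - b * c : ℝ) = p := by linarith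
      exact_mod_cast this
    · refine (toGL_smul_eq_iff _ _ _).mpr ?_
      change (a * τ + b : ℂ) = τ * (c * τ + d)
      rw [← h1, ← h2, mul_comm]

end SSP

namespace SSP

open UpperHalfPlane Function NumberField
open scoped nonZeroDivisors

section ClassGroup

variable {K : Type*} [Field K] [NumberField K] (φ : K →+* ℂ) {θ : 𝓞 K}

/-- The image in `ℂ` of an ideal of `𝓞 K`. -/
def idealLat (I : Ideal (𝓞 K)) : AddSubgroup ℂ where
  carrier := {x | ∃ a ∈ I, φ a = x}
  zero_mem' := ⟨0, I.zero_mem, by simp⟩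
  add_mem' := by
    rintro _ _ ⟨a, ha, rfl⟩ ⟨b, hb, rfl⟩
    exact ⟨a + b, I.add_mem ha hb, by simp⟩
  neg_mem' := by
    rintro _ ⟨a, ha, rfl⟩
    exact ⟨-a, I.neg_mem ha, by simp⟩

lemma mem_idealLat {I : Ideal (𝓞 K)} {x : ℂ} : x ∈ idealLat φ I ↔ ∃ a ∈ I, φ a = x := Iff.rfl

lemma stab_idealLat (I : Ideal (𝓞 K)) (θ : 𝓞 K) : Stab (φ θ) (idealLat φ I) := by
  rintro _ ⟨a, ha, rfl⟩
  exact ⟨θ * a, I.mul_mem_left _ ha, by simp⟩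

omit [NumberField K] in
lemma embed_injective : Injective fun a : 𝓞 K ↦ φ a :=
  φ.injective.comp RingOfIntegers.coe_injective

lemma mk0_eq_iff_homothety (I J : (Ideal (𝓞 K))⁰) :
    ClassGroup.mk0 I = ClassGroup.mk0 J ↔
      ∃ z : ℂ, z ≠ 0 ∧ ∀ x, x ∈ idealLat φ I ↔ z * x ∈ idealLat φ J := by
  have hinj := embed_injective φ
  rw [ClassGroup.mk0_eq_mk0_iff]
  constructor
  · rintro ⟨x, y, hx, hy, h⟩
    have hx' : φ x ≠ 0 := by simpa using hx
    have hy' : φ y ≠ 0 := by simpa using hy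
    refine ⟨φ x / φ y, div_ne_zero hx' hy', fun u ↦ ⟨?_, ?_⟩⟩
    · rintro ⟨a, ha, rfl⟩
      have h1 : x * a ∈ Ideal.span {x} * (I : Ideal (𝓞 K)) :=
        Ideal.mem_span_singleton_mul.mpr ⟨a, ha, rfl⟩
      rw [h] at h1
      obtain ⟨b, hb, hab⟩ := Ideal.mem_span_singleton_mul.mp h1
      refine ⟨b, hb, ?_⟩
      have := congrArg (fun a : 𝓞 K ↦ φ a) hab
      simp only [map_mul] at this
      field_simp
      linear_combination this
    · rintro ⟨b, hb, hbu⟩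
      have h1 : y * b ∈ Ideal.span {y} * (J : Ideal (𝓞 K)) :=
        Ideal.mem_span_singleton_mul.mpr ⟨b, hb, rfl⟩
      rw [← h] at h1
      obtain ⟨a, ha, hab⟩ := Ideal.mem_span_singleton_mul.mp h1
      refine ⟨a, ha, ?_⟩
      have := congrArg (fun a : 𝓞 K ↦ φ a) hab
      simp only [map_mul] at this
      field_simp at hbu
      apply mul_left_cancel₀ hx'
      linear_combination this + hbu
  · rintro ⟨z, hz, h⟩
    obtain ⟨a, ha, ha0⟩ := Submodule.exists_mem_ne_zero_of_ne_bot (nonZeroDivisors.coe_ne_zero I)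
    obtain ⟨b, hb, hab⟩ := (h (φ a)).mp ⟨a, ha, rfl⟩
    have ha' : φ a ≠ 0 := by simpa using ha0
    have hb0 : b ≠ 0 := by
      rintro rfl
      simp [hz] at hab
      exact ha0 hab
    refine ⟨b, a, hb0, ha0, le_antisymm ?_ ?_⟩
    · intro u hu
      obtain ⟨x, hx, rfl⟩ := Ideal.mem_span_singleton_mul.mp hu
      obtain ⟨y, hy, hxy⟩ := (h (φ x)).mp ⟨x, hx, rfl⟩
      refine Ideal.mem_span_singleton_mul.mpr ⟨y, hy, hinj ?_⟩
      simp only [map_mul]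
      rw [hxy, hab]
      ring
    · intro u hu
      obtain ⟨y, hy, rfl⟩ := Ideal.mem_span_singleton_mul.mp hu
      obtain ⟨x, hx, hxy⟩ := (h (z⁻¹ * φ y)).mpr ⟨y, hy, by field_simp⟩
      refine Ideal.mem_span_singleton_mul.mpr ⟨x, hx, hinj ?_⟩
      simp only [map_mul]
      rw [hxy, hab]
      field_simp

variable (hθ : ∀ a : 𝓞 K, ∃ m n : ℤ, a = m * θ + n) (him : (φ θ).im ≠ 0)

include hθ him in
lemma exists_basis_ringOfIntegers : Nonempty (Module.Basis (Fin 2) ℤ (𝓞 K)) := by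
  refine ⟨Module.Basis.mk (v := ![θ, 1]) ?_ ?_⟩
  · rw [LinearIndependent.pair_iff]
    intro m n h
    have h1 := congrArg (fun a : 𝓞 K ↦ φ a) h
    simp at h1
    have h2 := congrArg Complex.im h1
    simp [him] at h2
    subst h2
    simpa using h1
  · rintro a -
    obtain ⟨m, n, rfl⟩ := hθ a
    simp only [Matrix.range_cons, Matrix.range_empty, Set.union_empty, Set.singleton_union]
    exact Submodule.mem_span_pair.mpr ⟨m, n, by simp⟩

include hθ him in
lemma exists_hasJ_idealLat (I : (Ideal (𝓞 K))⁰) : ∃ c, HasJ (idealLat φ I) c := by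
  obtain ⟨b⟩ := exists_basis_ringOfIntegers φ hθ him
  let b' := Ideal.selfBasis b I.1 (nonZeroDivisors.coe_ne_zero I)
  have hmem (a : 𝓞 K) (ha : a ∈ I.1) : ∃ m n : ℤ, (m * φ (b' 0 : 𝓞 K) + n * φ (b' 1 : 𝓞 K) : ℂ) = φ a := by
    have := congrArg (fun a : I.1 ↦ φ (a : 𝓞 K)) (b'.sum_repr ⟨a, ha⟩)
    rw [Fin.sum_univ_two] at this
    refine ⟨b'.repr ⟨a, ha⟩ 0, b'.repr ⟨a, ha⟩ 1, ?_⟩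
    simpa only [Submodule.coe_add, Submodule.coe_smul_of_tower, zsmul_eq_mul, map_add, map_mul, map_intCast]
      using this
  have h1 : φ (b' 1 : 𝓞 K) ≠ 0 := by
    have := b'.ne_zero 1
    simpa using this
  refine exists_hasJ (x := φ (b' 0 : 𝓞 K)) (y := φ (b' 1 : 𝓞 K)) h1 (fun h0 ↦ ?_) fun z ↦ ⟨?_, ?_⟩
  · obtain ⟨m, n, h⟩ := hmem _ (I.1.mul_mem_left θ (b' 1).2)
    have h2 : φ θ = m * (φ (b' 0 : 𝓞 K) / φ (b' 1 : 𝓞 K)) + n := by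
      field_simp
      simp only [map_mul] at h
      linear_combination -h
    apply him
    rw [h2]
    simp [h0]
  · rintro ⟨a, ha, rfl⟩
    exact hmem a ha
  · rintro ⟨m, n, rfl⟩
    exact ⟨m * (b' 0 : 𝓞 K) + n * (b' 1 : 𝓞 K), I.1.add_mem (I.1.mul_mem_left _ (b' 0).2)
      (I.1.mul_mem_left _ (b' 1).2), by simp⟩

include hθ in
lemma exists_ideal_of_stab {τ : ℍ} (h : Stab (φ θ) (lat τ)) (him : (φ θ).im ≠ 0) :
    ∃ I : (Ideal (𝓞 K))⁰, ∃ z : ℂ, z ≠ 0 ∧ ∀ x, x ∈ lat τ ↔ z * x ∈ idealLat φ I := by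
  obtain ⟨a, b, c, d, h1, h2⟩ := stab_lat_iff.mp h
  have hc : (c : ℂ) ≠ 0 := by
    intro hc
    rw [hc] at h2
    apply him
    rw [h2]
    simp
  let I : Ideal (𝓞 K) :=
    { carrier := {u | ∃ x ∈ lat τ, φ u = c * x}
      zero_mem' := ⟨0, (lat τ).zero_mem, by simp⟩
      add_mem' := by
        rintro u v ⟨x, hx, hu⟩ ⟨y, hy, hv⟩
        exact ⟨x + y, (lat τ).add_mem hx hy, by simp [hu, hv, mul_add]⟩
      smul_mem' := by
        rintro e u ⟨x, hx, hu⟩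
        obtain ⟨m, n, rfl⟩ := hθ e
        refine ⟨m * (φ θ * x) + n * x, (lat τ).add_mem (intCast_mul_mem _ (h x hx) m)
          (intCast_mul_mem _ hx n), ?_⟩
        simp [hu]
        ring }
  have hI0 : I ≠ ⊥ := by
    have : (c : 𝓞 K) ∈ I := ⟨1, one_mem_lat τ, by simp⟩
    intro hI
    rw [hI, Ideal.mem_bot] at this
    apply hc
    have := congrArg (fun a : 𝓞 K ↦ φ a) this
    simpa using this
  refine ⟨⟨I, mem_nonZeroDivisors_of_ne_zero hI0⟩, c, hc, fun x ↦ ⟨?_, ?_⟩⟩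
  · rintro ⟨m, n, rfl⟩
    have key : φ ((m * θ + (n * c - m * d) : 𝓞 K) : K) = c * (m * τ + n) := by
      simp [h2]
      ring
    exact ⟨m * θ + (n * c - m * d), ⟨_, ⟨m, n, rfl⟩, key⟩, key⟩
  · rintro ⟨u, ⟨y, hy, hu⟩, hux⟩
    rw [hu] at hux
    rwa [← mul_left_cancel₀ hc hux]

include hθ him in
theorem classNumber_eq_ncard_jStab : classNumber K = (jStab (φ θ)).ncard := by
  choose I hI using ClassGroup.mk0_surjective (R := 𝓞 K)
  choose g hg using fun C ↦ exists_hasJ_idealLat φ hθ him (I C)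
  have hinj : Injective g := by
    intro C D h
    rw [← hI C, ← hI D, mk0_eq_iff_homothety φ]
    exact ((hg C).eq_iff (hg D)).mp h
  have hrange : Set.range g = jStab (φ θ) := by
    ext c
    constructor
    · rintro ⟨C, rfl⟩
      exact (hg C).mem_jStab_iff.mpr (stab_idealLat φ _ θ)
    · intro hc
      obtain ⟨τ, rfl, hs⟩ := exists_lat_of_mem_jStab hc
      obtain ⟨J, z, hz, hJ⟩ := exists_ideal_of_stab φ hθ hs him
      refine ⟨ClassGroup.mk0 J, ?_⟩
      obtain ⟨z', hz', hJ'⟩ := (mk0_eq_iff_homothety φ _ _).mp (hI (ClassGroup.mk0 J)).symm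
      refine ((hasJ_lat τ).eq_iff (hg _)).mpr ⟨z' * z, mul_ne_zero hz' hz, fun x ↦ ?_⟩ |>.symm
      rw [hJ, hJ', mul_assoc]
  rw [← hrange, Set.ncard_range_of_injective hinj, classNumber, Nat.card_eq_fintype_card]

end ClassGroup

end SSP

namespace SSP

open UpperHalfPlane Function

/-- The three nonzero linear forms modulo `2` on pairs of integers. -/
def form (e : Fin 3) (m n : ℤ) : ℤ := ![m, n, m + n] e

lemma form_add (e : Fin 3) (m n m' n' : ℤ) :
    form e (m + m') (n + n') = form e m n + form e m' n' := by
  fin_cases e <;> simp [form]; ring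

lemma form_neg (e : Fin 3) (m n : ℤ) : form e (-m) (-n) = -form e m n := by
  fin_cases e <;> simp [form]; ring

/-- The three sublattices of index `2` of `ℤτ + ℤ`. -/
def subLat (τ : ℍ) (e : Fin 3) : AddSubgroup ℂ where
  carrier := {x | ∃ m n : ℤ, (m * τ + n : ℂ) = x ∧ 2 ∣ form e m n}
  zero_mem' := ⟨0, 0, by simp, by fin_cases e <;> simp [form]⟩
  add_mem' := by
    rintro _ _ ⟨m, n, rfl, h⟩ ⟨m', n', rfl, h'⟩
    exact ⟨m + m', n + n', by push_cast; ring, by rw [form_add]; exact dvd_add h h'⟩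
  neg_mem' := by
    rintro _ ⟨m, n, rfl, h⟩
    exact ⟨-m, -n, by push_cast; ring, by rwa [form_neg, dvd_neg]⟩

lemma lat_coords {τ : ℍ} {m n m' n' : ℤ} (h : (m * τ + n : ℂ) = m' * τ + n') :
    m = m' ∧ n = n' := by
  have := intCast_add_mul_eq_zero τ (m := m - m') (n := n - n') (by
    push_cast; linear_combination h)
  omega

lemma mem_subLat {τ : ℍ} {e : Fin 3} {m n : ℤ} :
    (m * τ + n : ℂ) ∈ subLat τ e ↔ 2 ∣ form e m n := by
  constructor
  · rintro ⟨m', n', h, h'⟩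
    obtain ⟨rfl, rfl⟩ := lat_coords h
    exact h'
  · exact fun h ↦ ⟨m, n, rfl, h⟩

lemma subLat_le {τ : ℍ} {e : Fin 3} {x : ℂ} (hx : x ∈ subLat τ e) : x ∈ lat τ := by
  obtain ⟨m, n, rfl, -⟩ := hx
  exact ⟨m, n, rfl⟩

lemma two_mul_mem_subLat {τ : ℍ} (e : Fin 3) {x : ℂ} (hx : x ∈ lat τ) : 2 * x ∈ subLat τ e := by
  obtain ⟨m, n, rfl⟩ := hx
  refine ⟨2 * m, 2 * n, by push_cast; ring, ?_⟩
  fin_cases e <;> simp [form]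

lemma sub_mem_subLat {τ : ℍ} {e : Fin 3} {x y : ℂ} (hx : x ∈ lat τ) (hy : y ∈ lat τ)
    (hx' : x ∉ subLat τ e) (hy' : y ∉ subLat τ e) : x - y ∈ subLat τ e := by
  obtain ⟨m, n, rfl⟩ := hx
  obtain ⟨m', n', rfl⟩ := hy
  rw [mem_subLat] at hx' hy'
  refine ⟨m - m', n - n', by push_cast; ring, ?_⟩
  have := form_add e m n (-m') (-n')
  rw [form_neg] at this
  rw [sub_eq_add_neg, sub_eq_add_neg, this]
  omega

lemma subLat_injective (τ : ℍ) : Injective (subLat τ) := by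
  intro e e' h
  have h1 : (1 : ℂ) ∈ subLat τ e ↔ (1 : ℂ) ∈ subLat τ e' := by rw [h]
  have h2 : (τ : ℂ) ∈ subLat τ e ↔ (τ : ℂ) ∈ subLat τ e' := by rw [h]
  have k1 := fun e ↦ mem_subLat (τ := τ) (e := e) (m := 0) (n := 1)
  have k2 := fun e ↦ mem_subLat (τ := τ) (e := e) (m := 1) (n := 0)
  simp only [Int.cast_zero, Int.cast_one, zero_mul, one_mul, zero_add, add_zero] at k1 k2
  rw [k1, k1] at h1
  rw [k2, k2] at h2
  revert h1 h2
  fin_cases e <;> fin_cases e' <;> simp [form]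

lemma exists_hasJ_subLat (τ : ℍ) (e : Fin 3) : ∃ c, HasJ (subLat τ e) c := by
  have him := τ.im_pos.ne'
  rw [← coe_im] at him
  have hmem : ∀ z, z ∈ subLat τ e ↔ ∃ m n : ℤ, (m * τ + n : ℂ) = z ∧ 2 ∣ form e m n :=
    fun z ↦ Iff.rfl
  fin_cases e
  · refine exists_hasJ (x := 2 * τ) (y := 1) one_ne_zero (by simpa using him) fun z ↦ ?_
    rw [hmem]
    constructor
    · rintro ⟨m, n, rfl, k, hk⟩
      refine ⟨k, n, ?_⟩
      rw [show m = 2 * k from hk]; push_cast; ring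
    · rintro ⟨m, n, rfl⟩
      exact ⟨2 * m, n, by push_cast; ring, by simp [form]⟩
  · refine exists_hasJ (x := τ) (y := 2) two_ne_zero (by simpa using him) fun z ↦ ?_
    rw [hmem]
    constructor
    · rintro ⟨m, n, rfl, k, hk⟩
      refine ⟨m, k, ?_⟩
      rw [show n = 2 * k from hk]; push_cast; ring
    · rintro ⟨m, n, rfl⟩
      exact ⟨m, 2 * n, by push_cast; ring, by simp [form]⟩
  · refine exists_hasJ (x := τ + 1) (y := 2) two_ne_zero (by simpa using him) fun z ↦ ?_
    rw [hmem]
    constructor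
    · rintro ⟨m, n, rfl, k, hk⟩
      refine ⟨m, k - m, ?_⟩
      rw [show n = 2 * k - m by rw [← show m + n = 2 * k from hk]; ring]; push_cast; ring
    · rintro ⟨m, n, rfl⟩
      exact ⟨m, 2 * n + m, by push_cast; ring, ⟨m + n, by simp [form]; ring⟩⟩

/-- The `j`-invariant of `subLat τ e`. -/
def jSub (τ : ℍ) (e : Fin 3) : ℂ := (exists_hasJ_subLat τ e).choose

lemma hasJ_subLat (τ : ℍ) (e : Fin 3) : HasJ (subLat τ e) (jSub τ e) :=
  (exists_hasJ_subLat τ e).choose_spec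

lemma eq_of_between {τ : ℍ} {L : AddSubgroup ℂ} (h1 : ∀ x ∈ L, x ∈ lat τ)
    (h2 : ∀ x ∈ lat τ, 2 * x ∈ L) :
    L = lat τ ∨ (∀ x, x ∈ L ↔ x / 2 ∈ lat τ) ∨ ∃ e, L = subLat τ e := by
  have hred (m n k l : ℤ) : (m * τ + n : ℂ) ∈ L ↔
      ((m - 2 * k : ℤ) * τ + (n - 2 * l : ℤ) : ℂ) ∈ L := by
    have h := h2 (k * τ + l) ⟨k, l, rfl⟩
    rw [← L.add_mem_cancel_right (y := ((m - 2 * k : ℤ) * τ + (n - 2 * l : ℤ) : ℂ)) h]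
    apply iff_of_eq
    congr 1
    push_cast
    ring
  have hpar (m n : ℤ) : (m * τ + n : ℂ) ∈ L ↔ ((m % 2 : ℤ) * τ + (n % 2 : ℤ) : ℂ) ∈ L := by
    rw [hred m n (m / 2) (n / 2), Int.emod_def, Int.emod_def]
  have hext (L' : AddSubgroup ℂ) (h : ∀ x ∈ L', x ∈ lat τ)
      (h' : ∀ m n : ℤ, (m * τ + n : ℂ) ∈ L ↔ (m * τ + n : ℂ) ∈ L') : L = L' := by
    ext x
    constructor
    · intro hx
      obtain ⟨m, n, rfl⟩ := h1 x hx
      exact (h' m n).mp hx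
    · intro hx
      obtain ⟨m, n, rfl⟩ := h x hx
      exact (h' m n).mpr hx
  have hcase (m : ℤ) : m % 2 = 0 ∨ m % 2 = 1 := by omega
  have h0 : (0 : ℂ) ∈ L := L.zero_mem
  by_cases ha : (τ : ℂ) ∈ L <;> by_cases hb : (1 : ℂ) ∈ L
  · left
    refine hext _ (fun _ h ↦ h) fun m n ↦ ⟨fun _ ↦ ⟨m, n, rfl⟩, fun _ ↦ ?_⟩
    simpa using L.add_mem (intCast_mul_mem L ha m) (intCast_mul_mem L hb n)
  · have hc : (τ + 1 : ℂ) ∉ L := by rwa [L.add_mem_cancel_left ha]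
    refine Or.inr (Or.inr ⟨1, hext _ (fun _ h ↦ subLat_le h) fun m n ↦ ?_⟩)
    rw [hpar, mem_subLat]
    change _ ↔ 2 ∣ n
    rw [Int.dvd_iff_emod_eq_zero]
    rcases hcase m with hm | hm <;> rcases hcase n with hn | hn <;> simp [hm, hn, ha, hb, hc]
  · have hc : (τ + 1 : ℂ) ∉ L := by rwa [L.add_mem_cancel_right hb]
    refine Or.inr (Or.inr ⟨0, hext _ (fun _ h ↦ subLat_le h) fun m n ↦ ?_⟩)
    rw [hpar, mem_subLat]
    change _ ↔ 2 ∣ m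
    rw [Int.dvd_iff_emod_eq_zero]
    rcases hcase m with hm | hm <;> rcases hcase n with hn | hn <;> simp [hm, hn, ha, hb, hc]
  · by_cases hc : (τ + 1 : ℂ) ∈ L
    · refine Or.inr (Or.inr ⟨2, hext _ (fun _ h ↦ subLat_le h) fun m n ↦ ?_⟩)
      rw [hpar, mem_subLat]
      change _ ↔ 2 ∣ m + n
      rw [Int.dvd_iff_emod_eq_zero, Int.add_emod]
      rcases hcase m with hm | hm <;> rcases hcase n with hn | hn <;> simp [hm, hn, ha, hb, hc]
    · refine Or.inr (Or.inl fun x ↦ ⟨fun hx ↦ ?_, fun hx ↦ ?_⟩)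
      · obtain ⟨m, n, rfl⟩ := h1 x hx
        rw [hpar] at hx
        rcases hcase m with hm | hm <;> rcases hcase n with hn | hn <;>
          simp [hm, hn, ha, hb, hc] at hx
        refine ⟨m / 2, n / 2, ?_⟩
        have hm' : (m : ℂ) = 2 * (m / 2 : ℤ) := by exact_mod_cast (by omega)
        have hn' : (n : ℂ) = 2 * (n / 2 : ℤ) := by exact_mod_cast (by omega)
        linear_combination (-hm' * τ - hn') / 2
      · simpa [mul_div_cancel₀] using h2 _ hx

lemma exists_hasJ_of_between {τ : ℍ} {L : AddSubgroup ℂ} (h1 : ∀ x ∈ L, x ∈ lat τ)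
    (h2 : ∀ x ∈ lat τ, 2 * x ∈ L) : ∃ c, HasJ L c := by
  rcases eq_of_between h1 h2 with rfl | h | ⟨e, rfl⟩
  · exact ⟨_, hasJ_lat τ⟩
  · exact ⟨_, (hasJ_lat τ).of_homothety (z := 2⁻¹) (by norm_num) fun x ↦ by
      rw [h, div_eq_inv_mul]⟩
  · exact ⟨_, hasJ_subLat τ e⟩

lemma stab_subLat_iff {θ : ℂ} {τ : ℍ} {a b c d : ℤ} (h1 : θ * τ = a * τ + b)
    (h2 : θ = c * τ + d) (e : Fin 3) :
    Stab θ (subLat τ e) ↔ 2 ∣ ![c, b, a + b + c + d] e := by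
  have hmul (m n : ℤ) :
      θ * (m * τ + n) = (m * a + n * c : ℤ) * τ + (m * b + n * d : ℤ) := by
    push_cast
    linear_combination (m : ℂ) * h1 + (n : ℂ) * h2
  have hiff : Stab θ (subLat τ e) ↔
      ∀ m n, 2 ∣ form e m n → 2 ∣ form e (m * a + n * c) (m * b + n * d) := by
    constructor
    · intro h m n hmn
      have := h _ (mem_subLat.mpr hmn)
      rwa [hmul, mem_subLat] at this
    · rintro h _ ⟨m, n, rfl, hmn⟩
      rw [hmul, mem_subLat]
      exact h m n hmn
  rw [hiff]
  fin_cases e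
  · change (∀ m n : ℤ, 2 ∣ m → 2 ∣ m * a + n * c) ↔ 2 ∣ c
    exact ⟨fun h ↦ by simpa using h 0 1 (by norm_num),
      fun h m n hm ↦ dvd_add (hm.mul_right _) (h.mul_left _)⟩
  · change (∀ m n : ℤ, 2 ∣ n → 2 ∣ m * b + n * d) ↔ 2 ∣ b
    exact ⟨fun h ↦ by simpa using h 1 0 (by norm_num),
      fun h m n hn ↦ dvd_add (h.mul_left _) (hn.mul_right _)⟩
  · change (∀ m n : ℤ, 2 ∣ m + n → 2 ∣ m * a + n * c + (m * b + n * d)) ↔ 2 ∣ a + b + c + d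
    refine ⟨fun h ↦ ?_, fun h m n hmn ↦ ?_⟩
    · have := h 1 1 (by norm_num)
      convert this using 1
      ring
    · have h3 : m * a + n * c + (m * b + n * d) = (m + n) * (c + d) + m * (a + b + c + d)
        - 2 * (m * (c + d)) := by ring
      rw [h3]
      exact dvd_sub (dvd_add (hmn.mul_right _) (h.mul_left _)) (dvd_mul_right _ _)

lemma mem_lat_iff_of_not_stab {θ : ℂ} {τ : ℍ} (h : Stab θ (lat τ)) {e : Fin 3}
    (he : ¬ Stab θ (subLat τ e)) (y : ℂ) :
    y ∈ lat τ ↔ ∃ a ∈ subLat τ e, ∃ b ∈ subLat τ e, y = a + θ * b := by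
  constructor
  · intro hy
    simp only [Stab, not_forall] at he
    obtain ⟨b, hb, hb'⟩ := he
    by_cases hy' : y ∈ subLat τ e
    · exact ⟨y, hy', 0, AddSubgroup.zero_mem _, by simp⟩
    · exact ⟨y - θ * b, sub_mem_subLat hy (h b (subLat_le hb)) hy' hb', b, hb, by ring⟩
  · rintro ⟨a, ha, b, hb, rfl⟩
    exact AddSubgroup.add_mem _ (subLat_le ha) (h b (subLat_le hb))

end SSP

namespace SSP

open UpperHalfPlane Function

lemma sq_mul_ne_sq_mul_prime (hp : 5 ≤ p) {k : ℕ} (hk : 0 < k) (hkp : k < p) {c m : ℕ}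
    (hm : m ≠ 0) : c ^ 2 * k ≠ m ^ 2 * p := by
  intro h
  have hpp : p.Prime := Fact.out
  have hc : c ≠ 0 := by
    rintro rfl
    simp [hm] at h
    omega
  have h1 := congrArg (fun n ↦ n.factorization p) h
  rw [Nat.factorization_mul (pow_ne_zero 2 hc) hk.ne', Nat.factorization_mul (pow_ne_zero 2 hm)
    hpp.ne_zero, Nat.factorization_pow, Nat.factorization_pow] at h1
  have h2 : k.factorization p = 0 :=
    Nat.factorization_eq_zero_of_not_dvd (Nat.not_dvd_of_pos_of_lt hk hkp)
  simp [h2, hpp.factorization_self] at h1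
  omega

lemma eq_one_or_neg_one_of_homothety (hp : 5 ≤ p) {τ : ℍ} (hs : Stab (sqm p) (lat τ)) {z : ℂ}
    (hz : z ≠ 0) (h : ∀ x, x ∈ lat τ ↔ z * x ∈ lat τ) : z = 1 ∨ z = -1 := by
  have hst : Stab z (lat τ) := fun x hx ↦ (h x).mp hx
  have hst' : Stab z⁻¹ (lat τ) := fun x hx ↦ (h _).mpr (by rwa [mul_inv_cancel_left₀ hz])
  obtain ⟨a, b, m, n, h1, h2⟩ := stab_lat_iff.mp hst
  obtain ⟨a', b', m', n', h3, h4⟩ := stab_lat_iff.mp hst'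
  obtain ⟨-, -, c, d, -, h5⟩ := stab_lat_iff.mp hs
  have hzz := mul_inv_cancel₀ hz
  obtain ⟨k1, k2⟩ := lat_coords (τ := τ) (m := m' * a + n' * m) (n := m' * b + n' * n) (m' := 0)
    (n' := 1) (by
      push_cast
      linear_combination hzz - z * h4 - (m' : ℂ) * h1 - (n' : ℂ) * h2)
  obtain ⟨k3, k4⟩ := lat_coords (τ := τ) (m := a' * a + b' * m) (n := a' * b + b' * n) (m' := 1)
    (n' := 0) (by
      push_cast
      linear_combination (τ : ℂ) * hzz - z * h3 - (a' : ℂ) * h1 - (b' : ℂ) * h2)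
  have hdet : (a * n - b * m) * (a' * n' - b' * m') = 1 := by
    linear_combination (a' * a + b' * m) * k2 + k3 - (a' * b + b' * n) * k1
  by_cases hm : m = 0
  · subst hm
    have hn : n * (a * (a' * n' - b' * m')) = 1 := by linear_combination hdet
    rw [h2]
    rcases Int.eq_one_or_neg_one_of_mul_eq_one hn with rfl | rfl <;> simp
  exfalso
  have hc : c ≠ 0 := by
    rintro rfl
    have := (sqm_im_pos p).ne'
    rw [h5] at this
    simp at this
  have hquad : z * z - (a + n) * z + (a * n - b * m) = 0 := by
    linear_combination (m : ℂ) * h1 + (z - a) * h2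
  have hcz : (c : ℂ) * z = m * sqm p + (n * c - m * d) := by
    linear_combination (c : ℂ) * h2 - (m : ℂ) * h5
  set t := a + n with ht
  set D := a * n - b * m with hD
  set e := n * c - m * d with he
  obtain ⟨j1, j2⟩ := sqm_indep p (a := (-m * m * p + e * e - t * c * e + D * c * c : ℤ))
    (b := (2 * m * e - t * c * m : ℤ)) (by
      have h6 : (c : ℂ) * c * (z * z - t * z + D) = 0 := by
        rw [ht, hD]; push_cast; rw [hquad, mul_zero]
      have h7 : (c : ℂ) * z = m * sqm p + e := by rw [hcz, he]; push_cast; ring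
      push_cast
      linear_combination h6 - (c * z + m * sqm p + e - t * c) * h7 - (m : ℂ) * m * sqm_mul_self p)
  have j1' : -m * m * p + e * e - t * c * e + D * c * c = 0 := by exact_mod_cast j1
  have j2' : m * (2 * e - t * c) = 0 := by
    have : 2 * m * e - t * c * m = 0 := by exact_mod_cast j2
    linear_combination this
  have j3 : 2 * e = t * c := by
    rcases mul_eq_zero.mp j2' with h | h
    · exact absurd h hm
    · linarith
  have j4 : c ^ 2 * (4 * D - t ^ 2) = (2 * m) ^ 2 * p := by
    linear_combination 4 * j1' + (t * c - 2 * e) * j3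
  have hpos : 0 < 4 * D - t ^ 2 := by
    have h8 : 0 < (2 * m) ^ 2 * (p : ℤ) := by
      have : (0 : ℤ) < p := by exact_mod_cast (by omega)
      positivity
    rw [← j4] at h8
    exact pos_of_mul_pos_right h8 (sq_nonneg c)
  have hD1 : D = 1 := by
    rcases Int.eq_one_or_neg_one_of_mul_eq_one hdet with h | h
    · exact h
    · nlinarith [sq_nonneg t]
  obtain ⟨k, hk⟩ := Int.eq_ofNat_of_zero_le hpos.le
  refine sq_mul_ne_sq_mul_prime p hp (k := k) (c := c.natAbs) (m := (2 * m).natAbs)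
    (by omega) ?_ (by omega) ?_
  · have : (k : ℤ) ≤ 4 := by nlinarith [sq_nonneg t]
    omega
  · zify
    rw [sq_abs, sq_abs, ← hk, j4]

/-- The generator `(1 + √-p) / 2` of the maximal order when `p ≡ 3 (mod 4)`. -/
def omg : ℂ := (1 + sqm p) / 2

omit [Fact p.Prime] in
lemma omg_mul_self {N : ℤ} (hN : 4 * N = p + 1) : omg p * omg p = omg p - N := by
  have hN' : (4 * N : ℂ) = p + 1 := by exact_mod_cast hN
  rw [omg]
  linear_combination sqm_mul_self p / 4 + hN' / 4

omit [Fact p.Prime] in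
lemma sqm_eq : sqm p = 2 * omg p - 1 := by rw [omg]; ring

omit [Fact p.Prime] in
lemma stab_sqm_of_stab_omg {L : AddSubgroup ℂ} (h : Stab (omg p) L) : Stab (sqm p) L := by
  intro x hx
  rw [sqm_eq]
  convert L.sub_mem (L.add_mem (h x hx) (h x hx)) hx using 1
  ring

lemma omg_matrix {N : ℤ} (hN : 4 * N = p + 1) {τ : ℍ} {a b c d : ℤ}
    (h1 : omg p * τ = a * τ + b) (h2 : omg p = c * τ + d) : a + d = 1 ∧ a * d - b * c = N := by
  have h3 : (1 - (a + d)) * omg p + (a * d - b * c - N) = 0 := by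
    linear_combination (c : ℂ) * h1 + (omg p - a) * h2 - omg_mul_self p hN
  obtain ⟨h4, h5⟩ := sqm_indep p (a := (1 - (a + d)) / 2 + (a * d - b * c - N))
    (b := (1 - (a + d)) / 2) (by
      rw [omg] at h3
      push_cast
      linear_combination h3)
  have h6 : (a + d : ℝ) = 1 := by linarith
  have h7 : (a * d - b * c : ℝ) = N := by linarith
  exact ⟨by exact_mod_cast h6, by exact_mod_cast h7⟩

lemma parity_omg_matrix {N a b c d : ℤ} (h1 : a + d = 1) (h2 : a * d - b * c = N) :
    (Even b ∨ Even c ↔ Even N) := by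
  obtain rfl : d = 1 - a := by linarith
  have h3 : Even (a * (1 - a)) := by
    rw [Int.even_mul, Int.even_sub']
    rcases Int.even_or_odd a with ha | ha
    · exact Or.inl ha
    · exact Or.inr (by simpa using ha)
  rw [← h2, Int.even_sub, Int.even_mul (m := b)]
  tauto

lemma not_stab_subLat_of_odd {N : ℤ} (hN : 4 * N = p + 1) (hodd : Odd N) {τ : ℍ}
    (h : Stab (omg p) (lat τ)) (e : Fin 3) : ¬ Stab (omg p) (subLat τ e) := by
  obtain ⟨a, b, c, d, h1, h2⟩ := stab_lat_iff.mp h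
  obtain ⟨h3, h4⟩ := omg_matrix p hN h1 h2
  have h5 := parity_omg_matrix h3 h4
  rw [stab_subLat_iff h1 h2]
  rw [← Int.not_even_iff_odd, ← h5, not_or, Int.not_even_iff_odd, Int.not_even_iff_odd] at hodd
  obtain ⟨⟨b', hb⟩, c', hc⟩ := hodd
  fin_cases e
  · change ¬ 2 ∣ c
    omega
  · change ¬ 2 ∣ b
    omega
  · change ¬ 2 ∣ a + b + c + d
    omega

lemma existsUnique_not_stab_subLat {N : ℤ} (hN : 4 * N = p + 1) (heven : Even N) {τ : ℍ}
    (h : Stab (omg p) (lat τ)) : ∃! e, ¬ Stab (omg p) (subLat τ e) := by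
  obtain ⟨a, b, c, d, h1, h2⟩ := stab_lat_iff.mp h
  obtain ⟨h3, h4⟩ := omg_matrix p hN h1 h2
  have h5 := (parity_omg_matrix h3 h4).mpr heven
  simp only [stab_subLat_iff h1 h2]
  rw [Int.even_iff, Int.even_iff] at h5
  have key (e₀ : Fin 3) (hc : ¬ 2 ∣ c ↔ e₀ = 0) (hb : ¬ 2 ∣ b ↔ e₀ = 1)
      (ha : ¬ 2 ∣ a + b + c + d ↔ e₀ = 2) : ∃! e, ¬ 2 ∣ ![c, b, a + b + c + d] e := by
    have : ∀ e, ¬ 2 ∣ ![c, b, a + b + c + d] e ↔ e₀ = e := by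
      intro e
      fin_cases e
      · exact hc
      · exact hb
      · exact ha
    exact ⟨e₀, (this e₀).mpr rfl, fun e he ↦ ((this e).mp he).symm⟩
  by_cases hb : 2 ∣ b
  · by_cases hc : 2 ∣ c
    · exact key 2 (by simp [hc]) (by simp [hb]) (by simp; omega)
    · exact key 0 (by simp [hc]) (by simp [hb]) (by simp; omega)
  · exact key 1 (by simp; omega) (by simp [hb]) (by simp; omega)

omit [Fact p.Prime] in
lemma exists_jSub_eq {N : ℤ} (hN : 4 * N = p + 1) {σ : ℂ → ℍ} (hσ : ∀ c ∈ jStab (omg p), jf (σ c) = c)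
    {c : ℂ} (hc : c ∈ jStab (sqm p)) (hc' : c ∉ jStab (omg p)) :
    ∃ c' ∈ jStab (omg p), ∃ e, ¬ Stab (omg p) (subLat (σ c') e) ∧ jSub (σ c') e = c := by
  obtain ⟨τ, rfl, hs⟩ := exists_lat_of_mem_jStab hc
  rw [(hasJ_lat τ).mem_jStab_iff] at hc'
  let A : AddSubgroup ℂ :=
    { carrier := {x | ∃ a ∈ lat τ, ∃ b ∈ lat τ, x = 2 * a + 2 * omg p * b}
      zero_mem' := ⟨0, (lat τ).zero_mem, 0, (lat τ).zero_mem, by simp⟩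
      add_mem' := by
        rintro _ _ ⟨a, ha, b, hb, rfl⟩ ⟨a', ha', b', hb', rfl⟩
        exact ⟨a + a', (lat τ).add_mem ha ha', b + b', (lat τ).add_mem hb hb', by ring⟩
      neg_mem' := by
        rintro _ ⟨a, ha, b, hb, rfl⟩
        exact ⟨-a, (lat τ).neg_mem ha, -b, (lat τ).neg_mem hb, by ring⟩ }
  have hA1 : ∀ x ∈ A, x ∈ lat τ := by
    rintro _ ⟨a, ha, b, hb, rfl⟩
    convert (lat τ).add_mem ((lat τ).add_mem ha ha) ((lat τ).add_mem hb (hs b hb)) using 1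
    rw [sqm_eq]
    ring
  have hA2 : ∀ x ∈ lat τ, 2 * x ∈ A := fun x hx ↦ ⟨x, hx, 0, (lat τ).zero_mem, by simp⟩
  obtain ⟨c', hA⟩ := exists_hasJ_of_between hA1 hA2
  have hAs : Stab (omg p) A := by
    rintro _ ⟨a, ha, b, hb, rfl⟩
    refine ⟨(-N : ℤ) * b, intCast_mul_mem _ hb _, a + b, (lat τ).add_mem ha hb, ?_⟩
    push_cast
    linear_combination 2 * b * omg_mul_self p hN
  have hc'' : c' ∈ jStab (omg p) := hA.mem_jStab_iff.mpr hAs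
  obtain ⟨z, hz, hzA⟩ := (hA.eq_iff (hasJ_lat (σ c'))).mp (hσ c' hc'').symm
  let M : AddSubgroup ℂ := (lat τ).comap (AddMonoidHom.mulLeft (2 * z)⁻¹)
  have hM (x : ℂ) : x ∈ M ↔ (2 * z)⁻¹ * x ∈ lat τ := Iff.rfl
  have hz2 : (2 * z)⁻¹ ≠ 0 := inv_ne_zero (mul_ne_zero two_ne_zero hz)
  have hMs : ¬ Stab (omg p) M := fun h ↦ hc' (h.of_homothety hz2 hM)
  have hσs : Stab (omg p) (lat (σ c')) := hAs.of_homothety hz hzA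
  have hM1 : ∀ x ∈ M, x ∈ lat (σ c') := by
    intro x hx
    have := (hzA _).mp (hA2 _ ((hM x).mp hx))
    convert this using 1
    field_simp
  have hM2 : ∀ x ∈ lat (σ c'), 2 * x ∈ M := by
    intro x hx
    rw [hM]
    apply hA1
    rw [hzA]
    convert hx using 1
    field_simp
  rcases eq_of_between hM1 hM2 with h | h | ⟨e, h⟩
  · rw [h] at hMs
    exact absurd hσs hMs
  · refine absurd (hσs.of_homothety (z := 2) two_ne_zero fun x ↦ ?_) hMs
    rw [h, mul_div_cancel_left₀ _ two_ne_zero]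
  · rw [h] at hMs
    refine ⟨c', hc'', e, hMs, ?_⟩
    refine ((hasJ_subLat _ e).eq_iff (hasJ_lat τ)).mpr ⟨(2 * z)⁻¹, hz2, fun x ↦ ?_⟩
    rw [← h, hM]

lemma ncard_jStab_sqm_aux (hp : 5 ≤ p) {N : ℤ} (hN : 4 * N = p + 1)
    (hfin : (jStab (sqm p)).Finite) {σ : ℂ → ℍ}
    (hσ : ∀ c ∈ jStab (omg p), jf (σ c) = c ∧ Stab (omg p) (lat (σ c))) :
    (jStab (sqm p)).ncard = (jStab (omg p)).ncard +
      {q : ℂ × Fin 3 | q.1 ∈ jStab (omg p) ∧ ¬ Stab (omg p) (subLat (σ q.1) q.2)}.ncard := by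
  set P := {q : ℂ × Fin 3 | q.1 ∈ jStab (omg p) ∧ ¬ Stab (omg p) (subLat (σ q.1) q.2)} with hP
  let G : ℂ × Fin 3 → ℂ := fun q ↦ jSub (σ q.1) q.2
  have hinj : Set.InjOn G P := by
    rintro ⟨c, e⟩ ⟨hc, he⟩ ⟨c', e'⟩ ⟨hc', he'⟩ h
    obtain ⟨z, hz, hL⟩ := ((hasJ_subLat (σ c) e).eq_iff (hasJ_subLat (σ c') e')).mp h
    have hlat : ∀ x, x ∈ lat (σ c) ↔ z * x ∈ lat (σ c') := by
      intro x
      rw [mem_lat_iff_of_not_stab (hσ c hc).2 he, mem_lat_iff_of_not_stab (hσ c' hc').2 he']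
      constructor
      · rintro ⟨a, ha, b, hb, rfl⟩
        exact ⟨z * a, (hL a).mp ha, z * b, (hL b).mp hb, by ring⟩
      · rintro ⟨a, ha, b, hb, hx⟩
        refine ⟨z⁻¹ * a, (hL _).mpr (by rwa [mul_inv_cancel_left₀ hz]), z⁻¹ * b,
          (hL _).mpr (by rwa [mul_inv_cancel_left₀ hz]), ?_⟩
        field_simp
        linear_combination hx
    obtain rfl : c = c' := by
      rw [← (hσ c hc).1, ← (hσ c' hc').1, jf_eq_iff]
      exact ⟨z, hz, hlat⟩
    obtain rfl : e = e' := by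
      apply subLat_injective (σ c)
      ext x
      rw [hL]
      rcases eq_one_or_neg_one_of_homothety p hp (stab_sqm_of_stab_omg p (hσ c hc).2) hz hlat
        with rfl | rfl <;> simp
    rfl
  have hunion : jStab (sqm p) = jStab (omg p) ∪ G '' P := by
    ext c
    constructor
    · intro hc
      by_cases hc' : c ∈ jStab (omg p)
      · exact Or.inl hc'
      · obtain ⟨c', h1, e, h2, h3⟩ := exists_jSub_eq p hN (fun c hc ↦ (hσ c hc).1) hc hc'
        exact Or.inr ⟨(c', e), ⟨h1, h2⟩, h3⟩
    · rintro (⟨L, hL, hs⟩ | ⟨⟨c', e⟩, ⟨h1, h2⟩, rfl⟩)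
      · exact ⟨L, hL, stab_sqm_of_stab_omg p hs⟩
      · refine (hasJ_subLat _ e).mem_jStab_iff.mpr fun x hx ↦ ?_
        rw [sqm_eq, sub_mul, one_mul, mul_assoc]
        exact AddSubgroup.sub_mem _ (two_mul_mem_subLat e ((hσ c' h1).2 x (subLat_le hx))) hx
  have hdisj : Disjoint (jStab (omg p)) (G '' P) := by
    rw [Set.disjoint_right]
    rintro _ ⟨⟨c', e⟩, ⟨h1, h2⟩, rfl⟩ h3
    exact h2 ((hasJ_subLat _ e).mem_jStab_iff.mp h3)
  rw [hunion] at hfin ⊢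
  rw [Set.ncard_union_eq hdisj (hfin.subset Set.subset_union_left)
    (hfin.subset Set.subset_union_right), hinj.ncard_image]

theorem ncard_jStab_sqm (hp : 5 ≤ p) {N : ℤ} (hN : 4 * N = p + 1)
    (hfin : (jStab (sqm p)).Finite) :
    (jStab (sqm p)).ncard = (if Even N then 2 else 4) * (jStab (omg p)).ncard := by
  choose! σ hσ using fun c (hc : c ∈ jStab (omg p)) ↦ exists_lat_of_mem_jStab hc
  rw [ncard_jStab_sqm_aux p hp hN hfin hσ]
  split_ifs with hE
  · choose! e he he' using fun c hc ↦ existsUnique_not_stab_subLat p hN hE (hσ c hc).2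
    have : {q : ℂ × Fin 3 | q.1 ∈ jStab (omg p) ∧ ¬ Stab (omg p) (subLat (σ q.1) q.2)} =
        (fun c ↦ (c, e c)) '' jStab (omg p) := by
      ext ⟨c, i⟩
      constructor
      · rintro ⟨hc, hi⟩
        exact ⟨c, hc, Prod.ext rfl (he' c hc i hi).symm⟩
      · rintro ⟨c, hc, h⟩
        obtain ⟨rfl, rfl⟩ := Prod.mk.inj h
        exact ⟨hc, he c hc⟩
    rw [this, Set.ncard_image_of_injective _ fun c c' h ↦ (Prod.mk.inj h).1]
    ring
  · have : {q : ℂ × Fin 3 | q.1 ∈ jStab (omg p) ∧ ¬ Stab (omg p) (subLat (σ q.1) q.2)} =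
        jStab (omg p) ×ˢ Set.univ := by
      ext ⟨c, i⟩
      simp only [Set.mem_ofPred_eq, Set.mem_prod, Set.mem_univ, and_true, and_iff_left_iff_imp]
      exact fun hc ↦ not_stab_subLat_of_odd p hN (Int.not_even_iff_odd.mp hE) (hσ c hc).2 i
    rw [this, Set.ncard_prod, Set.ncard_univ]
    simp
    ring

end SSP

namespace SSP

open Function NumberField IntermediateField

lemma exists_rat_of_mem_adjoin {x : ℂ} (hx : x ∈ adjoin ℚ {sqm p}) :
    ∃ a b : ℚ, x = a + b * sqm p := by
  have hs := sqm_mul_self p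
  induction hx using adjoin_induction with
  | mem x hx =>
    rw [Set.mem_singleton_iff] at hx
    exact ⟨0, 1, by simp [hx]⟩
  | algebraMap x => exact ⟨x, 0, by simp⟩
  | add x y _ _ h h' =>
    obtain ⟨a, b, rfl⟩ := h
    obtain ⟨a', b', rfl⟩ := h'
    exact ⟨a + a', b + b', by push_cast; ring⟩
  | mul x y _ _ h h' =>
    obtain ⟨a, b, rfl⟩ := h
    obtain ⟨a', b', rfl⟩ := h'
    refine ⟨a * a' - p * (b * b'), a * b' + a' * b, ?_⟩
    push_cast
    linear_combination (b * b' : ℂ) * hs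
  | inv x _ h =>
    obtain ⟨a, b, rfl⟩ := h
    rcases eq_or_ne (a + b * sqm p : ℂ) 0 with h0 | h0
    · exact ⟨0, 0, by simp [h0]⟩
    · have h1 : (a * a + p * (b * b) : ℂ) ≠ 0 := by
        intro h1
        have h2 : a * a + p * (b * b) = 0 := by exact_mod_cast h1
        have hp : (0 : ℚ) < p := by exact_mod_cast (Fact.out : p.Prime).pos
        have ha : a = 0 := by nlinarith [mul_self_nonneg a, mul_nonneg hp.le (mul_self_nonneg b)]
        have hb : b = 0 := by
          subst ha
          simpa [hp.ne'] using h2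
        simp [ha, hb] at h0
      refine ⟨a / (a * a + p * (b * b)), -b / (a * a + p * (b * b)), ?_⟩
      push_cast
      refine inv_eq_of_mul_eq_one_right ?_
      linear_combination (-b * b * (a * a + p * (b * b) : ℂ)⁻¹) * hs + mul_inv_cancel₀ h1

lemma exists_int_of_isIntegral {a : ℚ} (h : IsIntegral ℤ (a : ℂ)) : ∃ n : ℤ, a = n := by
  have h1 : IsIntegral ℤ a := by
    rw [← isIntegral_algebraMap_iff (B := ℂ) (algebraMap ℚ ℂ).injective]
    exact h
  obtain ⟨n, hn⟩ := (IsIntegrallyClosed.isIntegral_iff (R := ℤ)).mp h1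
  exact ⟨n, by rw [← hn]; simp⟩

/-- Half-integral coordinates of the integers of `ℚ(√-p)`. -/
lemma exists_half_coords {a b : ℚ} (h : IsIntegral ℤ (a + b * sqm p : ℂ)) :
    ∃ A C B : ℤ, A * A + p * (C * C) = 4 * B ∧ 2 * (a + b * sqm p : ℂ) = A + C * sqm p := by
  have hs := sqm_mul_self p
  have hp : (p : ℚ) ≠ 0 := by exact_mod_cast (Fact.out : p.Prime).ne_zero
  have hconj : IsIntegral ℤ (a - b * sqm p : ℂ) := by
    have h3 : starRingEnd ℂ (a + b * sqm p) = a - b * sqm p := by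
      simp [sqm, sub_eq_add_neg]
    rw [← h3]
    exact h.map (starRingEnd ℂ).toIntAlgHom
  obtain ⟨A, hA⟩ := exists_int_of_isIntegral (a := 2 * a) (by
    rw [show ((2 * a : ℚ) : ℂ) = (a + b * sqm p) + (a - b * sqm p) by push_cast; ring]
    exact h.add hconj)
  obtain ⟨B, hB⟩ := exists_int_of_isIntegral (a := a * a + p * (b * b)) (by
    rw [show ((a * a + p * (b * b) : ℚ) : ℂ) = (a + b * sqm p) * (a - b * sqm p) by
      push_cast; linear_combination (b * b : ℂ) * hs]
    exact h.mul hconj)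
  have hsq : (p * (2 * b)) ^ 2 = ((p * (4 * B - A * A) : ℤ) : ℚ) := by
    push_cast
    rw [← hA, ← hB]
    ring
  obtain ⟨C, hC⟩ : ∃ n : ℤ, p * (2 * b) = n := by
    obtain ⟨n, hn⟩ := (IsIntegrallyClosed.isIntegral_iff (R := ℤ)).mp
      (IsIntegral.of_pow (R := ℤ) (x := p * (2 * b)) two_pos (by
        rw [hsq]; exact isIntegral_algebraMap (R := ℤ)))
    exact ⟨n, by rw [← hn]; simp⟩
  have hC2 : C ^ 2 = p * (4 * B - A * A) := by
    rw [hC] at hsq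
    exact_mod_cast hsq
  obtain ⟨D, rfl⟩ : (p : ℤ) ∣ C :=
    (Nat.prime_iff_prime_int.mp Fact.out).dvd_of_dvd_pow (Dvd.intro _ hC2.symm)
  have hD : 2 * b = D := by
    push_cast at hC
    exact mul_left_cancel₀ hp hC
  refine ⟨A, D, B, ?_, ?_⟩
  · have : (A * A + p * (D * D) : ℚ) = 4 * B := by
      rw [← hA, ← hB, ← hD]
      ring
    exact_mod_cast this
  · have hA' : (2 * a : ℂ) = A := by exact_mod_cast hA
    have hD' : (2 * b : ℂ) = D := by exact_mod_cast hD
    linear_combination hA' + hD' * sqm p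

omit [Fact p.Prime] in
lemma isIntegral_sqm : IsIntegral ℤ (sqm p) := by
  refine IsIntegral.of_pow two_pos ?_
  rw [pow_two, sqm_mul_self]
  have := isIntegral_algebraMap (R := ℤ) (A := ℂ) (x := -p)
  simpa using this

omit [Fact p.Prime] in
lemma isIntegral_omg {N : ℤ} (hN : 4 * N = p + 1) : IsIntegral ℤ (omg p) := by
  refine ⟨X ^ 2 - X + C N, by monicity!, ?_⟩
  simp only [eval₂_add, eval₂_sub, eval₂_X_pow, eval₂_X, eval₂_C, eq_intCast (algebraMap ℤ ℂ)]
  linear_combination omg_mul_self p hN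

section

variable [NumberField (adjoin ℚ {sqm p})]

lemma classNumber_eq_ncard (θ : ℂ) (hmem : θ ∈ adjoin ℚ {sqm p}) (hθint : IsIntegral ℤ θ)
    (him : θ.im ≠ 0)
    (h : ∀ a b : ℚ, IsIntegral ℤ (a + b * sqm p : ℂ) →
      ∃ m n : ℤ, (a + b * sqm p : ℂ) = m * θ + n) :
    classNumber (adjoin ℚ {sqm p}) = (jStab θ).ncard := by
  let φ : adjoin ℚ {sqm p} →+* ℂ := algebraMap _ _
  have hφ : Injective φ := φ.injective
  let t : 𝓞 (adjoin ℚ {sqm p}) := ⟨⟨θ, hmem⟩, by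
    rw [mem_integralClosure_iff, ← isIntegral_algebraMap_iff (B := ℂ) hφ]
    exact hθint⟩
  refine classNumber_eq_ncard_jStab φ (θ := t) (fun x ↦ ?_) him
  obtain ⟨a, b, hab⟩ := exists_rat_of_mem_adjoin p (x : adjoin ℚ {sqm p}).2
  have hx : IsIntegral ℤ (φ x) := x.2.map (algebraMap (adjoin ℚ {sqm p}) ℂ).toIntAlgHom
  obtain ⟨m, n, hmn⟩ := h a b (by rw [← hab]; exact hx)
  refine ⟨m, n, embed_injective φ ?_⟩
  simp only [map_add, map_mul, map_intCast]
  exact hab.trans hmn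

lemma classNumber_eq_of_one_mod_four (h : p % 4 = 1) :
    classNumber (adjoin ℚ {sqm p}) = (jStab (sqm p)).ncard := by
  refine classNumber_eq_ncard p _ (mem_adjoin_simple_self ℚ _) (isIntegral_sqm p)
    (sqm_im_pos p).ne' fun a b hab ↦ ?_
  obtain ⟨A, C, B, h1, h2⟩ := exists_half_coords p hab
  obtain ⟨k, hk⟩ : ∃ k : ℤ, (p : ℤ) = 4 * k + 1 := ⟨p / 4, by omega⟩
  have h3 : A * A + C * C = 4 * (B - k * (C * C)) := by rw [hk] at h1; linear_combination h1
  have h4 : Even A ∧ Even C := by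
    rcases Int.even_or_odd' A with ⟨a', rfl | rfl⟩ <;> rcases Int.even_or_odd' C with ⟨c', rfl | rfl⟩
    · simp
    · ring_nf at h3; omega
    · ring_nf at h3; omega
    · ring_nf at h3; omega
  obtain ⟨⟨m, rfl⟩, n, rfl⟩ := h4
  refine ⟨n, m, ?_⟩
  push_cast at h2
  linear_combination h2 / 2

lemma classNumber_eq_of_three_mod_four {N : ℤ} (hN : 4 * N = p + 1) :
    classNumber (adjoin ℚ {sqm p}) = (jStab (omg p)).ncard := by
  have him : (omg p).im ≠ 0 := by
    have := (sqm_im_pos p).ne'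
    simpa [omg] using this
  have hmem : omg p ∈ adjoin ℚ {sqm p} :=
    div_mem (add_mem (one_mem _) (mem_adjoin_simple_self ℚ _)) (ofNat_mem _ 2)
  refine classNumber_eq_ncard p _ hmem (isIntegral_omg p hN) him fun a b hab ↦ ?_
  obtain ⟨A, C, B, h1, h2⟩ := exists_half_coords p hab
  have h3 : A * A - C * C = 4 * (B - N * (C * C)) := by
    linear_combination h1 + hN * (C * C)
  have h4 : Even (A - C) := by
    rcases Int.even_or_odd' A with ⟨a', rfl | rfl⟩ <;> rcases Int.even_or_odd' C with ⟨c', rfl | rfl⟩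
    · exact ⟨a' - c', by ring⟩
    · ring_nf at h3; omega
    · ring_nf at h3; omega
    · exact ⟨a' - c', by ring⟩
  obtain ⟨n, hn⟩ := h4
  obtain rfl : A = C + 2 * n := by linarith
  refine ⟨C, n, ?_⟩
  push_cast at h2
  rw [omg]
  linear_combination h2 / 2

end

end SSP

namespace SSP

lemma legendreSym_neg_two (hp : 5 ≤ p) :
    legendreSym p (-2) = if p % 8 = 1 ∨ p % 8 = 3 then 1 else -1 := by
  have hpp : p.Prime := Fact.out
  have h2 : p % 2 = 1 := hpp.mod_two_eq_one_iff_ne_two.mpr (by omega)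
  rw [legendreSym.at_neg_two (by omega), ZMod.χ₈'_nat_eq_if_mod_eight, if_neg (by omega)]

lemma two_mul_LL (hp : 5 ≤ p) : 2 * LL p = (jStab (sqm p)).ncard := by
  rw [← jf_image_cmPoints, (card_cmPoints p hp).2]

omit [Fact p.Prime] in
lemma numberField_adjoin : NumberField (IntermediateField.adjoin ℚ {sqm p}) :=
  have := IntermediateField.adjoin.finiteDimensional (K := ℚ) (isIntegral_sqm p).tower_top
  ⟨⟩

lemma two_mul_LL_of_one_mod_four (hp : 5 ≤ p) (h : p % 4 = 1) :
    2 * LL p = classNumberSqrtNeg p := by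
  rw [two_mul_LL p hp]
  have := numberField_adjoin p
  exact (classNumber_eq_of_one_mod_four p h).symm

lemma two_mul_LL_of_three_mod_four (hp : 5 ≤ p) (h : p % 4 = 3) :
    2 * LL p = (if p % 8 = 7 then 2 else 4) * classNumberSqrtNeg p := by
  obtain ⟨N, hN⟩ : ∃ N : ℤ, 4 * N = p + 1 := ⟨(p + 1) / 4, by omega⟩
  have hfin : (jStab (sqm p)).Finite := by
    rw [← jf_image_cmPoints]
    exact (card_cmPoints p hp).1
  have := numberField_adjoin p
  have hcl : classNumberSqrtNeg p = (jStab (omg p)).ncard :=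
    classNumber_eq_of_three_mod_four p hN
  rw [two_mul_LL p hp, ncard_jStab_sqm p hp hN hfin, hcl]
  have : Even N ↔ p % 8 = 7 := by
    rw [Int.even_iff]
    omega
  simp only [this]

end SSP

/-- For every prime p ≥ 5, the number L(p) of distinct roots of ss_p(X) in 𝔽_p equals
(1/4)·(2 + (1 − (−1|p))·(2 + (−2|p)))·h(√−p). -/
theorem number_of_linear_factors_of_ssp (hp : 5 ≤ p) :
    (LL p : ℚ) =
      1 / 4 * (2 + (1 - (legendreSym p (-1) : ℚ)) * (2 + (legendreSym p (-2) : ℚ))) *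
        (classNumberSqrtNeg p : ℚ) := by
  have hpp : p.Prime := Fact.out
  have h2 : p % 2 = 1 := hpp.mod_two_eq_one_iff_ne_two.mpr (by omega)
  rw [SSP.legendreSym_neg_one p hp, SSP.legendreSym_neg_two p hp]
  by_cases h1 : p % 4 = 1
  · have h : (2 * LL p : ℚ) = classNumberSqrtNeg p := by
      exact_mod_cast SSP.two_mul_LL_of_one_mod_four p hp h1
    rw [if_pos h1]
    push_cast
    linarith
  · have h3 : p % 4 = 3 := by omega
    have h := SSP.two_mul_LL_of_three_mod_four p hp h3
    rw [if_neg h1]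
    by_cases h7 : p % 8 = 7
    · rw [if_pos h7] at h
      have h' : (2 * LL p : ℚ) = 2 * classNumberSqrtNeg p := by exact_mod_cast h
      rw [if_neg (by omega)]
      push_cast
      linarith
    · rw [if_neg h7] at h
      have h' : (2 * LL p : ℚ) = 4 * classNumberSqrtNeg p := by exact_mod_cast h
      rw [if_pos (by omega)]
      push_cast
      linarith
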